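/- arXiv:1907.02914 — 4 statements merged into one kernel-verified Lean document; each statement's English description precedes it below -/
import Mathlib

section
/- Let S be a set of rational prime numbers possessing a natural density δ(S) within the primes. Then the limit lim_{X→∞} Σ_{2 ≤ n ≤ X, p_min(n) ∈ S} μ(n)/n exists and equals −δ(S), where the sum runs over integers n ≥ 2 whose smallest prime factor p_min(n) lies in S. -/
open Filter ArithmeticFunction

noncomputable section

namespace AlladiGen


open MeasureTheory FourierTransform SchwartzMap in
lemma exists_kernel : ∃ K φ : ℝ → ℂ, Continuous K ∧ HasCompactSupport K ∧
    (∀ w, φ w = ∫ v, (Real.fourierChar (-(v * w)) : ℂ) * K v) ∧ Continuous φ ∧ Integrable φ ∧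
    Integrable (fun u => |u| * ‖φ u‖) ∧ ∫ u, φ u = 1 := by
  let b : ContDiffBump (0 : ℝ) := ⟨1, 2, by norm_num, by norm_num⟩
  let K : ℝ → ℂ := fun x => (b x : ℂ)
  have hK1 : HasCompactSupport K := b.hasCompactSupport.comp_left (g := fun x : ℝ => (x : ℂ)) (by simp)
  have hK2 : ContDiff ℝ (⊤ : ℕ∞) K := by
    have := b.contDiff (n := (⊤ : ℕ∞))
    exact Complex.ofRealCLM.contDiff.comp this
  let Ks : 𝓢(ℝ, ℂ) := hK1.toSchwartzMap hK2
  have hKs : ∀ x, Ks x = K x := fun x => rfl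
  let φ : 𝓢(ℝ, ℂ) := 𝓕 Ks
  refine ⟨K, φ, hK2.continuous, hK1, ?_, φ.continuous, φ.integrable, ?_, ?_⟩
  · intro w
    have : (φ : ℝ → ℂ) = 𝓕 (Ks : ℝ → ℂ) := by
      exact (SchwartzMap.fourier_coe Ks).symm ▸ rfl
    rw [this, Real.fourier_real_eq]
    rfl
  · simpa using φ.integrable_pow_mul volume 1
  · have h1 : 𝓕⁻ φ = Ks := by simp [φ]
    have h2 : (𝓕⁻ (φ : ℝ → ℂ)) 0 = Ks 0 := by
      rw [← SchwartzMap.fourierInv_coe, h1]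
    rw [Real.fourierInv_eq'] at h2
    simp only [inner_zero_right, mul_zero, Complex.ofReal_zero, zero_mul, Complex.exp_zero, one_smul] at h2
    rw [h2, hKs]
    simp [K]
    apply b.one_of_mem_closedBall
    simp [b]

def zinv : ℂ → ℂ := Function.update (fun s => (s * riemannZeta s)⁻¹) 1 0

lemma zinv_continuousAt {s : ℂ} (hs : 1 ≤ s.re) : ContinuousAt zinv s := by
  have hs0 : s ≠ 0 := by rintro rfl; norm_num at hs
  by_cases h : s = 1
  · subst h
    rw [zinv, continuousAt_update_same]
    have h1 := riemannZeta_residue_one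
    have h2 : Tendsto (fun s : ℂ => (s - 1) / s) (nhdsWithin 1 {1}ᶜ) (nhds 0) := by
      have : ContinuousAt (fun s : ℂ => (s - 1) / s) 1 := by
        fun_prop (disch := norm_num)
      simpa using this.tendsto.mono_left nhdsWithin_le_nhds
    have h3 := h2.mul (h1.inv₀ one_ne_zero)
    rw [zero_mul] at h3
    refine h3.congr' ?_
    filter_upwards [self_mem_nhdsWithin] with z hz
    have : z - 1 ≠ 0 := sub_ne_zero.mpr hz
    rw [mul_inv, mul_inv]
    field_simp
  · rw [zinv, continuousAt_update_of_ne h]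
    have := (differentiableAt_riemannZeta h).continuousAt
    have hz := riemannZeta_ne_zero_of_one_le_re hs
    exact (continuousAt_id.mul this).inv₀ (mul_ne_zero hs0 hz)

def mert (x : ℝ) : ℝ := ∑ k ∈ Finset.Icc 1 ⌊x⌋₊, (moebius k : ℝ)

def mf (u : ℝ) : ℝ := mert (Real.exp u) * Real.exp (-u)

lemma mert_diff {x y : ℝ} (hx : 0 ≤ x) (hxy : x ≤ y) : |mert y - mert x| ≤ y - x + 1 := by
  have h := Nat.floor_le_floor hxy
  have h1 : mert y - mert x = ∑ k ∈ Finset.Ioc ⌊x⌋₊ ⌊y⌋₊, (moebius k : ℝ) := by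
    unfold mert
    rw [sub_eq_iff_eq_add, add_comm]
    have e : ∀ n : ℕ, Finset.Icc 1 n = Finset.Ioc 0 n := fun n => by ext; simp; lia
    rw [e, e, Finset.sum_Ioc_consecutive _ (Nat.zero_le _) h]
  rw [h1]
  refine (Finset.abs_sum_le_sum_abs _ _).trans ?_
  have : ∀ k ∈ Finset.Ioc ⌊x⌋₊ ⌊y⌋₊, |(moebius k : ℝ)| ≤ 1 := fun k _ => by
    exact_mod_cast abs_moebius_le_one
  refine (Finset.sum_le_card_nsmul _ _ _ this).trans ?_
  rw [Nat.card_Ioc, nsmul_eq_mul, mul_one, Nat.cast_sub h]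
  have := Nat.floor_le (hx.trans hxy)
  have := Nat.lt_floor_add_one x
  linarith

lemma mert_bound {x : ℝ} (hx : 0 ≤ x) : |mert x| ≤ x := by
  unfold mert
  refine (Finset.abs_sum_le_sum_abs _ _).trans ?_
  have : ∀ k ∈ Finset.Icc 1 ⌊x⌋₊, |(moebius k : ℝ)| ≤ 1 := fun k _ => by
    exact_mod_cast abs_moebius_le_one
  refine (Finset.sum_le_card_nsmul _ _ _ this).trans ?_
  simpa using Nat.floor_le hx

lemma mf_bound (u : ℝ) : |mf u| ≤ 1 := by
  rw [mf, abs_mul, abs_of_pos (Real.exp_pos _)]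
  calc _ ≤ Real.exp u * Real.exp (-u) := by gcongr; exact mert_bound (Real.exp_pos _).le
    _ = 1 := by rw [← Real.exp_add]; simp

lemma mf_neg {u : ℝ} (hu : u < 0) : mf u = 0 := by
  have : ⌊Real.exp u⌋₊ = 0 := by
    rw [Nat.floor_eq_zero]; simpa using hu
  simp [mf, mert, this]

lemma mf_measurable : Measurable mf := by
  have h : Measurable mert := by
    unfold mert
    exact (measurable_from_nat (f := fun n : ℕ => ∑ k ∈ Finset.Icc 1 n, (moebius k : ℝ))).comp Nat.measurable_floor
  unfold mf
  exact (h.comp Real.measurable_exp).mul (Real.measurable_exp.comp measurable_neg)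

lemma mf_diff_aux {s t : ℝ} (h : s ≤ t) : |mf t - mf s| ≤ 2 * (t - s) + Real.exp (-t) := by
  have e : mf t - mf s = (mert (Real.exp t) - mert (Real.exp s)) * Real.exp (-t)
      + mert (Real.exp s) * (Real.exp (-t) - Real.exp (-s)) := by unfold mf; ring
  have h1 := mert_diff (Real.exp_pos s).le (Real.exp_le_exp.mpr h)
  have h2 := mert_bound (Real.exp_pos s).le
  have h3 : Real.exp (-t) ≤ Real.exp (-s) := Real.exp_le_exp.mpr (by linarith)
  have h4 : 1 - (t - s) ≤ Real.exp (s - t) := by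
    have := Real.add_one_le_exp (s - t); linarith
  have e1 : Real.exp t * Real.exp (-t) = 1 := by rw [← Real.exp_add]; simp
  have e2 : Real.exp s * Real.exp (-s) = 1 := by rw [← Real.exp_add]; simp
  have e3 : Real.exp s * Real.exp (-t) = Real.exp (s - t) := by rw [← Real.exp_add, sub_eq_add_neg]
  rw [e]
  refine (abs_add_le _ _).trans ?_
  rw [abs_mul, abs_mul, abs_of_pos (Real.exp_pos (-t)), abs_of_nonpos (by linarith : Real.exp (-t) - Real.exp (-s) ≤ 0)]
  have a1 := mul_le_mul_of_nonneg_right h1 (Real.exp_pos (-t)).le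
  have a2 := mul_le_mul_of_nonneg_right h2 (by linarith : 0 ≤ -(Real.exp (-t) - Real.exp (-s)))
  nlinarith

lemma mf_diff (s t : ℝ) : |mf t - mf s| ≤ 2 * |t - s| + Real.exp (-t) := by
  rcases le_total s t with h | h
  · rw [abs_of_nonneg (by linarith : 0 ≤ t - s)]; exact mf_diff_aux h
  · rw [abs_sub_comm, abs_of_nonpos (by linarith : t - s ≤ 0)]
    have := mf_diff_aux h
    have : Real.exp (-s) ≤ Real.exp (-t) := Real.exp_le_exp.mpr (by linarith)
    linarith

open MeasureTheory in
lemma mf_laplace {σ : ℝ} (hσ : 0 < σ) (y : ℝ) :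
    ∫ u, (mf u : ℂ) * Complex.exp (-(σ + y * Complex.I) * u) = zinv (1 + σ + y * Complex.I) := by
  set s : ℂ := 1 + σ + y * Complex.I with hs
  have hre : s.re = 1 + σ := by simp [hs]
  have h1s : 1 < s.re := by rw [hre]; linarith
  have hs1 : s ≠ 1 := by rintro h; rw [h] at h1s; simp at h1s
  have hs0 : s ≠ 0 := by rintro h; rw [h] at h1s; norm_num at h1s
  have hL := LSeries_eq_mul_integral' (fun n => ((moebius n : ℤ) : ℂ)) zero_le_one h1s (by
    refine Asymptotics.isBigO_of_le _ fun n => ?_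
    rw [Real.norm_of_nonneg (Finset.sum_nonneg fun _ _ => norm_nonneg _)]
    have : ∀ k ∈ Finset.Icc 1 n, ‖((moebius k : ℤ) : ℂ)‖ ≤ 1 := fun k _ => by
      rw [Complex.norm_intCast]; exact_mod_cast abs_moebius_le_one
    refine (Finset.sum_le_card_nsmul _ _ _ this).trans ?_
    simp)
  have hz := LSeries_one_mul_Lseries_moebius h1s
  rw [LSeries_one_eq_riemannZeta h1s] at hz
  rw [hL] at hz
  have hζ := riemannZeta_ne_zero_of_one_le_re h1s.le
  rw [zinv, Function.update_of_ne hs1]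
  have hI : ∫ t in Set.Ioi (1 : ℝ), (∑ k ∈ Finset.Icc 1 ⌊t⌋₊, ((moebius k : ℤ) : ℂ)) * (t : ℂ) ^ (-(s + 1)) = (s * riemannZeta s)⁻¹ := by
    apply eq_inv_of_mul_eq_one_left; linear_combination hz
  rw [← hI]
  have himg : Real.exp '' (Set.Ioi 0) = Set.Ioi 1 := by
    ext x; constructor
    · rintro ⟨u, hu, rfl⟩; simpa using hu
    · intro hx
      refine ⟨Real.log x, Real.log_pos hx, Real.exp_log (by linarith [Set.mem_Ioi.mp hx])⟩
  rw [← himg, integral_image_eq_integral_abs_deriv_smul measurableSet_Ioi (fun x _ => (Real.hasDerivAt_exp x).hasDerivWithinAt) Real.exp_injective.injOn]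
  have h0 : ∫ u, (mf u : ℂ) * Complex.exp (-(σ + y * Complex.I) * u) = ∫ u in Set.Ici (0:ℝ), (mf u : ℂ) * Complex.exp (-(σ + y * Complex.I) * u) := by
    symm
    apply setIntegral_eq_integral_of_forall_compl_eq_zero
    intro x hx
    rw [mf_neg (by simpa using hx)]; simp
  rw [h0, integral_Ici_eq_integral_Ioi]
  refine setIntegral_congr_fun measurableSet_Ioi fun u _ => ?_
  simp only [abs_of_pos (Real.exp_pos u), mf, mert]
  have : ((Real.exp u : ℝ) : ℂ) ^ (-(s + 1)) = Complex.exp (-(s+1) * u) := by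
    rw [Complex.ofReal_exp, Complex.cpow_def_of_ne_zero (Complex.exp_ne_zero _), ← Complex.ofReal_exp, ← Complex.ofReal_log (Real.exp_pos _).le, Real.log_exp, mul_comm]
  rw [this, Complex.real_smul]
  push_cast
  rw [mul_left_comm, ← Complex.exp_add, mul_assoc, ← Complex.exp_add, hs]
  congr 2
  ring

open MeasureTheory in
lemma smoothed_eq_sigma {K φ : ℝ → ℂ} (hK : Continuous K) (hKc : HasCompactSupport K)
    (hφ : ∀ w, φ w = ∫ v, (Real.fourierChar (-(v * w)) : ℂ) * K v) (lam T : ℝ)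
    {σ : ℝ} (hσ : 0 < σ) :
    ∫ u, (mf u : ℂ) * Complex.exp (-σ * u) * φ (lam * (u - T)) =
      ∫ v, (Real.fourierChar (v * (lam * T)) : ℂ) * K v *
        zinv (1 + σ + ((2 * Real.pi * lam * v : ℝ) : ℂ) * Complex.I) := by
  have hg : Integrable (fun u : ℝ => (mf u : ℂ) * Complex.exp (-σ * u)) := by
    have h1 : IntegrableOn (fun u : ℝ => Real.exp (-σ * u)) (Set.Ici 0) := by
      rw [integrableOn_Ici_iff_integrableOn_Ioi]
      exact exp_neg_integrableOn_Ioi 0 hσ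
    have h2 := (integrable_indicator_iff measurableSet_Ici).mpr h1
    refine h2.mono' ?_ (Eventually.of_forall fun u => ?_)
    · refine Measurable.aestronglyMeasurable ?_
      exact (Complex.measurable_ofReal.comp mf_measurable).mul (by fun_prop)
    · by_cases hu : 0 ≤ u
      · rw [Set.indicator_of_mem (by simpa using hu)]
        rw [norm_mul, Complex.norm_real, Complex.norm_exp]
        have : ((-σ : ℂ) * u).re = -σ * u := by simp
        rw [this]
        have := mf_bound u
        rw [Real.norm_eq_abs]
        nlinarith [Real.exp_pos (-σ * u)]
      · rw [mf_neg (by simpa using hu)]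
        simp only [Complex.ofReal_zero, zero_mul, norm_zero]
        exact Set.indicator_nonneg (fun _ _ => (Real.exp_pos _).le) _
  have hKi : Integrable K := hK.integrable_of_hasCompactSupport hKc
  have hprod : Integrable (Function.uncurry fun u v : ℝ => (mf u : ℂ) * Complex.exp (-σ * u) *
      ((Real.fourierChar (-(v * (lam * (u - T)))) : ℂ) * K v)) (volume.prod volume) := by
    have h := (hg.mul_prod hKi)
    have hc : Continuous fun z : ℝ × ℝ => (Real.fourierChar (-(z.2 * (lam * (z.1 - T)))) : ℂ) := by
      have := Real.continuous_fourierChar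
      fun_prop
    refine h.mono ?_ (Eventually.of_forall fun z => ?_)
    · refine (h.aestronglyMeasurable.mul hc.aestronglyMeasurable).congr (Eventually.of_forall fun z => ?_)
      simp only [Function.uncurry, Pi.mul_apply]; ring
    · simp only [Function.uncurry]
      rw [norm_mul _ (_ * _), norm_mul (Real.fourierChar _ : ℂ), Circle.norm_coe, one_mul, ← norm_mul]
  have h1 : ∀ u : ℝ, (mf u : ℂ) * Complex.exp (-σ * u) * φ (lam * (u - T)) =
      ∫ v, (mf u : ℂ) * Complex.exp (-σ * u) *
      ((Real.fourierChar (-(v * (lam * (u - T)))) : ℂ) * K v) := fun u => by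
    rw [hφ, integral_const_mul]
  simp_rw [h1]
  rw [integral_integral_swap hprod]
  congr 1 with v
  rw [← mf_laplace hσ, ← integral_const_mul]
  congr 1 with u
  rw [Real.fourierChar_apply, Real.fourierChar_apply]
  have : ∀ a b c d e f : ℂ, b * c = d * f → a * b * (c * e) = d * e * (a * f) := by
    intro a b c d e f h; linear_combination a * e * h
  apply this
  rw [← Complex.exp_add, ← Complex.exp_add]
  congr 1
  push_cast
  ring

open MeasureTheory in
lemma smoothed_eq {K φ : ℝ → ℂ} (hK : Continuous K) (hKc : HasCompactSupport K)
    (hφ : ∀ w, φ w = ∫ v, (Real.fourierChar (-(v * w)) : ℂ) * K v) 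
    (hφi : Integrable φ) {lam : ℝ} (hlam : 0 < lam) (T : ℝ) :
    ∫ u, (mf u : ℂ) * φ (lam * (u - T)) =
      ∫ v, (Real.fourierChar (v * (lam * T)) : ℂ) * K v *
        zinv (1 + ((2 * Real.pi * lam * v : ℝ) : ℂ) * Complex.I) := by
  have hφi' : Integrable fun u => φ (lam * (u - T)) :=
    ((integrable_comp_mul_left_iff φ hlam.ne').mpr hφi).comp_sub_right T
  have L : Tendsto (fun σ : ℝ => ∫ u, (mf u : ℂ) * Complex.exp (-σ * u) * φ (lam * (u - T)))
      (nhdsWithin 0 (Set.Ioi 0)) (nhds (∫ u, (mf u : ℂ) * φ (lam * (u - T)))) := by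
    refine tendsto_integral_filter_of_dominated_convergence (fun u => ‖φ (lam * (u - T))‖) ?_ ?_ hφi'.norm ?_
    · refine Eventually.of_forall fun σ => ?_
      refine AEStronglyMeasurable.mul ?_ hφi'.aestronglyMeasurable
      exact ((Complex.measurable_ofReal.comp mf_measurable).mul (by fun_prop)).aestronglyMeasurable
    · filter_upwards [self_mem_nhdsWithin] with σ hσ
      refine Eventually.of_forall fun u => ?_
      by_cases hu : 0 ≤ u
      · rw [norm_mul, norm_mul, Complex.norm_real, Complex.norm_exp]
        have : ((-σ : ℂ) * u).re = -σ * u := by simp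
        rw [this]
        have h1 := mf_bound u
        have h2 : Real.exp (-σ * u) ≤ 1 := by
          rw [Real.exp_le_one_iff]; nlinarith [Set.mem_Ioi.mp hσ]
        rw [Real.norm_eq_abs]
        have h3 : |mf u| * Real.exp (-σ * u) ≤ 1 := mul_le_one₀ h1 (Real.exp_pos _).le h2
        exact mul_le_of_le_one_left (norm_nonneg _) h3
      · rw [mf_neg (by simpa using hu)]
        simp
    · refine Eventually.of_forall fun u => ?_
      have hc : Continuous fun σ : ℝ => (mf u : ℂ) * Complex.exp (-σ * u) * φ (lam * (u - T)) := by fun_prop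
      have := (hc.tendsto 0).mono_left (nhdsWithin_le_nhds (s := Set.Ioi 0))
      simpa using this
  have R : Tendsto (fun σ : ℝ => ∫ v, (Real.fourierChar (v * (lam * T)) : ℂ) * K v *
        zinv (1 + σ + ((2 * Real.pi * lam * v : ℝ) : ℂ) * Complex.I))
      (nhdsWithin 0 (Set.Ioi 0)) (nhds (∫ v, (Real.fourierChar (v * (lam * T)) : ℂ) * K v *
        zinv (1 + ((2 * Real.pi * lam * v : ℝ) : ℂ) * Complex.I))) := by
    have hcomp : IsCompact (Set.Icc (0:ℝ) 1 ×ˢ tsupport K) := isCompact_Icc.prod hKc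
    have hcz : ∀ σ : ℝ, 0 ≤ σ → ∀ v : ℝ, ContinuousAt zinv (1 + σ + ((2 * Real.pi * lam * v : ℝ) : ℂ) * Complex.I) := by
      intro σ hσ v
      apply zinv_continuousAt
      simp [hσ]
    have hcont : ContinuousOn (fun z : ℝ × ℝ => zinv (1 + z.1 + ((2 * Real.pi * lam * z.2 : ℝ) : ℂ) * Complex.I)) (Set.Icc (0:ℝ) 1 ×ˢ tsupport K) := by
      intro z hz
      have := hcz z.1 hz.1.1 z.2
      have h2 : ContinuousAt (fun z : ℝ × ℝ => (1 + z.1 + ((2 * Real.pi * lam * z.2 : ℝ) : ℂ) * Complex.I)) z := by fun_prop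
      exact (ContinuousAt.comp (f := fun z : ℝ × ℝ => (1 + z.1 + ((2 * Real.pi * lam * z.2 : ℝ) : ℂ) * Complex.I)) (g := zinv) this h2).continuousWithinAt
    obtain ⟨C, hC⟩ := hcomp.exists_bound_of_continuousOn hcont
    refine tendsto_integral_filter_of_dominated_convergence (fun v => C * ‖K v‖) ?_ ?_
      ((hK.integrable_of_hasCompactSupport hKc).norm.const_mul C) ?_
    · filter_upwards [self_mem_nhdsWithin] with σ hσ
      refine Continuous.aestronglyMeasurable ?_
      have h1 : Continuous fun v : ℝ => zinv (1 + σ + ((2 * Real.pi * lam * v : ℝ) : ℂ) * Complex.I) := by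
        rw [continuous_iff_continuousAt]
        intro v
        have h2 : ContinuousAt (fun v : ℝ => (1 + σ + ((2 * Real.pi * lam * v : ℝ) : ℂ) * Complex.I)) v := by fun_prop
        exact ContinuousAt.comp (f := fun v : ℝ => (1 + σ + ((2 * Real.pi * lam * v : ℝ) : ℂ) * Complex.I)) (g := zinv) (hcz σ (le_of_lt hσ) v) h2
      have := Real.continuous_fourierChar
      fun_prop
    · filter_upwards [Ioo_mem_nhdsGT (zero_lt_one (α := ℝ))] with σ hσ
      refine Eventually.of_forall fun v => ?_
      by_cases hv : v ∈ tsupport K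
      · have := hC (σ, v) ⟨⟨hσ.1.le, hσ.2.le⟩, hv⟩
        rw [norm_mul, norm_mul, Circle.norm_coe, one_mul, mul_comm]
        gcongr
      · rw [image_eq_zero_of_notMem_tsupport hv]; simp
    · refine Eventually.of_forall fun v => ?_
      refine Tendsto.const_mul _ ?_
      have h1 : ContinuousAt zinv (1 + ((2 * Real.pi * lam * v : ℝ) : ℂ) * Complex.I) := by
        simpa using hcz 0 le_rfl v
      refine h1.tendsto.comp ?_
      have hc : Continuous fun σ : ℝ => (1 + (σ : ℂ) + ((2 * Real.pi * lam * v : ℝ) : ℂ) * Complex.I) := by fun_prop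
      have := (hc.tendsto 0).mono_left (nhdsWithin_le_nhds (s := Set.Ioi 0))
      simpa using this
  refine tendsto_nhds_unique L (R.congr' ?_)
  filter_upwards [self_mem_nhdsWithin] with σ hσ
  exact (smoothed_eq_sigma hK hKc hφ lam T hσ).symm

open MeasureTheory in
lemma mf_tendsto : Tendsto mf atTop (nhds 0) := by
  obtain ⟨K, φ, hK, hKc, hφ, hφc, hφi, hφ1, hφint⟩ := exists_kernel
  have hsm : ∀ lam : ℝ, 0 < lam → Tendsto (fun T : ℝ => ∫ u, (mf u : ℂ) * φ (lam * (u - T))) atTop (nhds 0) := by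
    intro lam hlam
    have h := Real.tendsto_integral_exp_smul_cocompact (fun v : ℝ => K v *
        zinv (1 + ((2 * Real.pi * lam * v : ℝ) : ℂ) * Complex.I))
    have h2 : Tendsto (fun T : ℝ => -(lam * T)) atTop (cocompact ℝ) :=
      (tendsto_neg_atTop_atBot.comp (tendsto_id.const_mul_atTop hlam)).mono_right atBot_le_cocompact
    refine (h.comp h2).congr fun T => ?_
    rw [smoothed_eq hK hKc hφ hφi hlam]
    simp only [Function.comp]
    congr 1 with v
    rw [mul_neg, neg_neg, Circle.smul_def, smul_eq_mul, mul_assoc (Real.fourierChar _ : ℂ)]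
  set C0 := ∫ u, ‖φ u‖
  set C1 := ∫ u, |u| * ‖φ u‖
  have hC0 : 0 ≤ C0 := integral_nonneg fun _ => norm_nonneg _
  have hC1 : 0 ≤ C1 := integral_nonneg fun _ => by positivity
  have key : ∀ lam : ℝ, 0 < lam → ∀ T : ℝ, |mf T| ≤ lam * ‖∫ u, (mf u : ℂ) * φ (lam * (u - T))‖
      + 2 * C1 / lam + C0 * Real.exp (-T) := by
    intro lam hlam T
    have hφi' : Integrable fun u => φ (lam * (u - T)) :=
      ((integrable_comp_mul_left_iff φ hlam.ne').mpr hφi).comp_sub_right T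
    have hI : ∀ (E : Type) [NormedAddCommGroup E] [NormedSpace ℝ E] (g : ℝ → E), ∫ u, g (lam * (u - T)) = lam⁻¹ • ∫ u, g u := by
      intro E _ _ g
      rw [integral_sub_right_eq_self (fun u => g (lam * u)) T, Measure.integral_comp_mul_left, abs_of_pos (inv_pos.mpr hlam)]
    have i1 : ∫ u, φ (lam * (u - T)) = (lam⁻¹ : ℝ) := by
      rw [hI, hφint]; simp
    have i2 : ∫ u, ‖φ (lam * (u - T))‖ = lam⁻¹ * C0 := by
      rw [hI ℝ (fun u => ‖φ u‖)]; rfl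
    have i3 : ∫ u, |u - T| * ‖φ (lam * (u - T))‖ = lam⁻¹ * (lam⁻¹ * C1) := by
      have := hI ℝ (fun u => |u| * ‖φ u‖)
      rw [smul_eq_mul] at this
      rw [← this, ← integral_const_mul]
      congr 1 with u
      rw [abs_mul, abs_of_pos hlam]; field_simp
    have hi3 : Integrable fun u => |u - T| * ‖φ (lam * (u - T))‖ := by
      have : Integrable fun u => (fun u => |u| * ‖φ u‖) (lam * (u - T)) :=
        ((integrable_comp_mul_left_iff _ hlam.ne').mpr hφ1).comp_sub_right T
      refine (this.const_mul lam⁻¹).congr (Eventually.of_forall fun u => ?_)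
      simp only
      rw [abs_mul, abs_of_pos hlam]; field_simp
    have hi1 : Integrable fun u => (mf u : ℂ) * φ (lam * (u - T)) := by
      refine hφi'.mono ?_ (Eventually.of_forall fun u => ?_)
      · exact (Complex.measurable_ofReal.comp mf_measurable).aestronglyMeasurable.mul hφi'.aestronglyMeasurable
      · rw [norm_mul, Complex.norm_real]
        exact mul_le_of_le_one_left (norm_nonneg _) (mf_bound u)
    have e : (mf T : ℂ) * (lam⁻¹ : ℝ) = (∫ u, (mf u : ℂ) * φ (lam * (u - T)))
        + ∫ u, ((mf T : ℂ) - mf u) * φ (lam * (u - T)) := by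
      rw [← i1, ← integral_const_mul, ← integral_add hi1]
      · congr 1 with u; ring
      · simp_rw [sub_mul]
        exact (hφi'.const_mul _).sub hi1
    have b : ‖∫ u, ((mf T : ℂ) - mf u) * φ (lam * (u - T))‖ ≤
        2 * (lam⁻¹ * (lam⁻¹ * C1)) + Real.exp (-T) * (lam⁻¹ * C0) := by
      rw [← i2, ← i3, ← integral_const_mul, ← integral_const_mul, ← integral_add (hi3.const_mul _) (hφi'.norm.const_mul _)]
      refine norm_integral_le_of_norm_le ((hi3.const_mul _).add (hφi'.norm.const_mul _)) (Eventually.of_forall fun u => ?_)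
      rw [norm_mul, ← Complex.ofReal_sub, Complex.norm_real, Real.norm_eq_abs]
      have := mul_le_mul_of_nonneg_right (mf_diff u T) (norm_nonneg (φ (lam * (u - T))))
      rw [abs_sub_comm T u] at this
      linarith
    have h1 : |mf T| * lam⁻¹ ≤ ‖∫ u, (mf u : ℂ) * φ (lam * (u - T))‖ + (2 * (lam⁻¹ * (lam⁻¹ * C1)) + Real.exp (-T) * (lam⁻¹ * C0)) := by
      have : |mf T| * lam⁻¹ = ‖(mf T : ℂ) * (lam⁻¹ : ℝ)‖ := by
        rw [norm_mul, Complex.norm_real, Complex.norm_real, Real.norm_eq_abs, Real.norm_eq_abs, abs_of_pos (inv_pos.mpr hlam)]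
      rw [this, e]
      exact (norm_add_le _ _).trans (by gcongr)
    have h2 := mul_le_mul_of_nonneg_left h1 hlam.le
    have e2 : lam * (|mf T| * lam⁻¹) = |mf T| := by field_simp
    rw [e2] at h2
    refine h2.trans (le_of_eq ?_)
    field_simp
    ring
  rw [Metric.tendsto_atTop']
  intro ε hε
  set lam := (8 * (C1 + 1)) / ε
  have hlam : 0 < lam := by positivity
  have hh : Tendsto (fun T : ℝ => lam * ‖∫ u, (mf u : ℂ) * φ (lam * (u - T))‖ + C0 * Real.exp (-T)) atTop (nhds 0) := by
    have h1 := ((hsm lam hlam).norm).const_mul lam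
    have h2 := (Real.tendsto_exp_neg_atTop_nhds_zero).const_mul C0
    simpa using h1.add h2
  obtain ⟨N, hN⟩ := (Metric.tendsto_atTop'.mp hh) (ε / 2) (by positivity)
  refine ⟨N, fun T hT => ?_⟩
  have := hN T hT
  rw [Real.dist_eq, sub_zero] at this ⊢
  have h3 := key lam hlam T
  have h4 := (abs_lt.mp this).2
  have h5 : 2 * C1 / lam ≤ ε / 4 := by
    rw [div_le_iff₀ hlam]
    have : ε / 4 * lam = 2 * (C1 + 1) := by simp only [lam]; field_simp; ring
    linarith
  linarith

lemma mert_littleO : Tendsto (fun x : ℝ => mert x / x) atTop (nhds 0) := by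
  refine (mf_tendsto.comp Real.tendsto_log_atTop).congr' ?_
  filter_upwards [eventually_gt_atTop 0] with x hx
  simp [mf, Real.exp_log hx, Real.exp_neg, div_eq_mul_inv]

/-- `y`-rough numbers. -/
def Rough (y n : ℕ) : Prop := ∀ p, p.Prime → p ∣ n → y ≤ p

lemma rough_zero (n : ℕ) : Rough 0 n := fun _ _ _ => Nat.zero_le _

lemma rough_succ_iff {y n : ℕ} : Rough (y + 1) n ↔ Rough y n ∧ ¬ (y.Prime ∧ y ∣ n) := by
  constructor
  · intro h
    refine ⟨fun p hp hd => by have := h p hp hd; lia, fun ⟨h1, h2⟩ => ?_⟩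
    have := h y h1 h2; lia
  · rintro ⟨h, h2⟩ p hp hd
    have := h p hp hd
    rcases this.lt_or_eq with h3 | h3
    · exact h3
    · subst h3; exact absurd ⟨hp, hd⟩ h2

lemma minFac_eq_iff {p n : ℕ} (hp : p.Prime) : n.minFac = p ↔ Rough p n ∧ ¬ Rough (p + 1) n := by
  rw [rough_succ_iff]
  constructor
  · rintro rfl
    have h1 : n ≠ 1 := by rintro rfl; simp at hp; exact absurd hp (by norm_num)
    have h2 : Rough n.minFac n := fun q hq hd => Nat.minFac_le_of_dvd hq.two_le hd
    simp [h2, hp, Nat.minFac_dvd]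
  · rintro ⟨h1, h2⟩
    have h3 : p ∣ n := by tauto
    have h4 : n ≠ 1 := by rintro rfl; simp at h3; exact hp.one_lt.ne' h3
    have h5 := h1 _ (Nat.minFac_prime h4) (Nat.minFac_dvd n)
    exact le_antisymm (Nat.minFac_le_of_dvd hp.two_le h3) h5

open Classical in
def Mr (y N : ℕ) : ℝ := ∑ n ∈ Finset.Icc 1 N, if Rough y n then (moebius n : ℝ) else 0

lemma abs_moebius_real (n : ℕ) : |(moebius n : ℝ)| ≤ 1 := by exact_mod_cast abs_moebius_le_one

lemma abs_sum_le_card {a : ℕ → ℝ} (ha : ∀ n, |a n| ≤ 1) (N : ℕ) : |∑ n ∈ Finset.Icc 1 N, a n| ≤ N := by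
  refine (Finset.abs_sum_le_sum_abs _ _).trans ?_
  refine (Finset.sum_le_card_nsmul _ _ 1 fun n _ => ha n).trans ?_
  simp

lemma Mr_bound (y N : ℕ) : |Mr y N| ≤ N := by
  apply abs_sum_le_card
  intro n
  split_ifs
  · exact abs_moebius_real n
  · simp

lemma sum_multiples (g : ℕ → ℝ) {q : ℕ} (hq : 0 < q) (N : ℕ) :
    ∑ n ∈ Finset.Icc 1 N, (if q ∣ n then g n else 0) = ∑ m ∈ Finset.Icc 1 (N / q), g (q * m) := by
  rw [← Finset.sum_filter]
  symm
  refine Finset.sum_bij (fun m _ => q * m) ?_ ?_ ?_ ?_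
  · intro m hm
    simp only [Finset.mem_Icc, Finset.mem_filter] at hm ⊢
    refine ⟨⟨Nat.mul_pos hq hm.1, ?_⟩, dvd_mul_right _ _⟩
    have := (Nat.le_div_iff_mul_le hq).mp hm.2
    lia
  · intro a _ b _ h
    exact Nat.eq_of_mul_eq_mul_left hq h
  · intro n hn
    simp only [Finset.mem_Icc, Finset.mem_filter] at hn
    obtain ⟨m, rfl⟩ := hn.2
    refine ⟨m, ?_, rfl⟩
    simp only [Finset.mem_Icc]
    refine ⟨Nat.pos_of_mul_pos_left hn.1.1, ?_⟩
    rw [Nat.le_div_iff_mul_le hq]; lia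
  · intros; rfl

lemma Mr_rec {q : ℕ} (hq : q.Prime) (N : ℕ) : Mr (q + 1) N = Mr q N + Mr (q + 1) (N / q) := by
  classical
  have h1 : Mr q N = Mr (q + 1) N + ∑ n ∈ Finset.Icc 1 N, (if q ∣ n then (if Rough q n then (moebius n : ℝ) else 0) else 0) := by
    unfold Mr
    rw [← Finset.sum_add_distrib]
    refine Finset.sum_congr rfl fun n _ => ?_
    rw [rough_succ_iff]
    by_cases h : q ∣ n <;> simp [h, hq]
  have h2 : ∑ n ∈ Finset.Icc 1 N, (if q ∣ n then (if Rough q n then (moebius n : ℝ) else 0) else 0) = - Mr (q + 1) (N / q) := by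
    rw [sum_multiples _ hq.pos, Mr, ← Finset.sum_neg_distrib]
    refine Finset.sum_congr rfl fun m _ => ?_
    have hr : Rough q (q * m) ↔ Rough q m := by
      constructor
      · intro h p hp hd; exact h p hp (hd.mul_left _)
      · intro h p hp hd
        rcases (hp.dvd_mul).mp hd with h' | h'
        · exact ((Nat.prime_dvd_prime_iff_eq hp hq).mp h').ge
        · exact h p hp h'
    rw [hr, rough_succ_iff]
    by_cases h : q ∣ m
    · have : moebius (q * m) = 0 := by
        apply moebius_eq_zero_of_not_squarefree
        intro hs
        obtain ⟨c, rfl⟩ := h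
        have := hs q ⟨c, by ring⟩
        exact hq.one_lt.ne' (Nat.isUnit_iff.mp this)
      simp [h, hq, this]
    · have : moebius (q * m) = - moebius m := by
        rw [isMultiplicative_moebius.map_mul_of_coprime ((Nat.Prime.coprime_iff_not_dvd hq).mpr h), moebius_apply_prime hq]
        ring
      by_cases h3 : Rough q m <;> simp [h, hq, this, h3]
  rw [h2] at h1
  linarith

lemma Mr_littleO (y : ℕ) : ∀ ε : ℝ, 0 < ε → ∃ C : ℝ, ∀ N : ℕ, |Mr y N| ≤ ε * N + C := by
  induction y with
  | zero =>
    intro ε hε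
    have h := Metric.tendsto_atTop.mp mert_littleO ε hε
    obtain ⟨X, hX⟩ := h
    refine ⟨|X|, fun N => ?_⟩
    by_cases hN : X ≤ N
    · have h1 := hX N hN
      rw [Real.dist_eq, sub_zero, abs_div, Nat.abs_cast] at h1
      have h2 : mert N = Mr 0 N := by simp [mert, Mr, rough_zero]
      rw [h2] at h1
      rcases Nat.eq_zero_or_pos N with h0 | h0
      · subst h0; simp [Mr]
      · have h0' : (0:ℝ) < N := by exact_mod_cast h0
        rw [div_lt_iff₀ h0'] at h1
        have := abs_nonneg X
        linarith
    · have h1 := Mr_bound 0 N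
      have := le_abs_self X
      have : 0 ≤ ε * N := by positivity
      linarith
  | succ q ih =>
    by_cases hq : q.Prime
    · intro ε hε
      obtain ⟨C, hC⟩ := ih (ε / 2) (by positivity)
      have hC0 : 0 ≤ C := by
        have := hC 0; simp [Mr] at this; exact this
      -- handle additive constant
      have hC' : ∃ N0 : ℕ, ∀ N : ℕ, N0 ≤ N → |Mr q N| ≤ (ε / 2) * N := by
        obtain ⟨C, hC⟩ := ih (ε / 4) (by positivity)
        obtain ⟨N0, hN0⟩ := exists_nat_ge (C / (ε / 4))
        refine ⟨N0, fun N hN => ?_⟩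
        have h1 : C / (ε / 4) ≤ N := hN0.trans (by exact_mod_cast hN)
        rw [div_le_iff₀ (by positivity)] at h1
        have := hC N
        linarith
      obtain ⟨N0, hN0⟩ := hC'
      refine ⟨N0, fun N => ?_⟩
      induction N using Nat.strong_induction_on with
      | _ N ihN =>
        by_cases h : N < N0 ∨ N = 0
        · rcases h with h | h
          · have h1 := Mr_bound (q + 1) N
            have : (N : ℝ) ≤ N0 := by exact_mod_cast h.le
            have : 0 ≤ ε * N := by positivity
            linarith
          · subst h; simp [Mr]
        · push Not at h
          rw [Mr_rec hq]
          have h1 := hN0 N h.1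
          have h2 := ihN (N / q) (Nat.div_lt_self (Nat.pos_of_ne_zero h.2) hq.one_lt)
          have h3 : ((N / q : ℕ) : ℝ) ≤ N / 2 := by
            refine Nat.cast_div_le.trans ?_
            have : (2 : ℝ) ≤ q := by exact_mod_cast hq.two_le
            gcongr
          have h4 := abs_add_le (Mr q N) (Mr (q + 1) (N / q))
          have h5 : ε * ((N / q : ℕ) : ℝ) ≤ ε * (N / 2) := by gcongr
          linarith
    · have : ∀ N, Mr (q + 1) N = Mr q N := by
        intro N
        unfold Mr
        refine Finset.sum_congr rfl fun n _ => ?_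
        have h0 : Rough (q + 1) n ↔ Rough q n := by rw [rough_succ_iff]; tauto
        rw [h0]
      simpa [this] using ih

lemma totient_small (ε : ℝ) (hε : 0 < ε) : ∃ Y : ℕ, (Nat.totient (primorial Y) : ℝ) ≤ ε * primorial Y := by
  have h1 := Nat.Primes.not_summable_one_div
  have h2 : ¬ Summable (Set.indicator {p : ℕ | p.Prime} (fun n : ℕ => (1:ℝ) / n)) := by
    rw [← summable_subtype_iff_indicator]; exact h1
  have h3 := (not_summable_iff_tendsto_nat_atTop_of_nonneg (fun n => Set.indicator_nonneg (fun _ _ => by positivity) n)).mp h2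
  obtain ⟨Y, hY⟩ := (h3.eventually_ge_atTop (Real.log (1/ε))).exists_forall_of_atTop
  refine ⟨Y, ?_⟩
  have hpf : (primorial Y).primeFactors = (Finset.range (Y+1)).filter Nat.Prime := by
    ext p
    simp only [Nat.mem_primeFactors, Finset.mem_filter, Finset.mem_range]
    constructor
    · rintro ⟨hp, hd, _⟩
      exact ⟨Nat.lt_succ_of_le (hp.dvd_primorial_iff.mp hd), hp⟩
    · rintro ⟨h, hp⟩
      exact ⟨hp, hp.dvd_primorial_iff.mpr (by lia), (primorial_pos Y).ne'⟩
  have h4 : (Nat.totient (primorial Y) : ℝ) = primorial Y * ∏ p ∈ (primorial Y).primeFactors, (1 - (p:ℝ)⁻¹) := by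
    have := Nat.totient_eq_mul_prod_factors (primorial Y)
    have := congrArg (fun x : ℚ => (x : ℝ)) this
    push_cast at this
    exact this
  rw [h4, mul_comm]
  gcongr
  have h5 : ∏ p ∈ (primorial Y).primeFactors, (1 - (p:ℝ)⁻¹) ≤ ∏ p ∈ (primorial Y).primeFactors, Real.exp (-(p:ℝ)⁻¹) := by
    refine Finset.prod_le_prod ?_ ?_
    · intro p hp
      have : (1:ℝ) ≤ p := by exact_mod_cast (Nat.prime_of_mem_primeFactors hp).one_le
      have := inv_le_one_of_one_le₀ this
      linarith
    · intro p _
      have := Real.add_one_le_exp (-(p:ℝ)⁻¹)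
      linarith
  refine h5.trans ?_
  rw [← Real.exp_sum, ← Real.le_log_iff_exp_le hε, Finset.sum_neg_distrib, hpf]
  have h6 := hY (Y+1) (by lia)
  have h7 : ∑ i ∈ Finset.range (Y+1), Set.indicator {p : ℕ | p.Prime} (fun n : ℕ => (1:ℝ) / n) i = ∑ p ∈ (Finset.range (Y+1)).filter Nat.Prime, (p:ℝ)⁻¹ := by
    rw [Finset.sum_filter]
    refine Finset.sum_congr rfl fun n _ => ?_
    simp [Set.indicator]
  rw [h7, one_div, Real.log_inv] at h6
  linarith

open Classical in
def aS (S : Set ℕ) (n : ℕ) : ℝ := if n.minFac ∈ S then (moebius n : ℝ) else 0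

lemma aS_bound (S : Set ℕ) (n : ℕ) : |aS S n| ≤ 1 := by
  unfold aS
  split_ifs
  · exact abs_moebius_real n
  · simp

lemma rough_count (Y N : ℕ) : (((Finset.Icc 1 N).filter (fun n => Nat.Coprime (primorial Y) n)).card : ℝ)
    ≤ (Nat.totient (primorial Y) : ℝ) / primorial Y * N + Nat.totient (primorial Y) := by
  have hp := primorial_pos Y
  have h := Nat.Ico_filter_coprime_le (a := primorial Y) 1 N hp.ne'
  have e : Finset.Ico 1 (1 + N) = Finset.Icc 1 N := by ext; simp; lia
  rw [e] at h
  have h2 : (((Finset.Icc 1 N).filter (fun n => Nat.Coprime (primorial Y) n)).card : ℝ) ≤ (Nat.totient (primorial Y) : ℝ) * (((N / primorial Y : ℕ) : ℝ) + 1) := by exact_mod_cast h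
  refine h2.trans ?_
  have h3 : ((N / primorial Y : ℕ) : ℝ) ≤ N / primorial Y := Nat.cast_div_le
  have : (0:ℝ) < primorial Y := by exact_mod_cast hp
  calc _ ≤ (Nat.totient (primorial Y) : ℝ) * ((N / primorial Y : ℝ) + 1) := by gcongr
    _ = _ := by ring

lemma aS_littleO {S : Set ℕ} (hS : ∀ p ∈ S, p.Prime) (ε : ℝ) (hε : 0 < ε) :
    ∃ C : ℝ, ∀ N : ℕ, |∑ n ∈ Finset.Icc 1 N, aS S n| ≤ ε * N + C := by
  classical
  obtain ⟨Y, hY⟩ := totient_small (ε / 2) (by positivity)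
  have hp : (0:ℝ) < primorial Y := by exact_mod_cast primorial_pos Y
  have hY' : (Nat.totient (primorial Y) : ℝ) / primorial Y ≤ ε / 2 := by
    rw [div_le_iff₀ hp]; exact hY
  set P := (Finset.range (Y+1)).filter (fun p => p ∈ S) with hP
  have hη : 0 < ε / (4 * (P.card + 1)) := by positivity
  choose C hC using fun y => Mr_littleO y (ε / (4 * (P.card + 1))) hη
  refine ⟨∑ p ∈ P, (C p + C (p+1)) + Nat.totient (primorial Y), fun N => ?_⟩
  have hdec : ∀ n ∈ Finset.Icc 1 N, aS S n = (∑ p ∈ P, ((if Rough p n then (moebius n : ℝ) else 0) - (if Rough (p+1) n then (moebius n : ℝ) else 0)))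
      + (if n.minFac ∈ S ∧ Y < n.minFac then (moebius n : ℝ) else 0) := by
    intro n _
    have e : ∀ p ∈ P, ((if Rough p n then (moebius n : ℝ) else 0) - (if Rough (p+1) n then (moebius n : ℝ) else 0)) = if n.minFac = p then (moebius n : ℝ) else 0 := by
      intro p hpP
      have hpp := hS p (Finset.mem_filter.mp hpP).2
      have hm := minFac_eq_iff (n := n) hpp
      by_cases h1 : Rough (p+1) n
      · have h2 := (rough_succ_iff.mp h1).1
        rw [if_pos h1, if_pos h2, if_neg (by tauto), sub_self]
      · by_cases h2 : Rough p n
        · rw [if_neg h1, if_pos h2, if_pos (by tauto), sub_zero]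
        · rw [if_neg h1, if_neg h2, if_neg (by tauto), sub_zero]
    rw [Finset.sum_congr rfl e, Finset.sum_ite_eq, aS]
    simp only [hP, Finset.mem_filter, Finset.mem_range]
    by_cases h1 : n.minFac ∈ S <;> by_cases h2 : n.minFac < Y + 1
    · have : ¬ Y < n.minFac := by lia
      simp [h1, h2, this]
    · have : Y < n.minFac := by lia
      simp [h1, h2, this]
    · simp [h1]
    · simp [h1]
  rw [Finset.sum_congr rfl hdec, Finset.sum_add_distrib, Finset.sum_comm]
  have e2 : ∑ p ∈ P, ∑ n ∈ Finset.Icc 1 N, ((if Rough p n then (moebius n : ℝ) else 0) - (if Rough (p+1) n then (moebius n : ℝ) else 0)) = ∑ p ∈ P, (Mr p N - Mr (p+1) N) := by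
    refine Finset.sum_congr rfl fun p _ => ?_
    rw [Finset.sum_sub_distrib]; rfl
  rw [e2]
  have b1 : |∑ p ∈ P, (Mr p N - Mr (p+1) N)| ≤ ∑ p ∈ P, (2 * (ε / (4 * (P.card + 1)) * N) + (C p + C (p+1))) := by
    refine (Finset.abs_sum_le_sum_abs _ _).trans (Finset.sum_le_sum fun p _ => ?_)
    have h1 := hC p N
    have h2 := hC (p+1) N
    have h3 := abs_sub (Mr p N) (Mr (p+1) N)
    linarith
  have b2 : |∑ n ∈ Finset.Icc 1 N, (if n.minFac ∈ S ∧ Y < n.minFac then (moebius n : ℝ) else 0)| ≤ ε / 2 * N + Nat.totient (primorial Y) := by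
    refine le_trans ?_ ((rough_count Y N).trans ?_)
    · refine (Finset.abs_sum_le_sum_abs _ _).trans ?_
      rw [← Finset.sum_boole]
      refine Finset.sum_le_sum fun n hn => ?_
      by_cases h : n.minFac ∈ S ∧ Y < n.minFac
      · have hc : Nat.Coprime (primorial Y) n := by
          apply Nat.Coprime.symm
          refine Nat.coprime_of_dvd fun k hk hd h3 => ?_
          have := hk.dvd_primorial_iff.mp h3
          have := Nat.minFac_le_of_dvd hk.two_le hd
          lia
        rw [if_pos h, if_pos hc]
        exact abs_moebius_real n
      · simp only [h, if_false, abs_zero]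
        split_ifs <;> norm_num
    · gcongr
  refine (abs_add_le _ _).trans ?_
  refine (add_le_add b1 b2).trans ?_
  rw [Finset.sum_add_distrib, Finset.sum_const, nsmul_eq_mul]
  have h9 : (P.card : ℝ) * (2 * (ε / (4 * (P.card + 1)) * N)) ≤ ε / 2 * N := by
    have : (P.card : ℝ) * (2 * (ε / (4 * (P.card + 1)) * N)) = (P.card / (P.card + 1)) * (ε / 2 * N) := by
      field_simp; ring
    rw [this]
    refine mul_le_of_le_one_left (by positivity) ?_
    rw [div_le_one (by positivity)]; linarith
  linarith

lemma abel_bound {b g : ℕ → ℝ} {m : ℕ} {D : ℝ} (hb : ∀ n, |∑ k ∈ Finset.Ioc m n, b k| ≤ D)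
    (hg : ∀ n, m < n → g (n+1) ≤ g n) (hg0 : ∀ n, 0 ≤ g n) {N : ℕ} (hmN : m ≤ N) :
    |∑ n ∈ Finset.Ioc m N, b n * g n| ≤ D * g (m+1) := by
  have key : |∑ n ∈ Finset.Ioc m N, b n * g n - (∑ n ∈ Finset.Ioc m N, b n) * g (N+1)| ≤ D * (g (m+1) - g (N+1)) := by
    induction N, hmN using Nat.le_induction with
    | base => simp
    | succ N hN ih =>
      have h1 := hb (N+1)
      rw [Finset.sum_Ioc_succ_top hN, Finset.sum_Ioc_succ_top hN]
      rw [Finset.sum_Ioc_succ_top hN] at h1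
      have h2 := hg (N+1) (by lia)
      have e : ∑ n ∈ Finset.Ioc m N, b n * g n + b (N + 1) * g (N + 1) - (∑ n ∈ Finset.Ioc m N, b n + b (N + 1)) * g (N+1+1)
        = (∑ n ∈ Finset.Ioc m N, b n * g n - (∑ n ∈ Finset.Ioc m N, b n) * g (N+1)) + (∑ n ∈ Finset.Ioc m N, b n + b (N + 1)) * (g (N+1) - g (N+1+1)) := by ring
      rw [e]
      refine (abs_add_le _ _).trans ?_
      rw [abs_mul, abs_of_nonneg (by linarith : 0 ≤ g (N+1) - g (N+1+1))]
      have := mul_le_mul_of_nonneg_right h1 (by linarith : 0 ≤ g (N+1) - g (N+1+1))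
      linarith
  have h1 := hb N
  have h2 := mul_le_mul_of_nonneg_right h1 (hg0 (N+1))
  have h3 : |(∑ n ∈ Finset.Ioc m N, b n) * g (N+1)| ≤ D * g (N+1) := by
    rw [abs_mul, abs_of_nonneg (hg0 _)]; exact h2
  have := abs_add_le (∑ n ∈ Finset.Ioc m N, b n * g n - (∑ n ∈ Finset.Ioc m N, b n) * g (N+1)) ((∑ n ∈ Finset.Ioc m N, b n) * g (N+1))
  rw [sub_add_cancel] at this
  linarith

/-- Axer's theorem. -/
lemma axer {a : ℕ → ℝ} (ha : ∀ n, |a n| ≤ 1)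
    (hA : ∀ ε : ℝ, 0 < ε → ∃ C : ℝ, ∀ N : ℕ, |∑ n ∈ Finset.Icc 1 N, a n| ≤ ε * N + C) :
    Tendsto (fun N : ℕ => (∑ n ∈ Finset.Icc 1 N, a n * ((N : ℝ) / n - ((N / n : ℕ) : ℝ))) / N) atTop (nhds 0) := by
  have main : ∀ k : ℕ, 0 < k → ∀ ε : ℝ, 0 < ε → ∃ C : ℝ, ∀ N : ℕ,
      |∑ n ∈ Finset.Icc 1 N, a n * ((N : ℝ) / n - ((N / n : ℕ) : ℝ))| ≤ N / k + 4 * k * ε * N + C := by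
    intro k hk ε hε
    obtain ⟨C, hC⟩ := hA ε hε
    refine ⟨4 * k * C, fun N => ?_⟩
    have eI : ∀ n : ℕ, Finset.Icc 1 n = Finset.Ioc 0 n := fun n => by ext; simp; lia
    have hk' : (0:ℝ) < k := by exact_mod_cast hk
    set m := N / k with hm
    have hmN : m ≤ N := Nat.div_le_self _ _
    -- truncated sequence
    let b : ℕ → ℝ := fun n => if n ≤ N then a n else 0
    have hbs : ∀ n, |∑ j ∈ Finset.Ioc m n, b j| ≤ 2 * (ε * N + C) := by
      intro n
      have e1 : ∑ j ∈ Finset.Ioc m n, b j = ∑ j ∈ Finset.Ioc m (min n N), a j := by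
        simp only [b]
        rw [← Finset.sum_filter]
        congr 1
        ext j; simp; lia
      rw [e1]
      by_cases hc : m ≤ min n N
      · have e2 : ∑ j ∈ Finset.Ioc m (min n N), a j = ∑ j ∈ Finset.Icc 1 (min n N), a j - ∑ j ∈ Finset.Icc 1 m, a j := by
          rw [eI, eI, ← Finset.sum_Ioc_consecutive _ (Nat.zero_le m) hc]; ring
        rw [e2]
        have h1 := hC (min n N)
        have h2 := hC m
        have h3 : ((min n N : ℕ) : ℝ) ≤ N := by exact_mod_cast min_le_right _ _
        have h4 : (m : ℝ) ≤ N := by exact_mod_cast hmN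
        have h5 := abs_sub (∑ j ∈ Finset.Icc 1 (min n N), a j) (∑ j ∈ Finset.Icc 1 m, a j)
        have h6 := mul_le_mul_of_nonneg_left h3 hε.le
        have h7 := mul_le_mul_of_nonneg_left h4 hε.le
        linarith
      · rw [Finset.Ioc_eq_empty (by lia)]
        simp only [Finset.sum_empty, abs_zero]
        have h1 := (abs_nonneg _).trans (hC N)
        linarith
    have hN1 : (N : ℝ) / ((m + 1 : ℕ) : ℝ) ≤ k := by
      rw [div_le_iff₀ (by positivity)]
      have : N < k * (m + 1) := by
        rw [hm]; exact Nat.lt_mul_div_succ N hk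
      exact_mod_cast this.le
    have g1 := abel_bound (N := N) (g := fun n => (N : ℝ) / n) hbs (by
      intro n hn
      have : (0:ℝ) < n := by exact_mod_cast (by lia : 0 < n)
      push_cast
      gcongr
      linarith) (fun n => by positivity) hmN
    have g2 := abel_bound (N := N) (g := fun n => ((N / n : ℕ) : ℝ)) hbs (by
      intro n hn
      have : N / (n+1) ≤ N / n := Nat.div_le_div_left (by lia) (by lia)
      exact_mod_cast this) (fun n => by positivity) hmN
    have hD : 0 ≤ 2 * (ε * N + C) := (abs_nonneg _).trans (hbs 0)
    have g1' := g1.trans (mul_le_mul_of_nonneg_left hN1 hD)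
    have g2' := g2.trans (mul_le_mul_of_nonneg_left (Nat.cast_div_le.trans hN1) hD)
    have split : ∑ n ∈ Finset.Icc 1 N, a n * ((N : ℝ) / n - ((N / n : ℕ) : ℝ)) =
        ∑ n ∈ Finset.Icc 1 m, a n * ((N : ℝ) / n - ((N / n : ℕ) : ℝ)) +
        (∑ n ∈ Finset.Ioc m N, b n * ((N : ℝ) / n) - ∑ n ∈ Finset.Ioc m N, b n * ((N / n : ℕ) : ℝ)) := by
      rw [eI, eI, ← Finset.sum_Ioc_consecutive _ (Nat.zero_le m) hmN, ← Finset.sum_sub_distrib]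
      congr 1
      refine Finset.sum_congr rfl fun n hn => ?_
      simp only [b, (Finset.mem_Ioc.mp hn).2, if_true]; ring
    have b0 : |∑ n ∈ Finset.Icc 1 m, a n * ((N : ℝ) / n - ((N / n : ℕ) : ℝ))| ≤ N / k := by
      have hfrac : ∀ n, |(N : ℝ) / n - ((N / n : ℕ) : ℝ)| ≤ 1 := by
        intro n
        rw [← Nat.floor_div_eq_div (K := ℝ), abs_le]
        have h1 := Nat.floor_le (by positivity : 0 ≤ (N : ℝ) / n)
        have h2 := Nat.lt_floor_add_one ((N : ℝ) / n)
        constructor <;> linarith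
      refine (abs_sum_le_card (a := fun n => a n * ((N : ℝ) / n - ((N / n : ℕ) : ℝ))) (fun n => ?_) m).trans Nat.cast_div_le
      rw [abs_mul]
      exact mul_le_one₀ (ha n) (abs_nonneg _) (hfrac n)
    rw [split]
    refine (abs_add_le _ _).trans ?_
    have h5 := abs_sub (∑ n ∈ Finset.Ioc m N, b n * ((N : ℝ) / n)) (∑ n ∈ Finset.Ioc m N, b n * ((N / n : ℕ) : ℝ))
    linarith
  rw [Metric.tendsto_atTop]
  intro ε hε
  obtain ⟨k, hk⟩ := exists_nat_gt (4 / ε)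
  have hk0 : (0:ℝ) < k := lt_trans (by positivity) hk
  obtain ⟨C, hC⟩ := main k (by exact_mod_cast hk0) (ε / (16 * k)) (by positivity)
  obtain ⟨N0, hN0⟩ := exists_nat_gt (4 * C / ε)
  refine ⟨N0 + 1, fun N hN => ?_⟩
  have hNpos : (0:ℝ) < N := by exact_mod_cast (by lia : 0 < N)
  rw [Real.dist_eq, sub_zero, abs_div, Nat.abs_cast, div_lt_iff₀ hNpos]
  refine (hC N).trans_lt ?_
  have h1 : (N:ℝ) / k ≤ ε / 4 * N := by
    rw [div_le_iff₀ hk0]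
    rw [div_lt_iff₀ hε] at hk
    nlinarith
  have h2 : 4 * k * (ε / (16 * k)) * N = ε / 4 * N := by field_simp; ring
  have h3 : 4 * C < N * ε := by
    rw [div_lt_iff₀ hε] at hN0
    have : (N0:ℝ) ≤ N := by exact_mod_cast (by lia : N0 ≤ N)
    nlinarith
  rw [h2]
  nlinarith


/-- largest prime factor (`0` for `n ≤ 1`). -/
def Pmax (n : ℕ) : ℕ := n.primeFactors.sup id

lemma Pmax_spec {n : ℕ} (hn : 2 ≤ n) : (Pmax n).Prime ∧ Pmax n ∣ n := by
  have h : n.primeFactors.Nonempty := Nat.nonempty_primeFactors.mpr (by lia)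
  obtain ⟨p, hp, he⟩ := Finset.exists_mem_eq_sup _ h id
  rw [Pmax, he]
  exact ⟨Nat.prime_of_mem_primeFactors hp, Nat.dvd_of_mem_primeFactors hp⟩

lemma le_Pmax {n p : ℕ} (hn : n ≠ 0) (hp : p.Prime) (hd : p ∣ n) : p ≤ Pmax n :=
  Finset.le_sup (f := id) (Nat.mem_primeFactors.mpr ⟨hp, hd, hn⟩)

lemma Pmax_le_iff {n y : ℕ} (hn : n ≠ 0) : Pmax n ≤ y ↔ ∀ p, p.Prime → p ∣ n → p ≤ y := by
  constructor
  · intro h p hp hd; exact (le_Pmax hn hp hd).trans h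
  · intro h
    refine Finset.sup_le fun p hp => ?_
    exact h p (Nat.prime_of_mem_primeFactors hp) (Nat.dvd_of_mem_primeFactors hp)

lemma Pmax_one : Pmax 1 = 0 := by simp [Pmax]

lemma smooth_rough (y n : ℕ) (hn : n ≠ 0) : ∃ a b : ℕ, n = a * b ∧ (∀ p, p.Prime → p ∣ a → p < y) ∧ Rough y b := by
  induction n using Nat.recOnMul with
  | zero => exact absurd rfl hn
  | one =>
    refine ⟨1, 1, rfl, ?_, ?_⟩
    · intro p hp hd; exact absurd (Nat.dvd_one.mp hd) hp.one_lt.ne'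
    · intro p hp hd; exact absurd (Nat.dvd_one.mp hd) hp.one_lt.ne'
  | prime q hq =>
    have h1 : ∀ p : ℕ, p.Prime → ¬ p ∣ 1 := fun p hp hd => hp.one_lt.ne' (Nat.dvd_one.mp hd)
    by_cases h : q < y
    · refine ⟨q, 1, by simp, ?_, fun p hp hd => absurd hd (h1 p hp)⟩
      intro p hp hd
      rw [(Nat.prime_dvd_prime_iff_eq hp hq).mp hd]; exact h
    · refine ⟨1, q, by simp, fun p hp hd => absurd hd (h1 p hp), ?_⟩
      intro p hp hd
      rw [(Nat.prime_dvd_prime_iff_eq hp hq).mp hd]; lia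
  | mul m k hm hk =>
    obtain ⟨a, b, e, ha, hb⟩ := hm (by rintro rfl; simp at hn)
    obtain ⟨a', b', e', ha', hb'⟩ := hk (by rintro rfl; simp at hn)
    refine ⟨a * a', b * b', by rw [e, e']; ring, ?_, ?_⟩
    · intro p hp hd
      rcases hp.dvd_mul.mp hd with h | h
      · exact ha p hp h
      · exact ha' p hp h
    · intro p hp hd
      rcases hp.dvd_mul.mp hd with h | h
      · exact hb p hp h
      · exact hb' p hp h

lemma sum_moebius_divisors (b : ℕ) : ∑ d ∈ b.divisors, (moebius d : ℝ) = if b = 1 then 1 else 0 := by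
  have h := congrArg (fun f => f b) moebius_mul_coe_zeta
  simp only [coe_mul_zeta_apply, one_apply] at h
  exact_mod_cast h

open Classical in
lemma sum_rough_divisors (y n : ℕ) (hn : n ≠ 0) :
    ∑ d ∈ n.divisors, (if Rough y d then (moebius d : ℝ) else 0) = if Pmax n < y ∨ n = 1 then 1 else 0 := by
  obtain ⟨a, b, e, ha, hb⟩ := smooth_rough y n hn
  have ha0 : a ≠ 0 := by rintro rfl; simp at e; exact hn e
  have hb0 : b ≠ 0 := by rintro rfl; simp at e; exact hn e
  rw [← Finset.sum_filter]
  have h1 : n.divisors.filter (fun d => Rough y d) = b.divisors := by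
    ext d
    simp only [Finset.mem_filter, Nat.mem_divisors]
    constructor
    · rintro ⟨⟨h1, _⟩, h2⟩
      refine ⟨?_, hb0⟩
      have : Nat.Coprime d a := by
        refine Nat.coprime_of_dvd fun k hk hd h3 => ?_
        have := ha k hk h3
        have := h2 k hk hd
        lia
      rw [e] at h1
      exact this.dvd_of_dvd_mul_left h1
    · rintro ⟨h1, _⟩
      exact ⟨⟨e ▸ h1.mul_left a, hn⟩, fun p hp hd => hb p hp (hd.trans h1)⟩
  rw [h1, sum_moebius_divisors]
  congr 1
  rw [eq_iff_iff]
  constructor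
  · rintro rfl
    by_cases h : n = 1
    · exact Or.inr h
    · left
      have := Pmax_spec (n := n) (by lia)
      apply ha _ this.1
      rw [e, mul_one] at this
      rw [e, mul_one]; exact this.2
  · rintro (h | h)
    · by_contra hb1
      have hp := Nat.minFac_prime hb1
      have h2 := hb _ hp (Nat.minFac_dvd b)
      have h3 := le_Pmax hn hp (e ▸ (Nat.minFac_dvd b).mul_left a)
      lia
    · rw [h] at e
      exact Nat.eq_one_of_mul_eq_one_left e.symm

open Classical in
lemma duality {S : Set ℕ} (hS : ∀ p ∈ S, p.Prime) {n : ℕ} (hn : 1 ≤ n) :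
    ∑ d ∈ n.divisors, aS S d = - (if Pmax n ∈ S then 1 else 0) := by
  set P := (Finset.range (n+1)).filter (fun p => p ∈ S) with hP
  have hPS : ∀ p ∈ P, p.Prime := fun p hp => hS p (Finset.mem_filter.mp hp).2
  have h1 : ∀ d ∈ n.divisors, aS S d = ∑ p ∈ P, ((if Rough p d then (moebius d : ℝ) else 0) - (if Rough (p+1) d then (moebius d : ℝ) else 0)) := by
    intro d hd
    have e : ∀ p ∈ P, ((if Rough p d then (moebius d : ℝ) else 0) - (if Rough (p+1) d then (moebius d : ℝ) else 0)) = if d.minFac = p then (moebius d : ℝ) else 0 := by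
      intro p hpP
      have hm := minFac_eq_iff (n := d) (hPS p hpP)
      by_cases h1 : Rough (p+1) d
      · have h2 := (rough_succ_iff.mp h1).1
        rw [if_pos h1, if_pos h2, if_neg (by tauto), sub_self]
      · by_cases h2 : Rough p d
        · rw [if_neg h1, if_pos h2, if_pos (by tauto), sub_zero]
        · rw [if_neg h1, if_neg h2, if_neg (by tauto), sub_zero]
    rw [Finset.sum_congr rfl e, Finset.sum_ite_eq, aS]
    simp only [hP, Finset.mem_filter, Finset.mem_range]
    have hdn := Nat.divisor_le hd
    have hd0 := Nat.pos_of_mem_divisors hd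
    have : d.minFac < n + 1 := by have := Nat.minFac_le hd0; lia
    simp [this]
  rw [Finset.sum_congr rfl h1, Finset.sum_comm]
  have h2 : ∀ p ∈ P, ∑ d ∈ n.divisors, ((if Rough p d then (moebius d : ℝ) else 0) - (if Rough (p+1) d then (moebius d : ℝ) else 0)) = -(if Pmax n = p then 1 else 0) := by
    intro p hp
    have hpp := (hPS p hp).pos
    rw [Finset.sum_sub_distrib, sum_rough_divisors _ _ (by lia), sum_rough_divisors _ _ (by lia)]
    by_cases h1 : n = 1
    · have : Pmax n ≠ p := by rw [h1, Pmax_one]; lia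
      simp [h1, this]
      subst h1; exact this
    · rcases lt_trichotomy (Pmax n) p with h | h | h
      · have h' : Pmax n < p + 1 := by lia
        simp [h, h', h1, h.ne]
      · simp [h, h1]
      · have h' : ¬ Pmax n < p + 1 := by lia
        have h'' : ¬ Pmax n < p := by lia
        simp [h', h'', h1, h.ne']
  rw [Finset.sum_congr rfl h2, Finset.sum_neg_distrib, Finset.sum_ite_eq]
  congr 1
  have : Pmax n < n + 1 := by
    rcases Nat.lt_or_ge n 2 with h | h
    · have : n = 1 := by lia
      subst this; simp [Pmax_one]
    · have := Nat.le_of_dvd (by lia) (Pmax_spec h).2; lia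
  simp [hP, this]

lemma sum_div_floor (a : ℕ → ℝ) (N : ℕ) :
    ∑ d ∈ Finset.Icc 1 N, a d * ((N / d : ℕ) : ℝ) = ∑ n ∈ Finset.Icc 1 N, ∑ d ∈ n.divisors, a d := by
  have h1 : ∀ n ∈ Finset.Icc 1 N, ∑ d ∈ n.divisors, a d = ∑ d ∈ Finset.Icc 1 N, if d ∣ n then a d else 0 := by
    intro n hn
    rw [← Finset.sum_filter]
    congr 1
    ext d
    simp only [Nat.mem_divisors, Finset.mem_filter, Finset.mem_Icc] at *
    constructor
    · rintro ⟨h, _⟩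
      have := Nat.le_of_dvd (by lia) h
      have := Nat.pos_of_dvd_of_pos h (by lia)
      exact ⟨by lia, h⟩
    · rintro ⟨_, h⟩; exact ⟨h, by lia⟩
  rw [Finset.sum_congr rfl h1, Finset.sum_comm]
  refine Finset.sum_congr rfl fun d hd => ?_
  rw [sum_multiples (fun _ => a d) (Finset.mem_Icc.mp hd).1]
  simp [mul_comm]

open Classical in
lemma final_of_count {S : Set ℕ} (hS : ∀ p ∈ S, p.Prime) {δ : ℝ}
    (h : Tendsto (fun N : ℕ => (∑ n ∈ Finset.Icc 1 N, (if Pmax n ∈ S then (1:ℝ) else 0)) / N) atTop (nhds δ)) :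
    Tendsto (fun X : ℕ =>
        ∑ n ∈ Finset.Icc 2 X, if n.minFac ∈ S then (moebius n : ℝ) / (n : ℝ) else 0)
      atTop (nhds (-δ)) := by
  have hax := axer (aS_bound S) (aS_littleO hS)
  have h2 := hax.sub h
  rw [zero_sub] at h2
  refine h2.congr' ?_
  filter_upwards [eventually_ge_atTop 1] with N hN
  have hN' : (N:ℝ) ≠ 0 := by exact_mod_cast (by lia : N ≠ 0)
  have e1 : ∑ n ∈ Finset.Icc 1 N, (if Pmax n ∈ S then (1:ℝ) else 0) = - ∑ d ∈ Finset.Icc 1 N, aS S d * ((N / d : ℕ) : ℝ) := by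
    rw [sum_div_floor, ← Finset.sum_neg_distrib]
    refine Finset.sum_congr rfl fun n hn => ?_
    rw [duality hS (Finset.mem_Icc.mp hn).1, neg_neg]
  rw [e1, ← sub_div, sub_neg_eq_add, ← Finset.sum_add_distrib]
  have e2 : Finset.Icc 1 N = insert 1 (Finset.Icc 2 N) := by ext; simp; lia
  rw [e2, Finset.sum_insert (by simp)]
  have e3 : aS S 1 = 0 := by
    have : (1:ℕ) ∉ S := fun h => Nat.not_prime_one (hS 1 h)
    simp [aS, this]
  rw [e3, zero_mul, zero_mul, add_zero, zero_add, Finset.sum_div]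
  refine Finset.sum_congr rfl fun n hn => ?_
  have hn' : (n:ℝ) ≠ 0 := by
    have := (Finset.mem_Icc.mp hn).1
    exact_mod_cast (by lia : n ≠ 0)
  unfold aS
  split_ifs
  · field_simp; ring
  · simp


lemma mertens_upper {Y : ℕ} (hY : 1 ≤ Y) :
    ∑ p ∈ Nat.primesLE Y, Real.log p / p ≤ Real.log Y + Real.log 4 := by
  have hY0 : (0:ℝ) < Y := by exact_mod_cast hY
  have h1 : ∑ n ∈ Finset.Icc 1 Y, ∑ p ∈ Nat.primesLE Y, (if p ∣ n then Real.log p else 0) ≤ Y * Real.log Y := by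
    have : ∀ n ∈ Finset.Icc 1 Y, ∑ p ∈ Nat.primesLE Y, (if p ∣ n then Real.log p else 0) ≤ Real.log Y := by
      intro n hn
      have hn' := Finset.mem_Icc.mp hn
      rw [← Finset.sum_filter]
      have e : (Nat.primesLE Y).filter (fun p => p ∣ n) = n.primeFactors := by
        ext p
        simp only [Finset.mem_filter, Nat.mem_primesLE, Nat.mem_primeFactors]
        constructor
        · rintro ⟨⟨_, h⟩, h2⟩; exact ⟨h, h2, by lia⟩
        · rintro ⟨h, h2, _⟩
          exact ⟨⟨(Nat.le_of_dvd (by lia) h2).trans hn'.2, h⟩, h2⟩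
      rw [e, ← Real.log_prod (fun p hp => by
        exact_mod_cast (Nat.prime_of_mem_primeFactors hp).ne_zero)]
      have h2 : ∏ p ∈ n.primeFactors, p ≤ Y := (Nat.le_of_dvd (by lia) (Nat.prod_primeFactors_dvd n)).trans hn'.2
      apply Real.log_le_log
      · exact Finset.prod_pos fun p hp => by exact_mod_cast (Nat.prime_of_mem_primeFactors hp).pos
      · rw [← Nat.cast_prod]; exact_mod_cast h2
    refine (Finset.sum_le_card_nsmul _ _ _ this).trans ?_
    simp
  rw [Finset.sum_comm] at h1
  have h2 : ∑ p ∈ Nat.primesLE Y, (Y * (Real.log p / p) - Real.log p) ≤ Y * Real.log Y := by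
    refine le_trans (Finset.sum_le_sum fun p hp => ?_) h1
    have hp' := (Nat.mem_primesLE.mp hp).2
    rw [sum_multiples (fun _ => Real.log p) hp'.pos, Finset.sum_const, Nat.card_Icc, nsmul_eq_mul]
    have h3 : (Y:ℝ) / p - 1 ≤ ((Y / p : ℕ) : ℝ) := by
      rw [← Nat.floor_div_eq_div (K := ℝ)]
      linarith [Nat.lt_floor_add_one ((Y : ℝ) / p)]
    have h4 : 0 ≤ Real.log p := Real.log_natCast_nonneg p
    have := mul_le_mul_of_nonneg_right h3 h4
    simp only [Nat.add_sub_cancel]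
    refine le_trans (le_of_eq ?_) this
    ring
  rw [Finset.sum_sub_distrib, ← Finset.mul_sum, ← Chebyshev.theta_eq_sum_primesLE_log] at h2
  have h3 := Chebyshev.theta_le_log4_mul_x hY0.le
  have h4 : (Y:ℝ) * ∑ p ∈ Nat.primesLE Y, Real.log p / p ≤ Y * (Real.log Y + Real.log 4) := by linarith
  exact le_of_mul_le_mul_left h4 hY0

lemma smooth_log_sum {Y : ℕ} (hY : 1 ≤ Y) (N : ℕ) :
    ∑ n ∈ (Finset.Icc 1 N).filter (fun n => Pmax n ≤ Y), Real.log n ≤ 2 * N * (Real.log Y + Real.log 4) := by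
  have h1 : ∀ n ∈ (Finset.Icc 1 N).filter (fun n => Pmax n ≤ Y), Real.log n = ∑ p ∈ Nat.primesLE Y, (n.factorization p : ℝ) * Real.log p := by
    intro n hn
    simp only [Finset.mem_filter, Finset.mem_Icc] at hn
    rw [Real.log_nat_eq_sum_factorization, Finsupp.sum]
    refine Finset.sum_subset ?_ ?_
    · intro p hp
      rw [Nat.support_factorization] at hp
      have hp1 := Nat.prime_of_mem_primeFactors hp
      rw [Nat.mem_primesLE]
      exact ⟨(Pmax_le_iff (by lia)).mp hn.2 p hp1 (Nat.dvd_of_mem_primeFactors hp), hp1⟩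
    · intro p _ hp
      rw [Finsupp.notMem_support_iff] at hp
      simp [hp]
  rw [Finset.sum_congr rfl h1]
  have h2 : ∑ n ∈ (Finset.Icc 1 N).filter (fun n => Pmax n ≤ Y), ∑ p ∈ Nat.primesLE Y, (n.factorization p : ℝ) * Real.log p
      ≤ ∑ n ∈ Finset.Icc 1 N, ∑ p ∈ Nat.primesLE Y, (n.factorization p : ℝ) * Real.log p := by
    refine Finset.sum_le_sum_of_subset_of_nonneg (Finset.filter_subset _ _) fun n _ _ => ?_
    exact Finset.sum_nonneg fun p _ => mul_nonneg (by positivity) (Real.log_natCast_nonneg p)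
  refine h2.trans ?_
  rw [Finset.sum_comm]
  have h3 := mul_le_mul_of_nonneg_left (mertens_upper hY) (by positivity : (0:ℝ) ≤ 2 * N)
  refine le_trans ?_ h3
  rw [Finset.mul_sum]
  refine Finset.sum_le_sum fun p hp => ?_
  have hp' := (Nat.mem_primesLE.mp hp).2
  rw [← Finset.sum_mul]
  have h4 : ∑ n ∈ Finset.Icc 1 N, n.factorization p = (N.factorial).factorization p := by
    rw [← Finset.prod_Ico_id_eq_factorial, show Finset.Ico 1 (N + 1) = Finset.Icc 1 N from by ext; simp, Nat.factorization_prod (fun n hn => by have := (Finset.mem_Icc.mp hn).1; lia)]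
    simp
  have h5 : (p - 1) * (N.factorial).factorization p ≤ N := by
    rw [Nat.sub_one_mul_factorization_factorial hp']; exact Nat.sub_le _ _
  have h6 : (p : ℝ) * (N.factorial).factorization p ≤ 2 * N := by
    have h7 : p ≤ 2 * (p - 1) := by have := hp'.two_le; lia
    have : p * (N.factorial).factorization p ≤ 2 * N := by
      calc _ ≤ 2 * (p - 1) * (N.factorial).factorization p := Nat.mul_le_mul_right _ h7
        _ = 2 * ((p - 1) * (N.factorial).factorization p) := by ring
        _ ≤ _ := Nat.mul_le_mul_left _ h5
    exact_mod_cast this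
  have e : ∑ n ∈ Finset.Icc 1 N, (n.factorization p : ℝ) = ((N.factorial).factorization p : ℝ) := by
    rw [← h4]; push_cast; rfl
  rw [e]
  have hp0 : (0:ℝ) < p := by exact_mod_cast hp'.pos
  have h8 : ((N.factorial).factorization p : ℝ) ≤ 2 * N / p := by
    rw [le_div_iff₀ hp0]; linarith
  calc _ ≤ 2 * N / p * Real.log p := mul_le_mul_of_nonneg_right h8 (Real.log_natCast_nonneg p)
    _ = _ := by ring

lemma smooth_count {Y : ℕ} (hY : 1 ≤ Y) {N : ℕ} (hN : 2 ≤ N) :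
    (((Finset.Icc 1 N).filter (fun n => Pmax n ≤ Y)).card : ℝ) ≤
      Real.sqrt N + 2 / Real.log N * (2 * N * (Real.log Y + Real.log 4)) := by
  have hN1 : (1:ℝ) < N := by exact_mod_cast hN
  have hl : 0 < Real.log N := Real.log_pos hN1
  have hs := Real.sqrt_nonneg (N:ℝ)
  have h1 : (((Finset.Icc 1 N).filter (fun n => Pmax n ≤ Y)).card : ℝ) ≤
      ∑ n ∈ (Finset.Icc 1 N).filter (fun n => Pmax n ≤ Y), ((if n ≤ ⌊Real.sqrt N⌋₊ then (1:ℝ) else 0) + 2 / Real.log N * Real.log n) := by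
    rw [Finset.card_eq_sum_ones, Nat.cast_sum]
    refine Finset.sum_le_sum fun n hn => ?_
    have h0 : 0 ≤ 2 / Real.log N * Real.log n := mul_nonneg (by positivity) (Real.log_natCast_nonneg n)
    split_ifs with h
    · simpa using h0
    · rw [Nat.le_floor_iff hs, not_le] at h
      have h2 := Real.log_le_log (Real.sqrt_pos.mpr (by linarith)) h.le
      rw [Real.log_sqrt (by linarith)] at h2
      have : 2 / Real.log N * (Real.log N / 2) ≤ 2 / Real.log N * Real.log n := by gcongr
      have e : 2 / Real.log N * (Real.log N / 2) = 1 := by field_simp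
      push_cast
      linarith
  refine h1.trans ?_
  rw [Finset.sum_add_distrib, ← Finset.mul_sum]
  have h2 := smooth_log_sum hY N
  gcongr
  rw [Finset.sum_boole]
  refine le_trans ?_ (Nat.floor_le hs)
  have : ((((Finset.Icc 1 N).filter (fun n => Pmax n ≤ Y)).filter (fun n => n ≤ ⌊Real.sqrt N⌋₊))).card ≤ (Finset.Icc 1 ⌊Real.sqrt N⌋₊).card := by
    apply Finset.card_le_card
    intro n hn
    simp only [Finset.mem_filter, Finset.mem_Icc] at hn ⊢
    lia
  rw [Nat.card_Icc, Nat.add_sub_cancel] at this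
  exact_mod_cast this

lemma pi_bound {t : ℕ} (ht : 2 ≤ t) : (Nat.primeCounting t : ℝ) ≤ 5 * (t / Real.log t) := by
  have ht1 : (1:ℝ) < t := by exact_mod_cast ht
  have h := Chebyshev.pi_le_log4_mul_div ht1
  rw [Nat.floor_natCast, Real.log_sqrt (by linarith)] at h
  have hl : 0 < Real.log t := Real.log_pos ht1
  have h4 : Real.log 4 ≤ 1.4 := by
    have : (4:ℝ) = 2 ^ 2 := by norm_num
    rw [this, Real.log_pow]
    have := Real.log_two_lt_d9
    push_cast; linarith
  have hs : Real.sqrt t ≤ 2 * (t / Real.log t) := by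
    have h1 : Real.log t ≤ 2 * Real.sqrt t := by
      have h2 := Real.log_le_sub_one_of_pos (Real.sqrt_pos.mpr (by linarith : (0:ℝ) < t))
      rw [Real.log_sqrt (by linarith)] at h2
      linarith
    rw [← mul_div_assoc, le_div_iff₀ hl]
    have h2 := Real.mul_self_sqrt (by linarith : (0:ℝ) ≤ t)
    nlinarith [Real.sqrt_nonneg (t:ℝ)]
  have e : Real.log 4 * t / (Real.log t / 2) = 2 * Real.log 4 * (t / Real.log t) := by field_simp
  rw [e] at h
  have h5 : 0 ≤ (t:ℝ) / Real.log t := by positivity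
  nlinarith

lemma Pmax_mul {m p : ℕ} (hm : 1 ≤ m) (hp : p.Prime) (h : Pmax m ≤ p) : Pmax (m * p) = p := by
  have h0 : m * p ≠ 0 := Nat.mul_ne_zero (by lia) hp.ne_zero
  apply le_antisymm
  · rw [Pmax_le_iff h0]
    intro q hq hd
    rcases hq.dvd_mul.mp hd with h' | h'
    · exact (le_Pmax (by lia) hq h').trans h
    · exact ((Nat.prime_dvd_prime_iff_eq hq hp).mp h').le
  · exact le_Pmax h0 hp (dvd_mul_left _ _)

lemma nonsmooth_sum (g : ℕ → ℝ) {z : ℕ} (hz : 1 ≤ z) (N : ℕ) :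
    ∑ n ∈ (Finset.Icc 1 N).filter (fun n => z ≤ Pmax n), g (Pmax n) =
    ∑ m ∈ Finset.Icc 1 (N / z), ∑ p ∈ (Nat.primesLE (N / m)).filter (fun p => max z (Pmax m) ≤ p), g p := by
  rw [Finset.sum_sigma']
  have two : ∀ n, 1 ≤ n → z ≤ Pmax n → 2 ≤ n := by
    intro n h1 h2
    by_contra h
    have : n = 1 := by lia
    subst this; rw [Pmax_one] at h2; lia
  refine Finset.sum_bij' (fun n _ => ⟨n / Pmax n, Pmax n⟩) (fun x _ => x.1 * x.2) ?_ ?_ ?_ ?_ ?_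
  · intro n hn
    simp only [Finset.mem_filter, Finset.mem_Icc] at hn
    obtain ⟨⟨h1, h2⟩, h3⟩ := hn
    obtain ⟨hp, hd⟩ := Pmax_spec (two n h1 h3)
    obtain ⟨m, hm⟩ := hd
    set p := Pmax n with hpdef
    have hm' : n / p = m := by rw [hm]; exact Nat.mul_div_cancel_left m hp.pos
    have hm0 : 1 ≤ m := by
      rcases Nat.eq_zero_or_pos m with h | h
      · subst h; lia
      · exact h
    simp only [Finset.mem_sigma, Finset.mem_filter, Finset.mem_Icc, Nat.mem_primesLE, hm']
    refine ⟨⟨hm0, ?_⟩, ⟨?_, hp⟩, max_le h3 ?_⟩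
    · rw [Nat.le_div_iff_mul_le (by lia)]
      calc m * z ≤ m * p := Nat.mul_le_mul_left _ h3
        _ ≤ N := by rw [mul_comm, ← hm]; exact h2
    · rw [Nat.le_div_iff_mul_le (by lia)]; rw [← hm]; exact h2
    · rw [Pmax_le_iff (by lia)]
      intro q hq hd
      exact le_Pmax (by lia) hq (hm ▸ hd.mul_left p)
  · rintro ⟨m, p⟩ hx
    simp only [Finset.mem_sigma, Finset.mem_filter, Finset.mem_Icc, Nat.mem_primesLE] at hx ⊢
    obtain ⟨⟨h1, _⟩, ⟨h3, hp⟩, h4⟩ := hx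
    rw [Pmax_mul h1 hp ((le_max_right _ _).trans h4)]
    rw [Nat.le_div_iff_mul_le (by lia)] at h3
    refine ⟨⟨Nat.mul_pos h1 hp.pos, by rw [mul_comm]; exact h3⟩, (le_max_left _ _).trans h4⟩
  · intro n hn
    simp only [Finset.mem_filter, Finset.mem_Icc] at hn
    exact Nat.div_mul_cancel (Pmax_spec (two n hn.1.1 hn.2)).2
  · rintro ⟨m, p⟩ hx
    simp only [Finset.mem_sigma, Finset.mem_filter, Finset.mem_Icc, Nat.mem_primesLE] at hx
    obtain ⟨⟨h1, _⟩, ⟨h3, hp⟩, h4⟩ := hx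
    simp only [Pmax_mul h1 hp ((le_max_right _ _).trans h4), Nat.mul_div_cancel _ hp.pos]
  · intros; rfl

open Classical in
def gS (S : Set ℕ) (δ : ℝ) (p : ℕ) : ℝ := (if p ∈ S then 1 else 0) - δ

lemma gS_bound (S : Set ℕ) (δ : ℝ) (p : ℕ) : |gS S δ p| ≤ 1 + |δ| := by
  unfold gS
  refine (abs_sub _ _).trans ?_
  gcongr
  split_ifs <;> simp

open Classical in
lemma G_bound {S : Set ℕ} (hS : ∀ p ∈ S, p.Prime) {δ : ℝ}
    (hδ : Tendsto (fun X : ℕ =>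
        (((Finset.range (X + 1)).filter (fun p => p ∈ S)).card : ℝ) /
          (Nat.primeCounting X : ℝ)) atTop (nhds δ)) {η : ℝ} (hη : 0 < η) :
    ∃ C : ℝ, 0 ≤ C ∧ ∀ t : ℕ, |∑ p ∈ Nat.primesLE t, gS S δ p| ≤ η * Nat.primeCounting t + C := by
  obtain ⟨T, hT⟩ := Metric.tendsto_atTop.mp hδ η hη
  set G : ℕ → ℝ := fun t => ∑ p ∈ Nat.primesLE t, gS S δ p
  refine ⟨∑ t ∈ Finset.range (T + 2), |G t|, Finset.sum_nonneg fun _ _ => abs_nonneg _, fun t => ?_⟩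
  have hC : 0 ≤ ∑ t ∈ Finset.range (T + 2), |G t| := Finset.sum_nonneg fun _ _ => abs_nonneg _
  by_cases h : t < T + 2
  · have h1 : |G t| ≤ ∑ t ∈ Finset.range (T + 2), |G t| :=
      Finset.single_le_sum (f := fun t => |G t|) (fun _ _ => abs_nonneg _) (Finset.mem_range.mpr h)
    have : 0 ≤ η * Nat.primeCounting t := by positivity
    show |G t| ≤ _
    linarith
  · have h1 := hT t (by lia)
    have hpi : 0 < Nat.primeCounting t := by
      have h2 := Nat.monotone_primeCounting (by lia : 2 ≤ t)
      have : Nat.primeCounting 2 = 1 := by decide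
      lia
    have hpi' : (0:ℝ) < Nat.primeCounting t := by exact_mod_cast hpi
    have e : ∑ p ∈ Nat.primesLE t, gS S δ p = (((Finset.range (t + 1)).filter (fun p => p ∈ S)).card : ℝ) - δ * Nat.primeCounting t := by
      unfold gS
      rw [Finset.sum_sub_distrib, Finset.sum_const, Finset.sum_boole, nsmul_eq_mul, mul_comm]
      congr 2
      · norm_cast
        congr 1
        ext p
        simp only [Finset.mem_filter, Nat.mem_primesLE, Finset.mem_range]
        constructor
        · rintro ⟨⟨h1, _⟩, h2⟩; exact ⟨by lia, h2⟩
        · rintro ⟨h1, h2⟩; exact ⟨⟨by lia, hS p h2⟩, h2⟩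
      · simp
    rw [Real.dist_eq] at h1
    have e2 : (((Finset.range (t + 1)).filter (fun p => p ∈ S)).card : ℝ) - δ * Nat.primeCounting t =
      ((((Finset.range (t + 1)).filter (fun p => p ∈ S)).card : ℝ) / Nat.primeCounting t - δ) * Nat.primeCounting t := by
      field_simp
    rw [e, e2, abs_mul, Nat.abs_cast]
    have := mul_le_mul_of_nonneg_right h1.le hpi'.le
    linarith

lemma inner_bound {g : ℕ → ℝ} {η C : ℝ} (hη : 0 < η)
    (hG : ∀ t : ℕ, |∑ p ∈ Nat.primesLE t, g p| ≤ η * Nat.primeCounting t + C) (t w : ℕ) (hw : 1 ≤ w) :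
    |∑ p ∈ (Nat.primesLE t).filter (fun p => w ≤ p), g p| ≤ 2 * (η * Nat.primeCounting t + C) := by
  have hnn := (abs_nonneg _).trans (hG t)
  by_cases h : w ≤ t
  · have e : ∑ p ∈ (Nat.primesLE t).filter (fun p => w ≤ p), g p = ∑ p ∈ Nat.primesLE t, g p - ∑ p ∈ Nat.primesLE (w - 1), g p := by
      rw [eq_sub_iff_add_eq, ← Finset.sum_filter_add_sum_filter_not (Nat.primesLE t) (fun p => w ≤ p)]
      congr 2
      ext p
      simp only [Finset.mem_filter, Nat.mem_primesLE]
      constructor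
      · rintro ⟨h1, h2⟩; exact ⟨⟨by lia, h2⟩, by lia⟩
      · rintro ⟨⟨h1, h2⟩, h3⟩; exact ⟨by lia, h2⟩
    rw [e]
    refine (abs_sub _ _).trans ?_
    have h1 := hG t
    have h2 := hG (w - 1)
    have h3 : (Nat.primeCounting (w-1) : ℝ) ≤ Nat.primeCounting t := by
      exact_mod_cast Nat.monotone_primeCounting (by lia : w - 1 ≤ t)
    have := mul_le_mul_of_nonneg_left h3 hη.le
    linarith
  · rw [Finset.filter_false_of_mem]
    · simp only [Finset.sum_empty, abs_zero]; linarith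
    · intro p hp
      have := (Nat.mem_primesLE.mp hp).1
      lia

lemma E_bound {g : ℕ → ℝ} {B η C ε : ℝ} (hη : 0 < η) (hC : 0 ≤ C) (hε : 0 < ε) (hB : ∀ p, |g p| ≤ B)
    (hG : ∀ t : ℕ, |∑ p ∈ Nat.primesLE t, g p| ≤ η * Nat.primeCounting t + C) {N : ℕ} (hN : 2 ≤ N) :
    |∑ n ∈ Finset.Icc 1 N, g (Pmax n)| ≤
      B * (Real.sqrt N + 2 / Real.log N * (2 * N * (ε * Real.log N + Real.log 4)))
      + 10 * η * N * (1 + Real.log N) / (ε * Real.log N) + 2 * C * (N / (N:ℝ) ^ ε) := by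
  have hB0 : 0 ≤ B := (abs_nonneg _).trans (hB 0)
  have hN1 : (1:ℝ) < N := by exact_mod_cast hN
  have hl : 0 < Real.log N := Real.log_pos hN1
  have hpow : (1:ℝ) ≤ (N:ℝ) ^ ε := Real.one_le_rpow hN1.le hε.le
  set Y := ⌊(N:ℝ) ^ ε⌋₊ with hYdef
  have hY : 1 ≤ Y := Nat.le_floor (by simpa using hpow)
  have hY0 : (0:ℝ) < Y := by exact_mod_cast hY
  have hYle : (Y:ℝ) ≤ (N:ℝ) ^ ε := Nat.floor_le (by linarith)
  have hlogY : Real.log Y ≤ ε * Real.log N := by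
    rw [← Real.log_rpow (by linarith)]
    exact Real.log_le_log hY0 hYle
  have hYgt : (N:ℝ) ^ ε ≤ ((Y + 1 : ℕ) : ℝ) := by push_cast; exact (Nat.lt_floor_add_one _).le
  have hlogz : ε * Real.log N ≤ Real.log ((Y + 1 : ℕ) : ℝ) := by
    rw [← Real.log_rpow (by linarith)]
    exact Real.log_le_log (by linarith) hYgt
  rw [← Finset.sum_filter_add_sum_filter_not (Finset.Icc 1 N) (fun n => Pmax n ≤ Y)]
  have e : (Finset.Icc 1 N).filter (fun n => ¬ Pmax n ≤ Y) = (Finset.Icc 1 N).filter (fun n => Y + 1 ≤ Pmax n) := by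
    ext n; simp only [Finset.mem_filter, not_le, Nat.succ_le_iff]
  rw [e, nonsmooth_sum g (by lia : 1 ≤ Y + 1)]
  have b1 : |∑ n ∈ (Finset.Icc 1 N).filter (fun n => Pmax n ≤ Y), g (Pmax n)| ≤
      B * (Real.sqrt N + 2 / Real.log N * (2 * N * (ε * Real.log N + Real.log 4))) := by
    refine (Finset.abs_sum_le_sum_abs _ _).trans ?_
    refine (Finset.sum_le_card_nsmul _ _ B fun n _ => hB _).trans ?_
    rw [nsmul_eq_mul, mul_comm]
    refine mul_le_mul_of_nonneg_left ((smooth_count hY hN).trans ?_) hB0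
    gcongr
  have b2 : |∑ m ∈ Finset.Icc 1 (N / (Y+1)), ∑ p ∈ (Nat.primesLE (N / m)).filter (fun p => max (Y+1) (Pmax m) ≤ p), g p|
      ≤ ∑ m ∈ Finset.Icc 1 (N / (Y+1)), (10 * η * N / (ε * Real.log N) * (m:ℝ)⁻¹ + 2 * C) := by
    refine (Finset.abs_sum_le_sum_abs _ _).trans (Finset.sum_le_sum fun m hm => ?_)
    refine (inner_bound hη hG (N / m) _ (by lia)).trans ?_
    have hm' := Finset.mem_Icc.mp hm
    have hm0 : (0:ℝ) < m := by exact_mod_cast hm'.1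
    have ht : Y + 1 ≤ N / m := by
      rw [Nat.le_div_iff_mul_le (by lia)]
      have := (Nat.le_div_iff_mul_le (by lia)).mp hm'.2
      rw [mul_comm]; exact this
    have h1 := pi_bound (t := N / m) (by lia)
    have ht' : ((Y + 1 : ℕ) : ℝ) ≤ ((N / m : ℕ) : ℝ) := by exact_mod_cast ht
    have h2 : ε * Real.log N ≤ Real.log ((N / m : ℕ) : ℝ) := hlogz.trans (Real.log_le_log (by positivity) ht')
    have h3 : ((N / m : ℕ) : ℝ) / Real.log ((N / m : ℕ) : ℝ) ≤ (N / m) / (ε * Real.log N) := by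
      gcongr
      exact Nat.cast_div_le
    have h4 : η * (Nat.primeCounting (N / m) : ℝ) ≤ η * (5 * ((N / m) / (ε * Real.log N))) := by
      gcongr
      linarith
    have e3 : 2 * (η * (5 * (((N:ℝ) / m) / (ε * Real.log N)))) = 10 * η * N / (ε * Real.log N) * (m:ℝ)⁻¹ := by
      field_simp; ring
    linarith
  have b3 : ∑ m ∈ Finset.Icc 1 (N / (Y+1)), (10 * η * N / (ε * Real.log N) * (m:ℝ)⁻¹ + 2 * C) ≤
      10 * η * N * (1 + Real.log N) / (ε * Real.log N) + 2 * C * (N / (N:ℝ) ^ ε) := by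
    rw [Finset.sum_add_distrib, ← Finset.mul_sum, Finset.sum_const, nsmul_eq_mul, Nat.card_Icc, Nat.add_sub_cancel]
    have h1 : ∑ m ∈ Finset.Icc 1 (N / (Y+1)), (m:ℝ)⁻¹ ≤ 1 + Real.log N := by
      have h2 := harmonic_le_one_add_log N
      rw [harmonic_eq_sum_Icc] at h2
      push_cast at h2
      refine le_trans ?_ h2
      refine Finset.sum_le_sum_of_subset_of_nonneg ?_ fun _ _ _ => by positivity
      exact Finset.Icc_subset_Icc_right (Nat.div_le_self _ _)
    have h2 : ((N / (Y+1) : ℕ) : ℝ) ≤ N / (N:ℝ) ^ ε := by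
      refine Nat.cast_div_le.trans ?_
      gcongr
    have h3 : 10 * η * N / (ε * Real.log N) * ∑ m ∈ Finset.Icc 1 (N / (Y+1)), (m:ℝ)⁻¹ ≤ 10 * η * N / (ε * Real.log N) * (1 + Real.log N) := by
      gcongr
    have h4 := mul_le_mul_of_nonneg_right h2 (by linarith : 0 ≤ 2 * C)
    have e5 : 10 * η * N / (ε * Real.log N) * (1 + Real.log N) = 10 * η * N * (1 + Real.log N) / (ε * Real.log N) := by ring
    linarith
  refine (abs_add_le _ _).trans ?_
  linarith

open Classical in
lemma count_tendsto {S : Set ℕ} (hS : ∀ p ∈ S, p.Prime) {δ : ℝ}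
    (hδ : Tendsto (fun X : ℕ =>
        (((Finset.range (X + 1)).filter (fun p => p ∈ S)).card : ℝ) /
          (Nat.primeCounting X : ℝ)) atTop (nhds δ)) :
    Tendsto (fun N : ℕ => (∑ n ∈ Finset.Icc 1 N, (if Pmax n ∈ S then (1:ℝ) else 0)) / N) atTop (nhds δ) := by
  rw [Metric.tendsto_atTop]
  intro τ hτ
  set B := 1 + |δ| with hBdef
  have hB : 0 < B := by positivity
  set ε := τ / (16 * B) with hεdef
  have hε : 0 < ε := by positivity
  set η := ε * τ / 40 with hηdef
  have hη : 0 < η := by positivity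
  obtain ⟨C, hC0, hC⟩ := G_bound hS hδ hη
  have hlog : Tendsto (fun N : ℕ => (Real.log N)⁻¹) atTop (nhds 0) :=
    (Real.tendsto_log_atTop.comp tendsto_natCast_atTop_atTop).inv_tendsto_atTop
  have hsq : Tendsto (fun N : ℕ => (Real.sqrt N)⁻¹) atTop (nhds 0) :=
    (Real.tendsto_sqrt_atTop.comp tendsto_natCast_atTop_atTop).inv_tendsto_atTop
  have hpw : Tendsto (fun N : ℕ => ((N:ℝ) ^ ε)⁻¹) atTop (nhds 0) :=
    ((tendsto_rpow_atTop hε).comp tendsto_natCast_atTop_atTop).inv_tendsto_atTop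
  have hlim : Tendsto (fun N : ℕ => B * ((Real.sqrt N)⁻¹ + 4 * (ε + Real.log 4 * (Real.log N)⁻¹))
      + 10 * η / ε * ((Real.log N)⁻¹ + 1) + 2 * C * ((N:ℝ) ^ ε)⁻¹) atTop
      (nhds (B * (0 + 4 * (ε + Real.log 4 * 0)) + 10 * η / ε * (0 + 1) + 2 * C * 0)) := by
    refine Tendsto.add (Tendsto.add (Tendsto.const_mul _ (hsq.add (Tendsto.const_mul _ (tendsto_const_nhds.add (hlog.const_mul _))))) ?_) (hpw.const_mul _)
    exact (hlog.add tendsto_const_nhds).const_mul _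
  have hval : B * (0 + 4 * (ε + Real.log 4 * 0)) + 10 * η / ε * (0 + 1) + 2 * C * 0 = τ / 2 := by
    have h1 : B * (4 * ε) = τ / 4 := by rw [hεdef]; field_simp; ring
    have h2 : 10 * η / ε = τ / 4 := by rw [hηdef]; field_simp; ring
    rw [h2]; linarith
  rw [hval] at hlim
  obtain ⟨N0, hN0⟩ := (hlim.eventually_lt_const (by linarith : τ / 2 < τ)).exists_forall_of_atTop
  refine ⟨N0 + 2, fun N hN => ?_⟩
  have hb := hN0 N (by lia)
  have hN2 : 2 ≤ N := by lia
  have hN1 : (1:ℝ) < N := by exact_mod_cast hN2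
  have hNp : (0:ℝ) < N := by linarith
  have hl : 0 < Real.log N := Real.log_pos hN1
  have hE := E_bound hη hC0 hε (gS_bound S δ) hC hN2
  have e1 : ∑ n ∈ Finset.Icc 1 N, gS S δ (Pmax n) = ∑ n ∈ Finset.Icc 1 N, (if Pmax n ∈ S then (1:ℝ) else 0) - δ * N := by
    unfold gS
    rw [Finset.sum_sub_distrib]
    simp [mul_comm]
  rw [e1] at hE
  rw [Real.dist_eq]
  have e2 : (∑ n ∈ Finset.Icc 1 N, (if Pmax n ∈ S then (1:ℝ) else 0)) / N - δ = (∑ n ∈ Finset.Icc 1 N, (if Pmax n ∈ S then (1:ℝ) else 0) - δ * N) / N := by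
    field_simp
  rw [e2, abs_div, Nat.abs_cast, div_lt_iff₀ hNp]
  refine hE.trans_lt ?_
  have h2 := mul_lt_mul_of_pos_right hb hNp
  refine lt_of_le_of_lt (le_of_eq ?_) h2
  have hs : Real.sqrt N = (Real.sqrt N)⁻¹ * N := by
    have h3 := Real.mul_self_sqrt hNp.le
    have h4 : Real.sqrt N ≠ 0 := (Real.sqrt_pos.mpr hNp).ne'
    field_simp
    nlinarith
  have hpp : ((N:ℝ) ^ ε) ≠ 0 := (Real.rpow_pos_of_pos hNp _).ne'
  rw [← hBdef]
  nth_rewrite 1 [hs]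
  generalize Real.sqrt N = r
  generalize (N:ℝ) ^ ε = w at *
  field_simp
  ring



open Classical in
/-- Alladi's theorem for sets of rational primes with a natural density. -/
theorem mobius_sum_density_nat (S : Set ℕ) (hS : ∀ p ∈ S, p.Prime) (δ : ℝ)
    (hδ : Tendsto (fun X : ℕ =>
        (((Finset.range (X + 1)).filter (fun p => p ∈ S)).card : ℝ) /
          (Nat.primeCounting X : ℝ)) atTop (nhds δ)) :
    Tendsto (fun X : ℕ =>
        ∑ n ∈ Finset.Icc 2 X, if n.minFac ∈ S then (moebius n : ℝ) / (n : ℝ) else 0)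
      atTop (nhds (-δ)) := by
  exact final_of_count hS (count_tendsto hS hδ)

end AlladiGen
end
end

section
/- Let K be a number field, S a set of prime ideals of K, and a ⊆ O_K a nonzero integral ideal with a ≠ O_K. Then Σ_{b ⊇ a} μ_K(b)·𝟙_D(b) = −Q_S(a), where the sum runs over all integral ideals b containing a and 𝟙_D is the indicator function of D(K,S). -/
open NumberField Ideal Filter

noncomputable section

namespace AlladiGen

variable (K : Type*) [Field K] [NumberField K]

open Classical in
/-- The generalized Möbius function on integral ideals. -/
def muK (a : Ideal (𝓞 K)) : ℤ :=
  if Squarefree a then (-1) ^ (Nat.card {p : Ideal (𝓞 K) // p.IsPrime ∧ a ≤ p}) else 0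

/-- `p` is a prime ideal of minimal norm among those containing `a`. -/
def MinimalPrime (a p : Ideal (𝓞 K)) : Prop :=
  p.IsPrime ∧ a ≤ p ∧ ∀ q : Ideal (𝓞 K), q.IsPrime → a ≤ q → absNorm p ≤ absNorm q

/-- `a ∈ D(K,S)`: `a` is distinguishable with minimal prime in `S`. -/
def InD (S : Set (Ideal (𝓞 K))) (a : Ideal (𝓞 K)) : Prop :=
  ∃ p : Ideal (𝓞 K), MinimalPrime K a p ∧ p ∈ S ∧ ∀ q : Ideal (𝓞 K), MinimalPrime K a q → q = p

/-- `π_S(K; X)`: number of prime ideals in `S` of norm at most `X`. -/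
def primeCount (S : Set (Ideal (𝓞 K))) (X : ℝ) : ℕ :=
  Nat.card {p : Ideal (𝓞 K) // p.IsPrime ∧ p ∈ S ∧ (absNorm p : ℝ) ≤ X}

/-- `S` has natural density `δ` within the prime ideals of `K`. -/
def HasPrimeDensity (S : Set (Ideal (𝓞 K))) (δ : ℝ) : Prop :=
  Tendsto (fun X : ℝ => (primeCount K S X : ℝ) / (primeCount K Set.univ X : ℝ))
    atTop (nhds δ)

/-- `M(a)`: the maximal norm of a prime ideal containing `a`. -/
def maxNorm (a : Ideal (𝓞 K)) : ℕ :=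
  sSup (absNorm '' {p : Ideal (𝓞 K) | p.IsPrime ∧ a ≤ p})

/-- `Q_S(a)`: number of primes in `S` containing `a` of maximal norm. -/
def QS (S : Set (Ideal (𝓞 K))) (a : Ideal (𝓞 K)) : ℕ :=
  Nat.card {p : Ideal (𝓞 K) // p.IsPrime ∧ a ≤ p ∧ p ∈ S ∧ absNorm p = maxNorm K a}

/-- `c_K`: residue of the Dedekind zeta function at 1, via the analytic class number formula. -/
def cK : ℝ :=
  (2 ^ (InfinitePlace.nrRealPlaces K) * (2 * Real.pi) ^ (InfinitePlace.nrComplexPlaces K) *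
    NumberField.Units.regulator K * (NumberField.classNumber K)) /
  ((NumberField.Units.torsionOrder K : ℝ) * Real.sqrt |(NumberField.discr K : ℝ)|)

/-- `Ψ(X,Y)`: number of `Y`-smooth nonzero integral ideals of norm at most `X`. -/
def Psi (X Y : ℝ) : ℕ :=
  Nat.card {a : Ideal (𝓞 K) // a ≠ ⊥ ∧ (absNorm a : ℝ) ≤ X ∧
    ∀ p : Ideal (𝓞 K), p.IsPrime → a ≤ p → (absNorm p : ℝ) ≤ Y}

/-- `[X]_K`: number of nonzero integral ideals of norm at most `X`. -/
def idealCount (X : ℝ) : ℕ := Nat.card {a : Ideal (𝓞 K) // a ≠ ⊥ ∧ (absNorm a : ℝ) ≤ X}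

/-- The logarithmic integral `Li(X) = ∫_2^X dt / log t`. -/
def Li (X : ℝ) : ℝ := ∫ t in (2:ℝ)..X, 1 / Real.log t

open Classical in
lemma comb_inner {α : Type*} (P : Finset α) (f : α → ℕ) (p : α) (hp : p ∈ P) :
    (∑ T ∈ P.powerset, (-1 : ℤ) ^ T.card *
      (if p ∈ T ∧ ∀ q ∈ T, q ≠ p → f p < f q then 1 else 0)) =
    - (if ∀ q ∈ P, f q ≤ f p then 1 else 0) := by
  have h1 : (∑ T ∈ P.powerset, (-1 : ℤ) ^ T.card *
      (if p ∈ T ∧ ∀ q ∈ T, q ≠ p → f p < f q then 1 else 0)) =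
      ∑ T ∈ (P.filter (fun q => f p < f q)).powerset, -((-1 : ℤ) ^ T.card) := by
    simp only [mul_ite, mul_one, mul_zero]
    rw [← Finset.sum_filter]
    symm
    have hnot : ∀ T ∈ (P.filter (fun q => f p < f q)).powerset, p ∉ T := by
      intro T hT hpT
      have := (Finset.mem_filter.1 (Finset.mem_powerset.1 hT hpT)).2
      omega
    refine Finset.sum_bij' (fun T _ => insert p T) (fun T _ => T.erase p) ?_ ?_ ?_ ?_ ?_
    · intro T hT
      have hT' := Finset.mem_powerset.1 hT
      simp only [Finset.mem_filter, Finset.mem_powerset]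
      refine ⟨?_, Finset.mem_insert_self _ _, ?_⟩
      · intro x hx
        rcases Finset.mem_insert.1 hx with rfl | hx
        · exact hp
        · exact (Finset.mem_filter.1 (hT' hx)).1
      · intro q hq hqp
        rcases Finset.mem_insert.1 hq with rfl | hx
        · exact absurd rfl hqp
        · exact (Finset.mem_filter.1 (hT' hx)).2
    · intro T hT
      simp only [Finset.mem_filter, Finset.mem_powerset] at hT
      rw [Finset.mem_powerset]
      intro x hx
      have hx' := Finset.mem_erase.1 hx
      exact Finset.mem_filter.2 ⟨hT.1 hx'.2, hT.2.2 x hx'.2 hx'.1⟩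
    · intro T hT
      exact Finset.erase_insert (hnot T hT)
    · intro T hT
      simp only [Finset.mem_filter, Finset.mem_powerset] at hT
      exact Finset.insert_erase hT.2.1
    · intro T hT
      rw [Finset.card_insert_of_notMem (hnot T hT)]
      ring
  rw [h1, Finset.sum_neg_distrib, Finset.sum_powerset_neg_one_pow_card]
  simp [Finset.filter_eq_empty_iff]

open Classical in
lemma comb_main {α : Type*} (P : Finset α) (f : α → ℕ) (S : Set α) :
    (∑ T ∈ P.powerset, (-1 : ℤ) ^ T.card *
      (if ∃ p ∈ T, p ∈ S ∧ ∀ q ∈ T, q ≠ p → f p < f q then 1 else 0)) =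
    - ((P.filter (fun p => p ∈ S ∧ ∀ q ∈ P, f q ≤ f p)).card : ℤ) := by
  have h1 : ∀ T ∈ P.powerset,
      (if ∃ p ∈ T, p ∈ S ∧ ∀ q ∈ T, q ≠ p → f p < f q then (1 : ℤ) else 0) =
      ∑ p ∈ P.filter (· ∈ S), (if p ∈ T ∧ ∀ q ∈ T, q ≠ p → f p < f q then 1 else 0) := by
    intro T hT
    have hT' := Finset.mem_powerset.1 hT
    split_ifs with h
    · obtain ⟨p, hpT, hpS, hp⟩ := h
      rw [Finset.sum_eq_single p]
      · rw [if_pos ⟨hpT, hp⟩]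
      · intro b _ hbp
        rw [if_neg]
        rintro ⟨hbT, hb⟩
        have := hp b hbT hbp
        have := hb p hpT hbp.symm
        omega
      · intro h
        exact absurd (Finset.mem_filter.2 ⟨hT' hpT, hpS⟩) h
    · symm
      apply Finset.sum_eq_zero
      intro p hp
      rw [if_neg]
      rintro ⟨a, b⟩
      exact h ⟨p, a, (Finset.mem_filter.1 hp).2, b⟩
  rw [Finset.sum_congr rfl (fun T hT => by rw [h1 T hT, Finset.mul_sum]), Finset.sum_comm,
    Finset.sum_congr rfl (fun p hp => comb_inner P f p (Finset.mem_filter.1 hp).1),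
    Finset.sum_neg_distrib, Finset.sum_boole, Finset.filter_filter]

open UniqueFactorizationMonoid in
lemma mem_pf {a : Ideal (𝓞 K)} (ha : a ≠ ⊥) (p : Ideal (𝓞 K)) :
    p ∈ primeFactors a ↔ p.IsPrime ∧ a ≤ p := by
  rw [mem_primeFactors, Ideal.mem_normalizedFactors_iff ha]

lemma prime_of_pf {a : Ideal (𝓞 K)} (ha : a ≠ ⊥) {p : Ideal (𝓞 K)} (hp : p.IsPrime)
    (h : a ≤ p) : Prime p :=
  Ideal.prime_of_isPrime (fun h0 => ha (le_bot_iff.1 (h0 ▸ h))) hp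

lemma prod_le_iff {T : Finset (Ideal (𝓞 K))} (hT : ∀ p ∈ T, Prime p) (q : Ideal (𝓞 K))
    (hq : q.IsPrime) : ∏ p ∈ T, p ≤ q ↔ q ∈ T := by
  constructor
  · intro h
    obtain ⟨p, hp, hpq⟩ := (Ideal.IsPrime.prod_le hq).1 h
    have hp1 := Ideal.isPrime_of_prime (hT p hp)
    have := (hp1.isMaximal (hT p hp).ne_zero).eq_of_le hq.ne_top hpq
    exact this ▸ hp
  · intro h
    exact Ideal.le_of_dvd (Finset.dvd_prod_of_mem _ h)

lemma sqf_prod {T : Finset (Ideal (𝓞 K))} (hT : ∀ p ∈ T, Prime p) :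
    Squarefree (∏ p ∈ T, p) := by
  refine Finset.squarefree_prod_of_pairwise_isCoprime ?_ (fun p hp => (hT p hp).squarefree)
  intro p hp q hq hpq
  refine ((hT p hp).irreducible.isRelPrime_iff_not_dvd).2 fun h => hpq ?_
  exact associated_iff_eq.1 ((hT p hp).associated_of_dvd (hT q hq) h)

lemma muK_prod {T : Finset (Ideal (𝓞 K))} (hT : ∀ p ∈ T, Prime p) :
    muK K (∏ p ∈ T, p) = (-1) ^ T.card := by
  rw [muK, if_pos (sqf_prod K hT)]
  congr 1
  refine Nat.subtype_card T fun p => ⟨fun h => ?_, fun h => (prod_le_iff K hT p h.1).1 h.2⟩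
  have hp' := Ideal.isPrime_of_prime (hT p h)
  exact ⟨hp', (prod_le_iff K hT p hp').2 h⟩

lemma InD_prod (S : Set (Ideal (𝓞 K))) {T : Finset (Ideal (𝓞 K))} (hT : ∀ p ∈ T, Prime p) :
    InD K S (∏ p ∈ T, p) ↔
      ∃ p ∈ T, p ∈ S ∧ ∀ q ∈ T, q ≠ p → absNorm p < absNorm q := by
  have hm : ∀ p, MinimalPrime K (∏ p ∈ T, p) p ↔ p ∈ T ∧ ∀ q ∈ T, absNorm p ≤ absNorm q := by
    intro p
    constructor
    · rintro ⟨h1, h2, h3⟩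
      refine ⟨(prod_le_iff K hT p h1).1 h2, fun q hq => ?_⟩
      have hq' := Ideal.isPrime_of_prime (hT q hq)
      exact h3 q hq' ((prod_le_iff K hT q hq').2 hq)
    · rintro ⟨h1, h2⟩
      have hp' := Ideal.isPrime_of_prime (hT p h1)
      exact ⟨hp', (prod_le_iff K hT p hp').2 h1,
        fun q hq hle => h2 q ((prod_le_iff K hT q hq).1 hle)⟩
  simp only [InD, hm]
  constructor
  · rintro ⟨p, ⟨h1, h2⟩, h3, h4⟩
    refine ⟨p, h1, h3, fun q hq hqp => lt_of_le_of_ne (h2 q hq) fun he => hqp ?_⟩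
    exact h4 q ⟨hq, fun r hr => he ▸ h2 r hr⟩
  · rintro ⟨p, h1, h3, h4⟩
    refine ⟨p, ⟨h1, fun q hq => ?_⟩, h3, ?_⟩
    · by_cases h : q = p
      · rw [h]
      · exact (h4 q hq h).le
    · rintro q ⟨hq, hq'⟩
      by_contra h
      exact absurd (h4 q hq h) (not_lt.2 (hq' p h1))

open UniqueFactorizationMonoid in
open Classical in
lemma QS_eq (S : Set (Ideal (𝓞 K))) (a : Ideal (𝓞 K)) (ha : a ≠ ⊥) :
    QS K S a = ((primeFactors a).filter
      (fun p => p ∈ S ∧ ∀ q ∈ primeFactors a, absNorm q ≤ absNorm p)).card := by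
  have hbdd : BddAbove (absNorm '' {p : Ideal (𝓞 K) | p.IsPrime ∧ a ≤ p}) := by
    apply Set.Finite.bddAbove
    apply Set.Finite.image
    refine (primeFactors a).finite_toSet.subset fun p hp => ?_
    exact (mem_pf K ha p).2 hp
  rw [QS]
  refine Nat.subtype_card _ fun p => ?_
  simp only [Finset.mem_filter, mem_pf K ha]
  constructor
  · rintro ⟨⟨h1, h2⟩, h3, h4⟩
    refine ⟨h1, h2, h3, ?_⟩
    have hg : IsGreatest (absNorm '' {p : Ideal (𝓞 K) | p.IsPrime ∧ a ≤ p}) (absNorm p) := by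
      refine ⟨⟨p, ⟨h1, h2⟩, rfl⟩, ?_⟩
      rintro _ ⟨q, hq, rfl⟩
      exact h4 q hq
    exact hg.csSup_eq.symm
  · rintro ⟨h1, h2, h3, h4⟩
    refine ⟨⟨h1, h2⟩, h3, fun q hq => ?_⟩
    rw [h4]
    exact le_csSup hbdd ⟨q, hq, rfl⟩

open Classical in
/-- Duality lemma: `∑_{b ⊇ a} μ(b) 𝟙_D(b) = -Q_S(a)`. -/
theorem mobius_duality (S : Set (Ideal (𝓞 K))) (hS : ∀ p ∈ S, p.IsPrime)
    (a : Ideal (𝓞 K)) (ha : a ≠ ⊥) (ha' : a ≠ ⊤) :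
    ∑' b : {b : Ideal (𝓞 K) // a ≤ b},
        (muK K b.1 : ℝ) * (if InD K S b.1 then 1 else 0) = -(QS K S a : ℝ) := by
  have hpr : ∀ T ∈ (UniqueFactorizationMonoid.primeFactors a).powerset, ∀ p ∈ T, Prime p := by
    intro T hT p hp
    have := (mem_pf K ha p).1 (Finset.mem_powerset.1 hT hp)
    exact prime_of_pf K ha this.1 this.2
  have hle : ∀ T ∈ (UniqueFactorizationMonoid.primeFactors a).powerset, a ≤ ∏ p ∈ T, p := by
    intro T hT
    refine Ideal.le_of_dvd (Finset.prod_primes_dvd a (hpr T hT) fun p hp => ?_)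
    exact Ideal.dvd_iff_le.2 ((mem_pf K ha p).1 (Finset.mem_powerset.1 hT hp)).2
  let g : {T // T ∈ (UniqueFactorizationMonoid.primeFactors a).powerset} →
      {b : Ideal (𝓞 K) // a ≤ b} := fun T => ⟨∏ p ∈ T.1, p, hle T.1 T.2⟩
  have hg : Function.Injective g := by
    rintro ⟨T, hT⟩ ⟨U, hU⟩ h
    have h' : ∏ p ∈ T, p = ∏ p ∈ U, p := congrArg Subtype.val h
    apply Subtype.ext
    ext q
    constructor
    · intro hq
      have hq' := Ideal.isPrime_of_prime (hpr T hT q hq)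
      rwa [← prod_le_iff K (hpr U hU) q hq', ← h', prod_le_iff K (hpr T hT) q hq']
    · intro hq
      have hq' := Ideal.isPrime_of_prime (hpr U hU q hq)
      rwa [← prod_le_iff K (hpr T hT) q hq', h', prod_le_iff K (hpr U hU) q hq']
  rw [← hg.tsum_eq, tsum_fintype]
  · have := comb_main (UniqueFactorizationMonoid.primeFactors a) (fun p => absNorm p) S
    rw [← QS_eq K S a ha, ← Finset.sum_coe_sort] at this
    have h2 := congrArg (Int.cast : ℤ → ℝ) this
    push_cast at h2
    rw [← h2]
    refine Finset.sum_congr rfl fun T _ => ?_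
    simp only [g]
    rw [muK_prod K (hpr T.1 T.2)]
    simp only [InD_prod K S (hpr T.1 T.2)]
    push_cast
    rfl
  · rintro ⟨b, hb⟩ hsupp
    have hb0 : b ≠ ⊥ := fun h => ha (le_bot_iff.1 (h ▸ hb))
    have hsq : Squarefree b := by
      by_contra h
      apply hsupp
      simp [muK, h]
    refine ⟨⟨UniqueFactorizationMonoid.primeFactors b, ?_⟩, ?_⟩
    · rw [Finset.mem_powerset]
      intro p hp
      have := (mem_pf K hb0 p).1 hp
      exact (mem_pf K ha p).2 ⟨this.1, hb.trans this.2⟩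
    · apply Subtype.ext
      have h := UniqueFactorizationMonoid.radical_associated hsq.isRadical hb0
      exact associated_iff_eq.1 h

end AlladiGen
end
end

section
/- Let f be a function on positive integers with f(1) = 0, let S be a set of primes, and set F(m) = f(p_max(m))·𝟙[p_max(m) ∈ S] for m ≥ 2 and F(1)=0, where p_max(m) is the largest prime factor of m. Then for every integer n ≥ 2 with a unique smallest prime factor p_min(n), one has Σ_{d | n} μ(d) F(d) equal to −f(p_min(n)) when p_min(n) ∈ S; more simply, for any function f on the positive integers with f(1)=0 and any squarefree-supported sum, Σ_{d | n} μ(d) f(p_max(d)) = −f(p_min(n)) for all integers n ≥ 2. -/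
open Filter ArithmeticFunction

noncomputable section

namespace AlladiGen

/-- The largest prime factor of `n`, with the convention `pmax 1 = 1`. -/
def pmax (n : ℕ) : ℕ := if n ≤ 1 then 1 else n.primeFactors.sup _root_.id

theorem pmax_mul (n d : ℕ) (hn : 2 ≤ n) (hd : d ∣ n) (h1 : 2 ≤ d) :
    pmax (n.minFac * d) = pmax d := by
  have hq : n.minFac.Prime := Nat.minFac_prime (by omega)
  have hle : n.minFac ≤ d.primeFactors.sup _root_.id := by
    have hp : d.minFac.Prime := Nat.minFac_prime (by omega)
    have h2 : d.minFac ∈ d.primeFactors :=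
      Nat.mem_primeFactors.2 ⟨hp, Nat.minFac_dvd d, by omega⟩
    exact (Nat.minFac_le_of_dvd hp.two_le ((Nat.minFac_dvd d).trans hd)).trans
      (Finset.le_sup (f := _root_.id) h2)
  have h3 : ¬ n.minFac * d ≤ 1 := by
    have := hq.two_le
    nlinarith
  unfold pmax
  rw [if_neg h3, if_neg (by omega), Nat.primeFactors_mul hq.ne_zero (by omega),
    hq.primeFactors, Finset.sup_union, Finset.sup_singleton]
  exact sup_eq_right.2 hle

theorem pmax_prime (q : ℕ) (hq : q.Prime) : pmax q = q := by
  have := hq.two_le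
  unfold pmax
  rw [if_neg (by omega), hq.primeFactors, Finset.sup_singleton]
  rfl

theorem duality_aux (f : ℕ → ℝ) (hf : f 1 = 0) (n : ℕ) (hn : 2 ≤ n) :
    ∑ d ∈ n.divisors, (moebius d : ℝ) * f (pmax d) = -f n.minFac := by
  classical
  have hq : n.minFac.Prime := Nat.minFac_prime (by omega)
  have hqn : n.minFac ∣ n := Nat.minFac_dvd n
  have hpm := pmax_mul n
  obtain ⟨q, hqe⟩ : ∃ q, q = n.minFac := ⟨_, rfl⟩
  rw [← hqe] at hq hqn hpm ⊢
  have hq2 := hq.two_le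
  have hmu : ∀ d, ¬ q ∣ d → moebius (q * d) = - moebius d := by
    intro d hd
    rw [isMultiplicative_moebius.map_mul_of_coprime ((Nat.Prime.coprime_iff_not_dvd hq).2 hd),
      moebius_apply_prime hq]
    ring
  have e1 : ∑ d ∈ n.divisors, (moebius d : ℝ) * f (pmax d)
      = ∑ d ∈ n.divisors with Squarefree d, (moebius d : ℝ) * f (pmax d) := by
    symm
    apply Finset.sum_filter_of_ne
    intro d _ h
    by_contra hs
    apply h
    rw [moebius_eq_zero_of_not_squarefree hs]
    simp
  have hsub : ({q} : Finset ℕ) ⊆ n.divisors.filter Squarefree := by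
    intro x hx
    rw [Finset.mem_singleton] at hx
    subst hx
    simp only [Finset.mem_filter, Nat.mem_divisors]
    exact ⟨⟨hqn, by omega⟩, hq.squarefree⟩
  have hsub1 : ({1, q} : Finset ℕ) ⊆ n.divisors.filter Squarefree := by
    intro x hx
    rw [Finset.mem_insert] at hx
    rcases hx with rfl | hx
    · simp; omega
    · exact hsub hx
  rw [e1, ← Finset.sum_sdiff hsub1, Finset.sum_pair (by omega), pmax_prime q hq,
    moebius_apply_prime hq]
  have hp1 : pmax 1 = 1 := by simp [pmax]
  rw [hp1, hf]
  have key : ∑ d ∈ n.divisors.filter Squarefree \ {1, q}, (moebius d : ℝ) * f (pmax d) = 0 := by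
    have hne : ∀ d, d ∈ n.divisors.filter Squarefree \ {1, q} →
        d ∣ n ∧ Squarefree d ∧ d ≠ 1 ∧ d ≠ q ∧ 2 ≤ d := by
      intro d hd
      simp only [Finset.mem_sdiff, Finset.mem_filter, Nat.mem_divisors, Finset.mem_insert,
        Finset.mem_singleton, not_or] at hd
      have : d ≠ 0 := hd.1.2.ne_zero
      exact ⟨hd.1.1.1, hd.1.2, hd.2.1, hd.2.2, by omega⟩
    have hco : ∀ e, Squarefree (q * e) → ¬ q ∣ e := by
      intro e hs he
      have := hs q (Nat.mul_dvd_mul_left q he)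
      exact hq.one_lt.ne' (Nat.isUnit_iff.1 this)
    refine Finset.sum_involution (fun d _ => if q ∣ d then d / q else q * d) ?_ ?_ ?_ ?_
    · intro d hd
      obtain ⟨h1, h2, h3, h4, h5⟩ := hne d hd
      by_cases h : q ∣ d
      · obtain ⟨e, rfl⟩ := h
        have he := hco e h2
        have he0 : e ≠ 0 := by rintro rfl; simp at he
        have he1 : e ≠ 1 := by rintro rfl; simp at h4
        simp only [dvd_mul_right, if_true, Nat.mul_div_cancel_left e hq.pos]
        rw [hmu e he, hpm e hn ((Dvd.intro_left q rfl).trans h1) (by omega)]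
        push_cast; ring
      · simp only [h, if_false]
        rw [hmu d h, hpm d hn h1 h5]
        push_cast; ring
    · intro d hd _
      obtain ⟨h1, h2, h3, h4, h5⟩ := hne d hd
      by_cases h : q ∣ d
      · simp only [h, if_true]
        exact (Nat.div_lt_self (by omega) (by omega)).ne
      · simp only [h, if_false]
        nlinarith
    · intro d hd
      obtain ⟨h1, h2, h3, h4, h5⟩ := hne d hd
      simp only [Finset.mem_sdiff, Finset.mem_filter, Nat.mem_divisors, Finset.mem_insert,
        Finset.mem_singleton, not_or]
      by_cases h : q ∣ d
      · obtain ⟨e, rfl⟩ := h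
        have he := hco e h2
        have he1 : e ≠ 1 := by rintro rfl; simp at h4
        simp only [dvd_mul_right, if_true, Nat.mul_div_cancel_left e hq.pos]
        refine ⟨⟨⟨(Dvd.intro_left q rfl).trans h1, by omega⟩,
          h2.squarefree_of_dvd (Dvd.intro_left q rfl)⟩, he1, ?_⟩
        rintro rfl
        exact he dvd_rfl
      · simp only [h, if_false]
        have hc : Nat.Coprime q d := (Nat.Prime.coprime_iff_not_dvd hq).2 h
        refine ⟨⟨⟨hc.mul_dvd_of_dvd_of_dvd hqn h1, by omega⟩,
          (Nat.squarefree_mul hc).2 ⟨hq.squarefree, h2⟩⟩, ?_, ?_⟩ <;> nlinarith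
    · intro d hd
      obtain ⟨h1, h2, h3, h4, h5⟩ := hne d hd
      by_cases h : q ∣ d
      · obtain ⟨e, rfl⟩ := h
        have he := hco e h2
        simp only [dvd_mul_right, if_true, Nat.mul_div_cancel_left e hq.pos, he, if_false]
      · simp only [h, if_false, dvd_mul_right, if_true, Nat.mul_div_cancel_left d hq.pos]
  rw [key]
  push_cast; ring

open Classical in
/-- Alladi's duality between smallest and largest prime factors. -/
theorem duality_nat (f : ℕ → ℝ) (hf : f 1 = 0) (S : Set ℕ) (n : ℕ) (hn : 2 ≤ n) :
    (n.minFac ∈ S →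
      ∑ d ∈ n.divisors, (moebius d : ℝ) * (if pmax d ∈ S then f (pmax d) else 0) =
        -f n.minFac) ∧
    (∑ d ∈ n.divisors, (moebius d : ℝ) * f (pmax d) = -f n.minFac) := by
  refine ⟨fun hS => ?_, duality_aux f hf n hn⟩
  have h := duality_aux (fun m => if m ∈ S then f m else 0) (by simp [hf]) n hn
  simp only [hS, if_true] at h
  exact h

end AlladiGen
end
end

section
/- Fix a number field K and ε > 0. There exists a constant C_ε > 0 such that for all X ≥ 2 and Y ≥ 2, writing β = (log X)/(log Y), if 1 ≤ β ≤ (log X)^{1−ε} then Ψ(X,Y) ≤ C_ε · X · exp(−β · log(β/2)). -/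
open NumberField Ideal Filter

noncomputable section

namespace AlladiGen

variable (K : Type*) [Field K] [NumberField K]

set_option linter.unusedSectionVars false

/-- prime ideals of norm at most `Y`. -/
def PSet (Y : ℝ) : Set (Ideal (𝓞 K)) := {p | p.IsPrime ∧ p ≠ ⊥ ∧ (absNorm p : ℝ) ≤ Y}

lemma finite_norm_le (Y : ℝ) : {a : Ideal (𝓞 K) | (absNorm a : ℝ) ≤ Y}.Finite := by
  refine (Ideal.finite_setOfPred_absNorm_le (S := 𝓞 K) ⌊Y⌋₊).subset fun a ha => ?_
  exact Nat.le_floor ha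

lemma PSet_finite (Y : ℝ) : (PSet K Y).Finite :=
  (finite_norm_le K Y).subset fun _ h => h.2.2

def PF (Y : ℝ) : Finset (Ideal (𝓞 K)) := (PSet_finite K Y).toFinset

lemma mem_PF {Y : ℝ} {p : Ideal (𝓞 K)} :
    p ∈ PF K Y ↔ p.IsPrime ∧ p ≠ ⊥ ∧ (absNorm p : ℝ) ≤ Y := by
  simp [PF, PSet]

lemma PF_prime {Y : ℝ} {p : Ideal (𝓞 K)} (h : p ∈ PF K Y) : Prime p :=
  Ideal.prime_of_isPrime ((mem_PF K).1 h).2.1 ((mem_PF K).1 h).1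

lemma two_le_norm {p : Ideal (𝓞 K)} (h : Prime p) : (2 : ℝ) ≤ absNorm p := by
  have h0 : absNorm p ≠ 0 := by
    rw [Ne, Ideal.absNorm_eq_zero_iff]; exact h.ne_zero
  have h1 : absNorm p ≠ 1 := by
    rw [Ne, Ideal.absNorm_eq_one_iff]; intro h'; exact h.not_isUnit (by rw [h', ← Ideal.one_eq_top]; exact isUnit_one)
  have : 2 ≤ absNorm p := by omega
  exact_mod_cast this

lemma one_le_norm {a : Ideal (𝓞 K)} (h : a ≠ ⊥) : (1 : ℝ) ≤ absNorm a := by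
  have h0 : absNorm a ≠ 0 := by
    rw [Ne, Ideal.absNorm_eq_zero_iff]; exact h
  have : 1 ≤ absNorm a := by omega
  exact_mod_cast this

def SSet (X Y : ℝ) : Set (Ideal (𝓞 K)) := {a | a ≠ ⊥ ∧ (absNorm a : ℝ) ≤ X ∧
    ∀ p : Ideal (𝓞 K), p.IsPrime → a ≤ p → (absNorm p : ℝ) ≤ Y}

lemma SSet_finite (X Y : ℝ) : (SSet K X Y).Finite :=
  (finite_norm_le K X).subset fun _ h => h.2.1

def SF (X Y : ℝ) : Finset (Ideal (𝓞 K)) := (SSet_finite K X Y).toFinset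

lemma mem_SF {X Y : ℝ} {a : Ideal (𝓞 K)} :
    a ∈ SF K X Y ↔ a ≠ ⊥ ∧ (absNorm a : ℝ) ≤ X ∧
    ∀ p : Ideal (𝓞 K), p.IsPrime → a ≤ p → (absNorm p : ℝ) ≤ Y := by
  simp [SF, SSet]

lemma Psi_eq (X Y : ℝ) : Psi K X Y = (SF K X Y).card := by
  have : Psi K X Y = Nat.card (SSet K X Y) := rfl
  rw [this, SF, Nat.card_coe_set_eq, Set.ncard_eq_toFinset_card _ (SSet_finite K X Y)]

open UniqueFactorizationMonoid in
lemma mem_factors_SF {X Y : ℝ} {a p : Ideal (𝓞 K)} (ha : a ∈ SF K X Y)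
    (hp : p ∈ normalizedFactors a) : p ∈ PF K Y := by
  have hpr := prime_of_normalized_factor p hp
  have h1 := Ideal.isPrime_of_prime hpr
  exact (mem_PF K).2 ⟨h1, hpr.ne_zero, ((mem_SF K).1 ha).2.2 p h1
    (Ideal.dvd_iff_le.1 (dvd_of_mem_normalizedFactors hp))⟩

open UniqueFactorizationMonoid

open Classical in
/-- product of prime powers -/
def Ex (P : Finset (Ideal (𝓞 K))) (g : P → ℕ) : Ideal (𝓞 K) := ∏ p : P, p.1 ^ g p

open Classical in
lemma Ex_eq (P : Finset (Ideal (𝓞 K))) (g : P → ℕ) :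
    Ex K P g = (∑ p : P, g p • ({p.1} : Multiset (Ideal (𝓞 K)))).prod := by
  rw [Ex, Multiset.prod_sum]
  refine Finset.prod_congr rfl fun p _ => ?_
  rw [Multiset.prod_nsmul, Multiset.prod_singleton]

open Classical in
lemma count_Ex (P : Finset (Ideal (𝓞 K))) (hP : ∀ p ∈ P, Prime p) (g : P → ℕ) (p : P) :
    (normalizedFactors (Ex K P g)).count p.1 = g p := by
  rw [Ex_eq, normalizedFactors_prod_of_prime, Multiset.count_sum']
  · rw [Finset.sum_eq_single p]
    · simp
    · intro q _ hq
      have : p.1 ≠ q.1 := fun h => hq (Subtype.ext h.symm)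
      simp [this]
    · simp
  · intro q hq
    rw [Multiset.mem_sum] at hq
    obtain ⟨r, -, hr⟩ := hq
    have := Multiset.mem_of_mem_nsmul hr
    rw [Multiset.mem_singleton] at this
    rw [this]; exact hP _ r.2

lemma Ex_inj (P : Finset (Ideal (𝓞 K))) (hP : ∀ p ∈ P, Prime p) : Function.Injective (Ex K P) := by
  classical
  intro g h e
  funext p
  rw [← count_Ex K P hP g p, e, count_Ex K P hP h p]

open Classical in
lemma Ex_count (P : Finset (Ideal (𝓞 K))) (a : Ideal (𝓞 K)) (ha : a ≠ ⊥)
    (hf : ∀ p ∈ normalizedFactors a, p ∈ P) :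
    Ex K P (fun p => (normalizedFactors a).count p.1) = a := by
  conv_rhs => rw [← Ideal.prod_normalizedFactors_eq_self ha]
  rw [Ex, Finset.prod_multiset_count_of_subset _ P (fun p hp => hf p (Multiset.mem_toFinset.1 hp))]
  exact Finset.prod_coe_sort P (fun p => p ^ (normalizedFactors a).count p)

open Classical in
lemma norm_Ex (P : Finset (Ideal (𝓞 K))) (g : P → ℕ) :
    (absNorm (Ex K P g) : ℝ) = ∏ p : P, (absNorm p.1 : ℝ) ^ g p := by
  rw [Ex, map_prod]; push_cast; simp

lemma rpow_norm_Ex (P : Finset (Ideal (𝓞 K))) (g : P → ℕ) (s : ℝ) :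
    (absNorm (Ex K P g) : ℝ) ^ (-s) = ∏ p : P, ((absNorm p.1 : ℝ) ^ (-s)) ^ g p := by
  rw [norm_Ex, ← Real.finsetProd_rpow _ _ (fun _ _ => by positivity)]
  refine Finset.prod_congr rfl fun p _ => ?_
  rw [← Real.rpow_natCast_mul (by positivity), mul_comm, Real.rpow_mul_natCast (by positivity)]

lemma xs_bound {p : Ideal (𝓞 K)} (h : Prime p) {s : ℝ} (hs : 0 < s) :
    0 < (absNorm p : ℝ) ^ (-s) ∧ (absNorm p : ℝ) ^ (-s) < 1 := by
  have := two_le_norm K h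
  exact ⟨Real.rpow_pos_of_pos (by linarith) _,
    Real.rpow_lt_one_of_one_lt_of_neg (by linarith) (by linarith)⟩

lemma sum_le_euler (P : Finset (Ideal (𝓞 K))) (hP : ∀ p ∈ P, Prime p)
    (S : Finset (Ideal (𝓞 K))) (hS : ∀ a ∈ S, a ≠ ⊥ ∧ ∀ p ∈ normalizedFactors a, p ∈ P)
    (s : ℝ) (hs : 0 < s) :
    ∑ a ∈ S, (absNorm a : ℝ) ^ (-s) ≤ ∏ p ∈ P, (1 - (absNorm p : ℝ) ^ (-s))⁻¹ := by
  classical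
  set M := ∑ a ∈ S, ((normalizedFactors a).card + 1)
  have h1 : ∑ a ∈ S, (absNorm a : ℝ) ^ (-s) ≤
      ∑ g ∈ Fintype.piFinset (fun _ : P => Finset.range M),
        (absNorm (Ex K P g) : ℝ) ^ (-s) := by
    have : ∑ a ∈ S, (absNorm a : ℝ) ^ (-s) =
        ∑ g ∈ S.image (fun a => fun p : P => (normalizedFactors a).count p.1),
          (absNorm (Ex K P g) : ℝ) ^ (-s) := by
      rw [Finset.sum_image]
      · refine Finset.sum_congr rfl fun a ha => ?_
        rw [Ex_count K P a (hS a ha).1 (hS a ha).2]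
      · intro a ha b hb hab
        rw [← Ex_count K P a (hS a ha).1 (hS a ha).2, ← Ex_count K P b (hS b hb).1 (hS b hb).2]
        exact congrArg _ hab
    rw [this]
    refine Finset.sum_le_sum_of_subset_of_nonneg ?_ (fun _ _ _ => by positivity)
    intro g hg
    obtain ⟨a, ha, rfl⟩ := Finset.mem_image.1 hg
    rw [Fintype.mem_piFinset]
    intro p
    rw [Finset.mem_range]
    have h2 := Multiset.count_le_card p.1 (normalizedFactors a)
    have h3 : (normalizedFactors a).card + 1 ≤ M :=
      Finset.single_le_sum (f := fun a => (normalizedFactors a).card + 1)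
        (fun _ _ => Nat.zero_le _) ha
    omega
  refine h1.trans ?_
  simp_rw [rpow_norm_Ex]
  rw [← Finset.prod_univ_sum (fun _ : P => Finset.range M)
    (fun p k => ((absNorm p.1 : ℝ) ^ (-s)) ^ k), ← Finset.prod_coe_sort P]
  refine Finset.prod_le_prod (fun _ _ => by positivity) fun p _ => ?_
  obtain ⟨h3, h4⟩ := xs_bound K (hP _ p.2) hs
  rw [← tsum_geometric_of_lt_one h3.le h4]
  exact (summable_geometric_of_lt_one h3.le h4).sum_le_tsum _ (fun _ _ => by positivity)

lemma euler_le (P : Finset (Ideal (𝓞 K))) (hP : ∀ p ∈ P, Prime p) (B : ℝ)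
    (s : ℝ) (hs : 0 < s)
    (hB : ∀ S : Finset (Ideal (𝓞 K)), (∀ a ∈ S, a ≠ ⊥) → ∑ a ∈ S, (absNorm a : ℝ) ^ (-s) ≤ B) :
    ∏ p ∈ P, (1 - (absNorm p : ℝ) ^ (-s))⁻¹ ≤ B := by
  classical
  have h1 : ∀ M : ℕ, ∏ p ∈ P, ∑ k ∈ Finset.range M, ((absNorm p : ℝ) ^ (-s)) ^ k ≤ B := by
    intro M
    rw [← Finset.prod_coe_sort P, Finset.prod_univ_sum (fun _ : P => Finset.range M)
      (fun p k => ((absNorm p.1 : ℝ) ^ (-s)) ^ k)]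
    simp_rw [← rpow_norm_Ex]
    rw [← Finset.sum_image (f := fun a : Ideal (𝓞 K) => (absNorm a : ℝ) ^ (-s)) (g := Ex K P)
      (fun _ _ _ _ h => Ex_inj K P hP h)]
    apply hB
    intro a ha
    obtain ⟨g, -, rfl⟩ := Finset.mem_image.1 ha
    rw [Ex]
    exact Finset.prod_ne_zero_iff.2 fun p _ => pow_ne_zero _ (hP _ p.2).ne_zero
  refine le_of_tendsto' (x := atTop) (tendsto_finsetProd P fun p hp => ?_) h1
  obtain ⟨h3, h4⟩ := xs_bound K (hP _ hp) hs
  exact (hasSum_geometric_of_lt_one h3.le h4).tendsto_sum_nat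

open Classical in
lemma log_norm_eq (P : Finset (Ideal (𝓞 K))) (hP : ∀ p ∈ P, Prime p) (a : Ideal (𝓞 K)) (ha : a ≠ ⊥)
    (hf : ∀ p ∈ normalizedFactors a, p ∈ P) (M : ℕ) (hM : (normalizedFactors a).card ≤ M) :
    Real.log (absNorm a) = ∑ p ∈ P, ∑ k ∈ Finset.Icc 1 M,
      (if p ^ k ∣ a then Real.log (absNorm p) else 0) := by
  classical
  conv_lhs => rw [← Ex_count K P a ha hf, norm_Ex]
  rw [Finset.prod_coe_sort P (fun p => (absNorm p : ℝ) ^ (normalizedFactors a).count p),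
    Real.log_prod]
  · refine Finset.sum_congr rfl fun p hp => ?_
    rw [Real.log_pow, ← Finset.sum_filter, Finset.sum_const, nsmul_eq_mul]
    congr 2
    have : (Finset.Icc 1 M).filter (fun k => p ^ k ∣ a) =
        Finset.Icc 1 ((normalizedFactors a).count p) := by
      ext k
      have hc := Multiset.count_le_card p (normalizedFactors a)
      have h1 : p ^ k ∣ a ↔ k ≤ (normalizedFactors a).count p := by
        rw [pow_dvd_iff_le_emultiplicity,
          emultiplicity_eq_count_normalizedFactors (hP p hp).irreducible ha]
        simp
      rw [Finset.mem_filter, Finset.mem_Icc, Finset.mem_Icc, h1]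
      omega
    rw [this]; simp
  · intro p hp
    have := two_le_norm K (hP p hp)
    positivity

lemma count_pow_le (N : ℝ) (hN : 2 ≤ N) (z : ℝ) (hz : 1 ≤ z) (M : ℕ) :
    ∑ k ∈ Finset.Icc 1 M, (if N ^ k ≤ z then Real.log N else 0) ≤
      if N ≤ z then Real.log z else 0 := by
  classical
  have hN0 : 0 < Real.log N := Real.log_pos (by linarith)
  split_ifs with h
  · rw [← Finset.sum_filter, Finset.sum_const, nsmul_eq_mul]
    have hsub : (Finset.Icc 1 M).filter (fun k => N ^ k ≤ z) ⊆
        Finset.Icc 1 ⌊Real.log z / Real.log N⌋₊ := by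
      intro k hk
      rw [Finset.mem_filter, Finset.mem_Icc] at hk
      rw [Finset.mem_Icc]
      refine ⟨hk.1.1, Nat.le_floor ?_⟩
      rw [le_div_iff₀ hN0, ← Real.log_pow]
      exact Real.log_le_log (by positivity) hk.2
    have h1 := Finset.card_le_card hsub
    rw [Nat.card_Icc, Nat.add_sub_cancel] at h1
    have h2 : (⌊Real.log z / Real.log N⌋₊ : ℝ) ≤ Real.log z / Real.log N :=
      Nat.floor_le (div_nonneg (Real.log_nonneg hz) hN0.le)
    have h3 : (((Finset.Icc 1 M).filter (fun k => N ^ k ≤ z)).card : ℝ) ≤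
      Real.log z / Real.log N := le_trans (by exact_mod_cast h1) h2
    rwa [le_div_iff₀ hN0] at h3
  · refine (Finset.sum_eq_zero fun k hk => ?_).le
    rw [if_neg]
    intro h'
    apply h
    rw [Finset.mem_Icc] at hk
    exact (le_self_pow₀ (by linarith) (by omega)).trans h'

lemma sum_log_le (X Y : ℝ) :
    ∑ a ∈ SF K X Y, Real.log (absNorm a) ≤
      ∑ b ∈ SF K X Y, ∑ p ∈ PF K Y,
        (if (absNorm p : ℝ) ≤ X / absNorm b then Real.log (X / absNorm b) else 0) := by
  classical
  set M := ∑ a ∈ SF K X Y, (normalizedFactors a).card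
  have e1 : ∑ a ∈ SF K X Y, Real.log (absNorm a) =
      ∑ a ∈ SF K X Y, ∑ p ∈ PF K Y, ∑ k ∈ Finset.Icc 1 M,
        (if p ^ k ∣ a then Real.log (absNorm p) else 0) := by
    refine Finset.sum_congr rfl fun a ha => ?_
    refine log_norm_eq K _ (fun p hp => PF_prime K hp) a ((mem_SF K).1 ha).1
      (fun p hp => mem_factors_SF K ha hp) M ?_
    exact Finset.single_le_sum (f := fun a => (normalizedFactors a).card)
        (fun _ _ => Nat.zero_le _) ha
  have e2 : ∑ a ∈ SF K X Y, ∑ p ∈ PF K Y, ∑ k ∈ Finset.Icc 1 M,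
        (if p ^ k ∣ a then Real.log (absNorm p) else 0) =
      ∑ p ∈ PF K Y, ∑ k ∈ Finset.Icc 1 M, ∑ a ∈ SF K X Y,
        (if p ^ k ∣ a then Real.log (absNorm p) else 0) := by
    rw [Finset.sum_comm]
    exact Finset.sum_congr rfl fun p _ => Finset.sum_comm
  have e3 : ∑ b ∈ SF K X Y, ∑ p ∈ PF K Y, ∑ k ∈ Finset.Icc 1 M,
        (if (absNorm p : ℝ) ^ k ≤ X / absNorm b then Real.log (absNorm p) else 0) =
      ∑ p ∈ PF K Y, ∑ k ∈ Finset.Icc 1 M, ∑ b ∈ SF K X Y,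
        (if (absNorm p : ℝ) ^ k ≤ X / absNorm b then Real.log (absNorm p) else 0) := by
    rw [Finset.sum_comm]
    exact Finset.sum_congr rfl fun p _ => Finset.sum_comm
  rw [e1, e2]
  refine le_trans (b := ∑ b ∈ SF K X Y, ∑ p ∈ PF K Y, ∑ k ∈ Finset.Icc 1 M,
        (if (absNorm p : ℝ) ^ k ≤ X / absNorm b then Real.log (absNorm p) else 0)) ?_ ?_
  · rw [e3]
    refine Finset.sum_le_sum fun p hp => Finset.sum_le_sum fun k _ => ?_
    have hpp := PF_prime K hp
    have h2 := two_le_norm K hpp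
    rw [← Finset.sum_filter, ← Finset.sum_filter, Finset.sum_const, Finset.sum_const,
      nsmul_eq_mul, nsmul_eq_mul]
    refine mul_le_mul_of_nonneg_right ?_ (Real.log_nonneg (by linarith))
    have hsub : (SF K X Y).filter (fun a => p ^ k ∣ a) ⊆
        ((SF K X Y).filter (fun b => (absNorm p : ℝ) ^ k ≤ X / absNorm b)).image
          (fun b => p ^ k * b) := by
      intro a ha
      rw [Finset.mem_filter] at ha
      obtain ⟨haS, b, rfl⟩ := ha
      rw [Finset.mem_image]
      refine ⟨b, ?_, rfl⟩
      obtain ⟨h3, h4, h5⟩ := (mem_SF K).1 haS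
      have hb : b ≠ ⊥ := by
        rintro rfl; exact h3 (by simp)
      have hb1 := one_le_norm K hb
      have hn : (absNorm (p ^ k * b) : ℝ) = (absNorm p : ℝ) ^ k * absNorm b := by simp
      rw [hn] at h4
      have hp1 : (1 : ℝ) ≤ (absNorm p : ℝ) ^ k := one_le_pow₀ (by linarith)
      rw [Finset.mem_filter, mem_SF]
      refine ⟨⟨hb, ?_, fun q hq hbq => h5 q hq (le_trans Ideal.mul_le_right hbq)⟩, ?_⟩
      · nlinarith
      · rw [le_div_iff₀ (by linarith)]; exact h4
    exact_mod_cast (Finset.card_le_card hsub).trans Finset.card_image_le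
  · refine Finset.sum_le_sum fun b hb => Finset.sum_le_sum fun p hp => ?_
    obtain ⟨h3, h4, h5⟩ := (mem_SF K).1 hb
    have hb1 := one_le_norm K h3
    exact count_pow_le _ (two_le_norm K (PF_prime K hp)) _
      (by rw [le_div_iff₀ (by linarith)]; linarith) M

lemma fiber_card (q : ℕ) (hq : 2 ≤ q) (F : Finset (Ideal (𝓞 K)))
    (hF : ∀ p ∈ F, Prime p ∧ absNorm (under ℤ p) = q) : F.card ≤ Module.finrank ℤ (𝓞 K) := by
  have h1 : ∏ p ∈ F, p ∣ Ideal.span {(q : 𝓞 K)} := by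
    refine Finset.prod_primes_dvd _ (fun p hp => (hF p hp).1) fun p hp => ?_
    rw [Ideal.dvd_span_singleton, ← (hF p hp).2]
    have := Int.absNorm_under_mem p
    exact_mod_cast this
  have h2 := map_dvd (absNorm (S := 𝓞 K)) h1
  rw [map_prod, Ideal.absNorm_span_singleton] at h2
  have h3 : (Algebra.norm ℤ (q : 𝓞 K)).natAbs = q ^ Module.finrank ℤ (𝓞 K) := by
    have := Algebra.norm_algebraMap_of_basis (RingOfIntegers.basis K) (q : ℤ)
    rw [← Module.finrank_eq_card_basis (RingOfIntegers.basis K)] at this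
    simp only [map_natCast] at this
    rw [this]
    simp [Int.natAbs_pow]
  rw [h3] at h2
  have h4 := Nat.le_of_dvd (by positivity) h2
  have h5 : q ^ F.card ≤ ∏ p ∈ F, absNorm p := by
    rw [← Finset.prod_const]
    refine Finset.prod_le_prod' fun p hp => ?_
    rw [← (hF p hp).2]
    refine Nat.le_of_dvd ?_ (Int.absNorm_under_dvd_absNorm p)
    have := two_le_norm K (hF p hp).1
    have : 2 ≤ absNorm p := by exact_mod_cast this
    omega
  exact (Nat.pow_le_pow_iff_right (by omega)).1 (h5.trans h4)

lemma card_PF_le (z : ℝ) :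
    (PF K z).card ≤ Module.finrank ℤ (𝓞 K) * Nat.primeCounting ⌊z⌋₊ := by
  classical
  have h : ∀ p ∈ PF K z, absNorm (under ℤ p) ∈ Nat.primesLE ⌊z⌋₊ := by
    intro p hp
    obtain ⟨h1, h2, h3⟩ := (mem_PF K).1 hp
    have := h1
    have : NeZero p := ⟨h2⟩
    rw [Nat.mem_primesLE]
    refine ⟨Nat.le_floor ?_, Nat.absNorm_under_prime p⟩
    refine le_trans ?_ h3
    have h5 := two_le_norm K (PF_prime K hp)
    have h5 : 2 ≤ absNorm p := by exact_mod_cast h5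
    exact_mod_cast Nat.le_of_dvd (by omega) (Int.absNorm_under_dvd_absNorm p)
  have h2 := Finset.card_le_mul_card_image_of_maps_to (s := PF K z) h (Module.finrank ℤ (𝓞 K)) ?_
  · rwa [Nat.primesLE_card_eq_primeCounting] at h2
  · intro q hq
    rw [Nat.mem_primesLE] at hq
    refine fiber_card K q hq.2.two_le _ fun p hp => ?_
    rw [Finset.mem_filter] at hp
    exact ⟨PF_prime K hp.1, hp.2⟩

lemma chebyshev : ∃ C : ℝ, 1 ≤ C ∧ ∀ z : ℝ, 1 ≤ z → ((PF K z).card : ℝ) * Real.log z ≤ C * z := by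
  refine ⟨(Module.finrank ℤ (𝓞 K) : ℝ) * (2 * Real.log 4 + 2) + 1, ?_, fun z hz => ?_⟩
  · have : 0 ≤ Real.log 4 := Real.log_nonneg (by norm_num)
    have : 0 ≤ (Module.finrank ℤ (𝓞 K) : ℝ) * (2 * Real.log 4 + 2) := by positivity
    linarith
  · rcases hz.eq_or_lt with rfl | hz1
    · have : 0 ≤ Real.log 4 := Real.log_nonneg (by norm_num)
      simp only [Real.log_one]
      have : 0 ≤ (Module.finrank ℤ (𝓞 K) : ℝ) * (2 * Real.log 4 + 2) := by positivity
      linarith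
    have h1 := Chebyshev.pi_le_log4_mul_div hz1
    have hl : 0 < Real.log z := Real.log_pos hz1
    rw [Real.log_sqrt (by linarith)] at h1
    have h2 : (Nat.primeCounting ⌊z⌋₊ : ℝ) * Real.log z ≤ (2 * Real.log 4 + 2) * z := by
      have h3 : Real.log z ≤ 2 * √z := by
        have h4 := Real.log_le_sub_one_of_pos (x := √z) (by positivity)
        rw [Real.log_sqrt (by linarith)] at h4
        linarith
      have h5 : √z * √z = z := Real.mul_self_sqrt (by linarith)
      calc (Nat.primeCounting ⌊z⌋₊ : ℝ) * Real.log z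
          ≤ (Real.log 4 * z / (Real.log z / 2) + √z) * Real.log z :=
            mul_le_mul_of_nonneg_right h1 hl.le
        _ = 2 * Real.log 4 * z + √z * Real.log z := by field_simp
        _ ≤ 2 * Real.log 4 * z + √z * (2 * √z) := by gcongr
        _ = _ := by linear_combination 2 * h5
    have h6 : ((PF K z).card : ℝ) ≤ Module.finrank ℤ (𝓞 K) * Nat.primeCounting ⌊z⌋₊ := by
      exact_mod_cast card_PF_le K z
    calc ((PF K z).card : ℝ) * Real.log z
        ≤ (Module.finrank ℤ (𝓞 K) * Nat.primeCounting ⌊z⌋₊) * Real.log z := by gcongr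
      _ = Module.finrank ℤ (𝓞 K) * (Nat.primeCounting ⌊z⌋₊ * Real.log z) := by ring
      _ ≤ Module.finrank ℤ (𝓞 K) * ((2 * Real.log 4 + 2) * z) := by gcongr
      _ ≤ _ := by nlinarith

lemma sum_le_zeta (s : ℝ) (hne : dedekindZeta K s ≠ 0) (S : Finset (Ideal (𝓞 K)))
    (hS : ∀ a ∈ S, a ≠ ⊥) :
    ∑ a ∈ S, (absNorm a : ℝ) ^ (-s) ≤ ‖dedekindZeta K s‖ := by
  classical
  set f : ℕ → ℂ := fun n ↦ (Nat.card {I : Ideal (𝓞 K) // absNorm I = n} : ℂ) with hf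
  have hsum : Summable (LSeries.term f s) := by
    by_contra h
    exact hne (tsum_eq_zero_of_not_summable h)
  have hterm : ∀ n, LSeries.term f s n = ((‖LSeries.term f s n‖ : ℝ) : ℂ) := by
    intro n
    rcases Nat.eq_zero_or_pos n with rfl | hn
    · simp
    · rw [LSeries.norm_term_eq, LSeries.term_of_ne_zero hn.ne', if_neg hn.ne']
      simp only [hf, Complex.norm_natCast, Complex.ofReal_re]
      rw [Complex.ofReal_div, Complex.ofReal_cpow (by positivity)]
      simp
  have hz : dedekindZeta K s = ((∑' n, ‖LSeries.term f s n‖ : ℝ) : ℂ) := by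
    rw [Complex.ofReal_tsum]
    exact tsum_congr hterm
  rw [hz, Complex.norm_real, Real.norm_of_nonneg (tsum_nonneg fun _ => norm_nonneg _)]
  have h1 : ∑ a ∈ S, (absNorm a : ℝ) ^ (-s) ≤
      ∑ n ∈ S.image (fun a => absNorm a), ‖LSeries.term f s n‖ := by
    rw [← Finset.sum_fiberwise_of_maps_to (t := S.image (fun a => absNorm a))
      (g := fun a => absNorm a) (fun a ha => Finset.mem_image_of_mem _ ha)]
    refine Finset.sum_le_sum fun n hn => ?_
    obtain ⟨a, ha, rfl⟩ := Finset.mem_image.1 hn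
    have h2 : absNorm a ≠ 0 := by
      rw [Ne, Ideal.absNorm_eq_zero_iff]; exact hS a ha
    set n := absNorm a
    have h3 : ∑ i ∈ S with absNorm i = n, (absNorm i : ℝ) ^ (-s) =
        ((S.filter (fun i => absNorm i = n)).card : ℝ) * (n : ℝ) ^ (-s) := by
      rw [← nsmul_eq_mul, ← Finset.sum_const]
      refine Finset.sum_congr rfl fun i hi => ?_
      rw [(Finset.mem_filter.1 hi).2]
    rw [h3, LSeries.norm_term_eq, if_neg h2]
    simp only [hf, Complex.norm_natCast, Complex.ofReal_re]
    rw [div_eq_mul_inv, ← Real.rpow_neg (by positivity)]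
    refine mul_le_mul_of_nonneg_right ?_ (by positivity)
    have hfin : {I : Ideal (𝓞 K) | absNorm I = n}.Finite :=
      (finite_norm_le K n).subset fun I hI => by
        have : absNorm I = n := hI
        simp [this]
    have h5 : Nat.card {I : Ideal (𝓞 K) // absNorm I = n} = hfin.toFinset.card := by
      rw [← Set.ncard_eq_toFinset_card _ hfin, ← Nat.card_coe_set_eq]; rfl
    rw [h5]
    norm_cast
    refine Finset.card_le_card fun i hi => ?_
    simpa using (Finset.mem_filter.1 hi).2
  exact h1.trans (hsum.norm.sum_le_tsum _ (fun _ _ => norm_nonneg _))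

lemma zeta_bound : ∃ C L0 : ℝ, 0 < C ∧ ∀ L : ℝ, L0 ≤ L → ∀ S : Finset (Ideal (𝓞 K)),
    (∀ a ∈ S, a ≠ ⊥) → ∑ a ∈ S, (absNorm a : ℝ) ^ (-(1 + 1 / L)) ≤ C * L := by
  have h1 := NumberField.tendsto_sub_one_mul_dedekindZeta_nhdsGT K
  have hr := NumberField.dedekindZeta_residue_pos K
  have hL : Tendsto (fun L : ℝ => 1 + 1 / L) atTop (nhdsWithin 1 (Set.Ioi 1)) := by
    rw [tendsto_nhdsWithin_iff]
    constructor
    · have := (tendsto_const_nhds (x := (1:ℝ))).add (tendsto_inv_atTop_zero (𝕜 := ℝ))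
      simpa using this
    · filter_upwards [eventually_gt_atTop 0] with L hL
      simp [hL]
  have h2 := (h1.comp hL).norm
  have hn : ‖(NumberField.dedekindZeta_residue K : ℂ)‖ = NumberField.dedekindZeta_residue K := by
    rw [Complex.norm_real, Real.norm_of_nonneg hr.le]
  rw [hn] at h2
  have h3 := h2.eventually (lt_mem_nhds hr)
  have h4 := h2.eventually (gt_mem_nhds (lt_add_one _))
  obtain ⟨L0, hL0⟩ := (h3.and (h4.and (eventually_gt_atTop 0))).exists_forall_of_atTop
  refine ⟨NumberField.dedekindZeta_residue K + 1, L0, by linarith, fun L hL S hS => ?_⟩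
  obtain ⟨g1, g2, g3⟩ := hL0 L hL
  simp only [Function.comp] at g1 g2
  have hne : dedekindZeta K ((1 + 1 / L : ℝ) : ℂ) ≠ 0 := by
    intro h
    rw [h] at g1
    simp at g1
  refine (sum_le_zeta K _ hne S hS).trans ?_
  rw [norm_mul] at g2
  have h5 : ‖(((1 + 1 / L : ℝ) : ℂ) - 1)‖ = 1 / L := by
    have : (((1 + 1 / L : ℝ) : ℂ) - 1) = ((1 / L : ℝ) : ℂ) := by push_cast; ring
    rw [this, Complex.norm_real, Real.norm_of_nonneg (by positivity)]
  rw [h5, one_div_mul_eq_div, div_lt_iff₀ g3] at g2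
  linarith

lemma psi_trivial : ∃ C : ℝ, 0 < C ∧ ∀ X Y : ℝ, 2 ≤ X → (Psi K X Y : ℝ) ≤ C * X := by
  have h := NumberField.Ideal.tendsto_norm_le_div_atTop K
  set r := ((2 ^ InfinitePlace.nrRealPlaces K * (2 * Real.pi) ^ InfinitePlace.nrComplexPlaces K *
    Units.regulator K * classNumber K) / (Units.torsionOrder K * Real.sqrt |(discr K : ℝ)|))
  have h1 := h.eventually (gt_mem_nhds (lt_add_one _))
  obtain ⟨X0, hX0⟩ := (h1.and (eventually_ge_atTop 2)).exists_forall_of_atTop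
  have hle : ∀ X Y Z : ℝ, X ≤ Z → Psi K X Y ≤ Nat.card {I : Ideal (𝓞 K) // (absNorm I : ℝ) ≤ Z} := by
    intro X Y Z hXZ
    have : Finite {I : Ideal (𝓞 K) // (absNorm I : ℝ) ≤ Z} := finite_norm_le K Z
    refine Nat.card_le_card_of_injective (fun a => ⟨a.1, a.2.2.1.trans hXZ⟩) ?_
    intro a b hab
    simp only [Subtype.mk.injEq] at hab
    exact Subtype.ext hab
  set D := (Nat.card {I : Ideal (𝓞 K) // (absNorm I : ℝ) ≤ X0} : ℝ) with hD
  refine ⟨max (r + 1) 0 + D + 1, by positivity, fun X Y hX => ?_⟩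
  have hD0 : 0 ≤ D := by positivity
  have hm := le_max_left (r + 1) 0
  have hm0 := le_max_right (r + 1) 0
  rcases le_total X X0 with h2 | h2
  · have : (Psi K X Y : ℝ) ≤ D := by rw [hD]; exact_mod_cast hle X Y X0 h2
    nlinarith
  · obtain ⟨g1, -⟩ := hX0 X h2
    rw [div_lt_iff₀ (by linarith)] at g1
    have : (Psi K X Y : ℝ) ≤ Nat.card {I : Ideal (𝓞 K) // (absNorm I : ℝ) ≤ X} := by
      exact_mod_cast hle X Y X le_rfl
    nlinarith

lemma mertens_dyadic (C : ℝ)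
    (hC : ∀ z : ℝ, 1 ≤ z → ((PF K z).card : ℝ) * Real.log z ≤ C * z) (a : ℝ) (ha : 1 ≤ a) (n : ℕ) :
    ∑ p ∈ PF K (a * 2 ^ n) with a < absNorm p, Real.log (absNorm p) / absNorm p ≤ 2 * C * n := by
  classical
  induction n with
  | zero =>
    refine (Finset.sum_eq_zero fun p hp => ?_).le.trans (by simp)
    rw [Finset.mem_filter, mem_PF] at hp
    have := hp.1.2.2
    simp only [pow_zero, mul_one] at this
    linarith [hp.2]
  | succ n ih =>
    have h2 : (1:ℝ) ≤ 2 ^ n := one_le_pow₀ (by norm_num)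
    have hsub : (PF K (a * 2 ^ (n + 1))).filter (fun p => a < absNorm p) ⊆
        (PF K (a * 2 ^ n)).filter (fun p => a < absNorm p) ∪
        (PF K (a * 2 ^ (n + 1))).filter (fun p => a * 2 ^ n < absNorm p) := by
      intro p hp
      rw [Finset.mem_filter, mem_PF] at hp
      rw [Finset.mem_union, Finset.mem_filter, Finset.mem_filter, mem_PF, mem_PF]
      rcases le_or_gt (absNorm p : ℝ) (a * 2 ^ n) with h | h
      · exact Or.inl ⟨⟨hp.1.1, hp.1.2.1, h⟩, hp.2⟩
      · exact Or.inr ⟨hp.1, h⟩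
    have hnn : ∀ p : Ideal (𝓞 K), 0 ≤ Real.log (absNorm p) / absNorm p := fun p =>
      div_nonneg (Real.log_natCast_nonneg _) (by positivity)
    refine (Finset.sum_le_sum_of_subset_of_nonneg hsub (fun p _ _ => hnn p)).trans ?_
    refine (le_add_of_nonneg_right (Finset.sum_nonneg fun p _ => hnn p)).trans
      (Finset.sum_union_inter).le |>.trans ?_
    push_cast
    rw [mul_add, mul_one]
    refine add_le_add ih ?_
    set z := a * 2 ^ (n + 1) with hz
    have hz1 : 1 ≤ z := by rw [hz, pow_succ]; nlinarith
    have hzz : z = 2 * (a * 2 ^ n) := by rw [hz, pow_succ]; ring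
    have hp0 : 0 < a * 2 ^ n := by positivity
    have hb : ∀ p ∈ (PF K z).filter (fun p => a * 2 ^ n < absNorm p),
        Real.log (absNorm p) / absNorm p ≤ Real.log z / (a * 2 ^ n) := by
      intro p hp
      rw [Finset.mem_filter, mem_PF] at hp
      have := hp.1.2.2
      refine div_le_div₀ (Real.log_nonneg hz1) (Real.log_le_log (by linarith [hp.2]) this)
        hp0 hp.2.le
    refine (Finset.sum_le_card_nsmul _ _ _ hb).trans ?_
    rw [nsmul_eq_mul]
    have hcard : (((PF K z).filter (fun p => a * 2 ^ n < absNorm p)).card : ℝ) ≤ (PF K z).card := by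
      exact_mod_cast Finset.card_filter_le _ _
    have := hC z hz1
    calc _ ≤ ((PF K z).card : ℝ) * (Real.log z / (a * 2 ^ n)) := by
          have := Real.log_nonneg hz1
          gcongr
      _ = ((PF K z).card : ℝ) * Real.log z / (a * 2 ^ n) := by ring
      _ ≤ C * z / (a * 2 ^ n) := by gcongr
      _ = 2 * C := by rw [hzz]; field_simp

lemma mertens : ∃ C : ℝ, 1 ≤ C ∧ ∀ a b : ℝ, 1 ≤ a → a ≤ b →
    ∑ p ∈ PF K b with a < absNorm p, Real.log (absNorm p) / absNorm p ≤
      C * (Real.log b - Real.log a + 1) := by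
  classical
  obtain ⟨C, hC1, hC⟩ := chebyshev K
  refine ⟨4 * C, by linarith, fun a b ha hab => ?_⟩
  have ha0 : 0 < a := by linarith
  have hb0 : 0 < b := by linarith
  set t := Real.log b - Real.log a with ht
  have ht0 : 0 ≤ t := sub_nonneg.2 (Real.log_le_log ha0 hab)
  have hl2 : 1 / 2 < Real.log 2 := by linarith [Real.log_two_gt_d9]
  set n := ⌈t / Real.log 2⌉₊
  have hn1 : t / Real.log 2 ≤ n := Nat.le_ceil _
  have hn2 : (n : ℝ) < t / Real.log 2 + 1 := Nat.ceil_lt_add_one (by positivity)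
  have hn3 : t / Real.log 2 ≤ 2 * t := by
    rw [div_le_iff₀ (by linarith)]; nlinarith
  have hb : b ≤ a * 2 ^ n := by
    rw [← Real.log_le_log_iff hb0 (by positivity), Real.log_mul (by positivity) (by positivity),
      Real.log_pow]
    rw [div_le_iff₀ (by linarith)] at hn1
    linarith
  refine le_trans ?_ ((mertens_dyadic K C hC a ha n).trans ?_)
  · refine Finset.sum_le_sum_of_subset_of_nonneg ?_ (fun p _ _ =>
      div_nonneg (Real.log_natCast_nonneg _) (by positivity))
    intro p hp
    rw [Finset.mem_filter, mem_PF] at hp ⊢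
    exact ⟨⟨hp.1.1, hp.1.2.1, hp.1.2.2.trans hb⟩, hp.2⟩
  · nlinarith

lemma psi_point (C : ℝ) (hC0 : 1 ≤ C)
    (hC : ∀ z : ℝ, 1 ≤ z → ((PF K z).card : ℝ) * Real.log z ≤ C * z)
    (Y δ z : ℝ) (hY : 0 < Y) (hL : 2 ≤ Real.log Y) (hδ0 : 0 ≤ δ) (hδ : δ ≤ 1 / 2) (hz : 1 ≤ z) :
    ∑ p ∈ PF K Y, (if (absNorm p : ℝ) ≤ z then Real.log z else 0) ≤ C * (Y ^ δ * z ^ (1 - δ)) := by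
  classical
  have hlz := Real.log_nonneg hz
  have hz0 : 0 < z := by linarith
  rw [← Finset.sum_filter, Finset.sum_const, nsmul_eq_mul]
  rcases le_total z Y with h | h
  · have h1 : (((PF K Y).filter (fun p => (absNorm p : ℝ) ≤ z)).card : ℝ) ≤ (PF K z).card := by
      norm_cast
      refine Finset.card_le_card fun p hp => ?_
      rw [Finset.mem_filter, mem_PF] at hp
      rw [mem_PF]
      exact ⟨hp.1.1, hp.1.2.1, hp.2⟩
    have h2 : z ≤ Y ^ δ * z ^ (1 - δ) := by
      calc z = z ^ δ * z ^ (1 - δ) := by rw [← Real.rpow_add hz0]; simp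
        _ ≤ _ := by gcongr
    calc _ ≤ ((PF K z).card : ℝ) * Real.log z := by gcongr
      _ ≤ C * z := hC z hz
      _ ≤ _ := by gcongr
  · have h1 : (((PF K Y).filter (fun p => (absNorm p : ℝ) ≤ z)).card : ℝ) ≤ (PF K Y).card := by
      exact_mod_cast Finset.card_filter_le _ _
    have hY1 : 1 ≤ Y := by
      by_contra hlt
      have := Real.log_nonpos hY.le (by linarith)
      linarith
    have h2 := hC Y hY1
    set L := Real.log Y
    have h3 : Real.log z / L ≤ (z / Y) ^ (1 - δ) := by
      rw [Real.rpow_def_of_pos (by positivity), Real.log_div hz0.ne' hY.ne']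
      refine le_trans ?_ (Real.add_one_le_exp _)
      rw [div_le_iff₀ (by linarith)]
      have h4 : L ≤ Real.log z := Real.log_le_log hY h
      change Real.log z ≤ ((Real.log z - L) * (1 - δ) + 1) * L
      have h5 : 1 ≤ (1 - δ) * L := by nlinarith
      nlinarith
    have h4 : Y * (z / Y) ^ (1 - δ) = Y ^ δ * z ^ (1 - δ) := by
      rw [Real.div_rpow hz0.le hY.le, mul_div_assoc', div_eq_iff (by positivity)]
      have : Y = Y ^ δ * Y ^ (1 - δ) := by rw [← Real.rpow_add hY]; simp
      calc Y * z ^ (1 - δ) = (Y ^ δ * Y ^ (1 - δ)) * z ^ (1 - δ) := by rw [← this]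
        _ = _ := by ring
    calc _ ≤ ((PF K Y).card : ℝ) * Real.log z := by gcongr
      _ = ((PF K Y).card : ℝ) * L * (Real.log z / L) := by field_simp
      _ ≤ C * Y * (Real.log z / L) := by
        have : 0 ≤ Real.log z / L := by positivity
        gcongr
      _ ≤ C * Y * (z / Y) ^ (1 - δ) := by gcongr
      _ = C * (Y * (z / Y) ^ (1 - δ)) := by ring
      _ = _ := by rw [h4]

lemma psi_log_le : ∃ C : ℝ, 0 < C ∧ ∀ X Y δ : ℝ, 2 ≤ X → 0 < Y → 2 ≤ Real.log Y → 0 ≤ δ → δ ≤ 1 / 2 →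
    (Psi K X Y : ℝ) * Real.log X ≤
      C * X ^ (1 - δ) * Y ^ δ * ∏ p ∈ PF K Y, (1 - (absNorm p : ℝ) ^ (-(1 - δ)))⁻¹ := by
  classical
  obtain ⟨C, hC1, hC⟩ := chebyshev K
  refine ⟨C + 2, by linarith, fun X Y δ hX hY hL hδ0 hδ => ?_⟩
  have hX0 : 0 < X := by linarith
  have hY1 : 1 ≤ Y := by
    by_contra hlt
    have := Real.log_nonpos hY.le (by linarith)
    linarith
  have hYd : 1 ≤ Y ^ δ := Real.one_le_rpow hY1 hδ0
  have e1 : (Psi K X Y : ℝ) * Real.log X =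
      ∑ a ∈ SF K X Y, Real.log (absNorm a) + ∑ a ∈ SF K X Y, Real.log (X / absNorm a) := by
    rw [Psi_eq, ← nsmul_eq_mul, ← Finset.sum_const, ← Finset.sum_add_distrib]
    refine Finset.sum_congr rfl fun a ha => ?_
    have := one_le_norm K ((mem_SF K).1 ha).1
    rw [Real.log_div hX0.ne' (by positivity)]; ring
  have hz : ∀ a ∈ SF K X Y, 1 ≤ X / absNorm a := by
    intro a ha
    have h1 := one_le_norm K ((mem_SF K).1 ha).1
    rw [le_div_iff₀ (by linarith)]
    linarith [((mem_SF K).1 ha).2.1]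
  have e2 : ∑ a ∈ SF K X Y, Real.log (absNorm a) ≤
      ∑ a ∈ SF K X Y, C * (Y ^ δ * (X / absNorm a) ^ (1 - δ)) :=
    (sum_log_le K X Y).trans <| Finset.sum_le_sum fun a ha =>
      psi_point K C hC1 hC Y δ _ hY hL hδ0 hδ (hz a ha)
  have e3 : ∑ a ∈ SF K X Y, Real.log (X / absNorm a) ≤
      ∑ a ∈ SF K X Y, 2 * (Y ^ δ * (X / absNorm a) ^ (1 - δ)) := by
    refine Finset.sum_le_sum fun a ha => ?_
    have h1 := hz a ha
    have h2 := Real.log_le_rpow_div (x := X / absNorm a) (by linarith) (show 0 < 1 - δ by linarith)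
    have h3 : 0 ≤ (X / absNorm a) ^ (1 - δ) := by positivity
    have h4 : (X / absNorm a) ^ (1 - δ) / (1 - δ) ≤ 2 * (X / absNorm a) ^ (1 - δ) := by
      rw [div_le_iff₀ (by linarith)]; nlinarith
    nlinarith
  have e4 := sum_le_euler K (PF K Y) (fun p hp => PF_prime K hp) (SF K X Y)
    (fun a ha => ⟨((mem_SF K).1 ha).1, fun p hp => mem_factors_SF K ha hp⟩) (1 - δ) (by linarith)
  rw [e1]
  calc _ ≤ ∑ a ∈ SF K X Y, C * (Y ^ δ * (X / absNorm a) ^ (1 - δ)) +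
        ∑ a ∈ SF K X Y, 2 * (Y ^ δ * (X / absNorm a) ^ (1 - δ)) := add_le_add e2 e3
    _ = (C + 2) * X ^ (1 - δ) * Y ^ δ * ∑ a ∈ SF K X Y, (absNorm a : ℝ) ^ (-(1 - δ)) := by
      rw [← Finset.sum_add_distrib, Finset.mul_sum]
      refine Finset.sum_congr rfl fun a ha => ?_
      rw [Real.div_rpow hX0.le (by positivity), Real.rpow_neg (by positivity)]
      ring
    _ ≤ _ := by gcongr

lemma factor_le (x y : ℝ) (hy : 0 < y) (hyx : y ≤ x) (hx : x ≤ 3 / 4) :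
    (1 - x)⁻¹ ≤ (1 - y)⁻¹ * Real.exp ((x - y) + 4 * x ^ 2) := by
  have h1 : 0 < 1 - x := by linarith
  have h2 : 0 < 1 - y := by linarith
  have h3 : (1 - x)⁻¹ = (1 - y)⁻¹ * ((x - y) / (1 - x) + 1) := by field_simp; ring
  rw [h3]
  have h4 : (x - y) / (1 - x) ≤ (x - y) + 4 * x ^ 2 := by
    rw [div_le_iff₀ h1]
    nlinarith [mul_nonneg hy.le (by linarith : (0:ℝ) ≤ x), mul_nonneg (sq_nonneg x) (by linarith : 0 ≤ 3/4 - x)]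
  have h5 := Real.add_one_le_exp ((x - y) / (1 - x))
  have h6 := Real.exp_le_exp.2 h4
  gcongr
  linarith

lemma euler_compare : ∃ C L0 : ℝ, 0 < C ∧ 2 ≤ L0 ∧ ∀ Y δ : ℝ, 0 < Y → L0 ≤ Real.log Y → 0 ≤ δ →
    δ ≤ 1 / 4 →
    ∏ p ∈ PF K Y, (1 - (absNorm p : ℝ) ^ (-(1 - δ)))⁻¹ ≤ C * Real.log Y *
      Real.exp (∑ p ∈ PF K Y, ((absNorm p : ℝ) ^ (-(1 - δ)) -
        (absNorm p : ℝ) ^ (-(1 + 1 / Real.log Y)))) := by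
  classical
  obtain ⟨C, L0, hC, hz⟩ := zeta_bound K
  set M := max L0 2 with hM
  have hM2 : 2 ≤ M := le_max_right _ _
  refine ⟨C * Real.exp (4 * (C * M)), M, by positivity, hM2, fun Y δ hY hL hδ0 hδ => ?_⟩
  set L := Real.log Y
  have hL0 : 0 < L := by linarith
  have h1 : ∀ p ∈ PF K Y, (1 - (absNorm p : ℝ) ^ (-(1 - δ)))⁻¹ ≤
      (1 - (absNorm p : ℝ) ^ (-(1 + 1 / L)))⁻¹ * Real.exp (((absNorm p : ℝ) ^ (-(1 - δ)) -
        (absNorm p : ℝ) ^ (-(1 + 1 / L))) + 4 * (absNorm p : ℝ) ^ (-(1 + 1 / M))) := by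
    intro p hp
    have h2 := two_le_norm K (PF_prime K hp)
    have hx : (absNorm p : ℝ) ^ (-(1 - δ)) ≤ 3 / 4 := by
      calc (absNorm p : ℝ) ^ (-(1 - δ)) ≤ (absNorm p : ℝ) ^ (-(1 / 2) : ℝ) :=
            Real.rpow_le_rpow_of_exponent_le (by linarith) (by linarith)
        _ ≤ (2 : ℝ) ^ (-(1 / 2) : ℝ) :=
            Real.rpow_le_rpow_of_nonpos (by norm_num) h2 (by norm_num)
        _ ≤ 3 / 4 := by
          rw [Real.rpow_neg (by norm_num), ← Real.sqrt_eq_rpow]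
          rw [inv_le_comm₀ (by positivity) (by norm_num)]
          exact Real.le_sqrt_of_sq_le (by norm_num)
    have hyx : (absNorm p : ℝ) ^ (-(1 + 1 / L)) ≤ (absNorm p : ℝ) ^ (-(1 - δ)) := by
      refine Real.rpow_le_rpow_of_exponent_le (by linarith) ?_
      have : 0 ≤ 1 / L := by positivity
      linarith
    refine (factor_le _ _ (Real.rpow_pos_of_pos (by linarith) _) hyx hx).trans ?_
    have hy1 := (xs_bound K (PF_prime K hp) (s := 1 + 1 / L) (by positivity)).2
    have hsq : ((absNorm p : ℝ) ^ (-(1 - δ))) ^ 2 ≤ (absNorm p : ℝ) ^ (-(1 + 1 / M)) := by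
      rw [← Real.rpow_mul_natCast (by positivity)]
      refine Real.rpow_le_rpow_of_exponent_le (by linarith) ?_
      have : 1 / M ≤ 1 / 2 := one_div_le_one_div_of_le (by norm_num) hM2
      push_cast
      linarith
    have : 0 ≤ (1 - (absNorm p : ℝ) ^ (-(1 + 1 / L)))⁻¹ := inv_nonneg.2 (by linarith)
    gcongr
  have h0 : ∀ p ∈ PF K Y, 0 ≤ (1 - (absNorm p : ℝ) ^ (-(1 - δ)))⁻¹ := fun p hp =>
    inv_nonneg.2 (by linarith [(xs_bound K (PF_prime K hp) (s := 1 - δ) (by linarith)).2])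
  refine (Finset.prod_le_prod h0 h1).trans ?_
  rw [Finset.prod_mul_distrib, ← Real.exp_sum, Finset.sum_add_distrib, Real.exp_add, ← Finset.mul_sum]
  have h3 := euler_le K (PF K Y) (fun p hp => PF_prime K hp) (C * L) (1 + 1 / L) (by positivity)
    (hz L ((le_max_left _ _).trans hL))
  have h4 := hz M (le_max_left _ _) (PF K Y) (fun p hp => (PF_prime K hp).ne_zero)
  calc _ ≤ (C * L) * (Real.exp (∑ p ∈ PF K Y, ((absNorm p : ℝ) ^ (-(1 - δ)) -
        (absNorm p : ℝ) ^ (-(1 + 1 / L)))) * Real.exp (4 * (C * M))) := by gcongr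
    _ = _ := by ring

/-- an elementary one-variable estimate -/
lemma beta_est (D η : ℝ) (hD : 0 < D) (hη : 0 < η) (hη1 : η < 1) : ∃ C : ℝ, 0 < C ∧ ∀ β : ℝ, 1 ≤ β →
    D * (β ^ (1 - η) * (Real.log β + 1)) ≤ β / 4 + C := by
  set D' := D * (2 / η + 1) with hD'
  have hD'0 : 0 < D' := by positivity
  set B := (4 * D') ^ (2 / η) with hB
  have hB0 : 0 < B := by positivity
  refine ⟨D' * B + D', by positivity, fun β hβ => ?_⟩
  have hβ0 : 0 < β := by linarith
  have h1 : Real.log β ≤ β ^ (η / 2) / (η / 2) := Real.log_le_rpow_div hβ0.le (by positivity)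
  have h2 : 1 ≤ β ^ (η / 2) := Real.one_le_rpow hβ (by positivity)
  have h3 : Real.log β + 1 ≤ (2 / η + 1) * β ^ (η / 2) := by
    have : β ^ (η / 2) / (η / 2) = 2 / η * β ^ (η / 2) := by field_simp
    rw [this] at h1
    linarith
  have h4 : D * (β ^ (1 - η) * (Real.log β + 1)) ≤ D' * β ^ (1 - η / 2) := by
    calc _ ≤ D * (β ^ (1 - η) * ((2 / η + 1) * β ^ (η / 2))) := by gcongr
      _ = D' * (β ^ (1 - η) * β ^ (η / 2)) := by rw [hD']; ring
      _ = _ := by rw [← Real.rpow_add hβ0]; congr 2; ring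
  refine h4.trans ?_
  have h5 : β ^ (1 - η / 2) * β ^ (η / 2) = β := by rw [← Real.rpow_add hβ0]; simp
  have h6 : 0 < β ^ (1 - η / 2) := by positivity
  rcases le_total (4 * D') (β ^ (η / 2)) with h | h
  · have : 4 * D' * β ^ (1 - η / 2) ≤ β := by nlinarith
    have : 0 < D' * B := by positivity
    linarith
  · have hb : β ≤ B := by
      calc β = (β ^ (η / 2)) ^ (2 / η) := by
            rw [← Real.rpow_mul hβ0.le]
            have : η / 2 * (2 / η) = 1 := by field_simp
            rw [this, Real.rpow_one]
        _ ≤ _ := by rw [hB]; gcongr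
    have h7 : β ^ (1 - η / 2) ≤ β := by nlinarith
    nlinarith

lemma exponent_est : ∃ C L0 : ℝ, 0 < C ∧ 2 ≤ L0 ∧ ∀ Y β : ℝ, 0 < Y → L0 ≤ Real.log Y → 1 ≤ β →
    ∑ p ∈ PF K Y, ((absNorm p : ℝ) ^ (-(1 - Real.log β / Real.log Y)) -
        (absNorm p : ℝ) ^ (-(1 + 1 / Real.log Y))) ≤ β / 2 + C := by
  classical
  obtain ⟨C1, hC1, hm⟩ := mertens K
  set η := 1 / (16 * C1) with hη
  have hη0 : 0 < η := by positivity
  have hη1 : η ≤ 1 / 2 := by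
    rw [hη]; exact one_div_le_one_div_of_le (by norm_num) (by linarith)
  have hηC : C1 * η = 1 / 16 := by rw [hη]; field_simp
  obtain ⟨C, hC, hb⟩ := beta_est (2 * C1) η (by positivity) hη0 (by linarith)
  refine ⟨C, max 2 (1 / η), hC, le_max_left _ _, fun Y β hY hL hβ => ?_⟩
  set L := Real.log Y with hLdef
  have hL2 : 2 ≤ L := (le_max_left _ _).trans hL
  have hLη : 1 ≤ η * L := by
    have := (le_max_right _ _).trans hL
    rwa [div_le_iff₀ hη0, mul_comm] at this
  have hL0 : 0 < L := by linarith
  have hβ0 : 0 < β := by linarith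
  have hlβ := Real.log_nonneg hβ
  set δ := Real.log β / L with hδ
  have hδ0 : 0 ≤ δ := by positivity
  have hδL : δ * L = Real.log β := by rw [hδ]; field_simp
  set a := Real.exp ((1 - η) * L) with ha
  have hla : Real.log a = (1 - η) * L := Real.log_exp _
  have ha1 : 1 ≤ a := Real.one_le_exp (by nlinarith)
  have haY : a ≤ Y := by
    rw [← Real.log_le_log_iff (by positivity) hY, hla]; nlinarith
  have hY1 : 1 ≤ Y := ha1.trans haY
  set f : Ideal (𝓞 K) → ℝ := fun p => (absNorm p : ℝ) ^ (-(1 - δ)) -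
        (absNorm p : ℝ) ^ (-(1 + 1 / L)) with hf
  set g : Ideal (𝓞 K) → ℝ := fun p => Real.log (absNorm p) / absNorm p with hg
  have hrw : ∀ p ∈ PF K Y, f p = (absNorm p : ℝ)⁻¹ * (absNorm p : ℝ) ^ δ *
      (1 - Real.exp (-((δ + 1 / L) * Real.log (absNorm p)))) := by
    intro p hp
    have h2 := two_le_norm K (PF_prime K hp)
    have hp0 : (0:ℝ) < absNorm p := by linarith
    simp only [hf]
    rw [← Real.rpow_neg_one, ← Real.rpow_add hp0, mul_sub, mul_one,
      show -((δ + 1 / L) * Real.log (absNorm p)) = Real.log (absNorm p) * (-(δ + 1 / L)) by ring,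
      ← Real.rpow_def_of_pos hp0, ← Real.rpow_add hp0]
    congr 2 <;> ring
  have hpow : ∀ p ∈ PF K Y, (absNorm p : ℝ) ^ δ = Real.exp (δ * Real.log (absNorm p)) := by
    intro p hp
    have h2 := two_le_norm K (PF_prime K hp)
    rw [Real.rpow_def_of_pos (by linarith), mul_comm]
  rw [← Finset.sum_filter_add_sum_filter_not (PF K Y) (fun p => (absNorm p : ℝ) ≤ a)]
  have part1 : ∑ p ∈ PF K Y with (absNorm p : ℝ) ≤ a, f p ≤ β / 4 + C := by
    have h1 : ∀ p ∈ (PF K Y).filter (fun p => (absNorm p : ℝ) ≤ a),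
        f p ≤ β ^ (1 - η) * ((Real.log β + 1) / L) * g p := by
      intro p hp
      rw [Finset.mem_filter] at hp
      have h2 := two_le_norm K (PF_prime K hp.1)
      have hlp : 0 ≤ Real.log (absNorm p) := Real.log_nonneg (by linarith)
      have h9 : 0 ≤ 1 - Real.exp (-((δ + 1 / L) * Real.log (absNorm p))) := by
        rw [sub_nonneg, Real.exp_le_one_iff, neg_nonpos]; positivity
      rw [hrw p hp.1, hpow p hp.1]
      have h3 : Real.exp (δ * Real.log (absNorm p)) ≤ β ^ (1 - η) := by
        rw [Real.rpow_def_of_pos hβ0, Real.exp_le_exp, ← hδL]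
        have : Real.log (absNorm p) ≤ (1 - η) * L := by
          rw [← hla]; exact Real.log_le_log (by linarith) hp.2
        nlinarith
      have h4 : 1 - Real.exp (-((δ + 1 / L) * Real.log (absNorm p))) ≤
          (Real.log β + 1) / L * Real.log (absNorm p) := by
        have h5 := Real.add_one_le_exp (-((δ + 1 / L) * Real.log (absNorm p)))
        have h6 : δ + 1 / L = (Real.log β + 1) / L := by rw [hδ]; ring
        rw [← h6]; linarith
      have h5 : 0 ≤ (Real.log β + 1) / L * Real.log (absNorm p) := by positivity
      calc _ ≤ (absNorm p : ℝ)⁻¹ * β ^ (1 - η) * ((Real.log β + 1) / L * Real.log (absNorm p)) := by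
            gcongr
        _ = _ := by simp only [hg]; ring
    refine (Finset.sum_le_sum h1).trans ?_
    rw [← Finset.mul_sum]
    have h2 : ∑ p ∈ PF K Y with (absNorm p : ℝ) ≤ a, g p ≤ C1 * (L + 1) := by
      have h3 := hm 1 Y le_rfl hY1
      rw [Real.log_one, sub_zero] at h3
      refine le_trans ?_ h3
      refine Finset.sum_le_sum_of_subset_of_nonneg ?_ (fun p _ _ =>
        div_nonneg (Real.log_natCast_nonneg _) (by positivity))
      intro p hp
      rw [Finset.mem_filter] at hp ⊢
      exact ⟨hp.1, by linarith [two_le_norm K (PF_prime K hp.1)]⟩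
    refine le_trans ?_ (hb β hβ)
    calc _ ≤ β ^ (1 - η) * ((Real.log β + 1) / L) * (C1 * (L + 1)) := by gcongr
      _ ≤ β ^ (1 - η) * ((Real.log β + 1) / L) * (C1 * (2 * L)) := by gcongr; linarith
      _ = _ := by field_simp
  have part2 : ∑ p ∈ PF K Y with ¬ (absNorm p : ℝ) ≤ a, f p ≤ β / 4 := by
    have h1 : ∀ p ∈ (PF K Y).filter (fun p => ¬ (absNorm p : ℝ) ≤ a),
        f p ≤ β * (2 / L) * g p := by
      intro p hp
      rw [Finset.mem_filter, not_le] at hp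
      have h2 := two_le_norm K (PF_prime K hp.1)
      have hlp : 0 ≤ Real.log (absNorm p) := Real.log_nonneg (by linarith)
      have h9 : 0 ≤ 1 - Real.exp (-((δ + 1 / L) * Real.log (absNorm p))) := by
        rw [sub_nonneg, Real.exp_le_one_iff, neg_nonpos]; positivity
      rw [hrw p hp.1, hpow p hp.1]
      have h3 : Real.exp (δ * Real.log (absNorm p)) ≤ β := by
        rw [← Real.le_log_iff_exp_le hβ0, ← hδL]
        have : Real.log (absNorm p) ≤ L :=
          Real.log_le_log (by linarith) ((mem_PF K).1 hp.1).2.2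
        gcongr
      have h4 : 1 - Real.exp (-((δ + 1 / L) * Real.log (absNorm p))) ≤
          2 / L * Real.log (absNorm p) := by
        have h5 := Real.exp_pos (-((δ + 1 / L) * Real.log (absNorm p)))
        have h6 : (1 - η) * L ≤ Real.log (absNorm p) := by
          rw [← hla]; exact Real.log_le_log (by linarith) hp.2.le
        have h7 : 1 ≤ 2 / L * Real.log (absNorm p) := by
          rw [div_mul_eq_mul_div, le_div_iff₀ hL0]; nlinarith
        linarith
      have h5 : 0 ≤ 2 / L * Real.log (absNorm p) := by positivity
      calc _ ≤ (absNorm p : ℝ)⁻¹ * β * (2 / L * Real.log (absNorm p)) := by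
            gcongr
        _ = _ := by simp only [hg]; ring
    refine (Finset.sum_le_sum h1).trans ?_
    rw [← Finset.mul_sum]
    have h2 : ∑ p ∈ PF K Y with ¬ (absNorm p : ℝ) ≤ a, g p ≤ C1 * (2 * (η * L)) := by
      have h3 := hm a Y ha1 haY
      simp only [not_le]
      refine h3.trans ?_
      rw [hla]
      have : L - (1 - η) * L + 1 ≤ 2 * (η * L) := by linarith
      gcongr
    calc _ ≤ β * (2 / L) * (C1 * (2 * (η * L))) := by gcongr
      _ = 4 * β * (C1 * η) := by field_simp; ring
      _ = β / 4 := by rw [hηC]; ring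
  linarith

/-- Smooth ideal count bound. -/
theorem psi_bound (ε : ℝ) (hε : 0 < ε) :
    ∃ C : ℝ, 0 < C ∧ ∀ X Y : ℝ, 2 ≤ X → 2 ≤ Y →
      1 ≤ Real.log X / Real.log Y →
      Real.log X / Real.log Y ≤ Real.log X ^ (1 - ε) →
      (Psi K X Y : ℝ) ≤
        C * X * Real.exp (-(Real.log X / Real.log Y) *
          Real.log ((Real.log X / Real.log Y) / 2)) := by
  obtain ⟨C0, hC0, htriv⟩ := psi_trivial K
  obtain ⟨C2, hC2, hpsi⟩ := psi_log_le K
  obtain ⟨C3, L3, hC3, hL3, heul⟩ := euler_compare K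
  obtain ⟨C4, L4, hC4, hL4, hexp⟩ := exponent_est K
  obtain ⟨T, hT⟩ : ∃ T : ℝ, ∀ L : ℝ, T ≤ L → Real.log L ≤ ε / 4 * L := by
    have h := (Real.isLittleO_log_id_atTop).bound (show 0 < ε / 4 by positivity)
    obtain ⟨T, hT⟩ := (h.and (eventually_ge_atTop 0)).exists_forall_of_atTop
    refine ⟨T, fun L hL => ?_⟩
    obtain ⟨h1, h2⟩ := hT L hL
    simp only [id, Real.norm_eq_abs, abs_of_nonneg h2] at h1
    exact (le_abs_self _).trans h1
  set L1 := max T (max L3 L4) with hL1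
  have hL13 : L3 ≤ L1 := (le_max_left _ _).trans (le_max_right _ _)
  have hL14 : L4 ≤ L1 := (le_max_right _ _).trans (le_max_right _ _)
  have hL1T : T ≤ L1 := le_max_left _ _
  have hl2 : 1 / 2 < Real.log 2 := by linarith [Real.log_two_gt_d9]
  set Λ := Real.log L1 + |Real.log (Real.log 2)| with hΛ
  have hΛ0 : 0 ≤ Λ := add_nonneg (Real.log_nonneg (by linarith)) (abs_nonneg _)
  set G := |1 - ε| * Λ / ε with hG
  have hG0 : 0 ≤ G := by positivity
  refine ⟨C0 * Real.exp (Real.exp G * G) + C2 * C3 * Real.exp C4, by positivity,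
    fun X Y hX hY hβ1 hβ2 => ?_⟩
  set lx := Real.log X with hlx
  set L := Real.log Y with hL
  set β := lx / L with hβ
  have hX0 : 0 < X := by linarith
  have hY0 : 0 < Y := by linarith
  have hlx0 : 0 < lx := Real.log_pos (by linarith)
  have hLlow : Real.log 2 ≤ L := Real.log_le_log (by norm_num) hY
  have hL0 : 0 < L := by linarith
  have hβ0 : 0 < β := by linarith
  have hlxe : lx = β * L := by rw [hβ]; field_simp
  have hlβ := Real.log_nonneg hβ1
  have hkey : ε * Real.log β ≤ (1 - ε) * Real.log L := by
    have h1 := Real.log_le_log hβ0 hβ2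
    rw [Real.log_rpow hlx0, hlxe, Real.log_mul hβ0.ne' hL0.ne'] at h1
    linarith
  have hlog2 : Real.log (β / 2) = Real.log β - Real.log 2 := Real.log_div hβ0.ne' (by norm_num)
  rcases le_total L1 L with hcase | hcase
  · have hlL : 0 ≤ Real.log L := Real.log_nonneg (by linarith)
    have hTL := hT L (hL1T.trans hcase)
    have hδ : Real.log β / L ≤ 1 / 4 := by
      rw [div_le_iff₀ hL0]
      have h2 : ε * Real.log β ≤ ε * (1 / 4 * L) := by nlinarith
      exact le_of_mul_le_mul_left h2 hε
    have hδ0 : 0 ≤ Real.log β / L := by positivity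
    have h1 := hpsi X Y (Real.log β / L) hX hY0 (by linarith) hδ0 (by linarith)
    have h2 := heul Y (Real.log β / L) hY0 (by linarith) hδ0 hδ
    have h3 := hexp Y β hY0 (by linarith) hβ1
    have hYd : Y ^ (Real.log β / L) = β := by
      rw [Real.rpow_def_of_pos hY0, ← hL, mul_div_cancel₀ _ hL0.ne', Real.exp_log hβ0]
    have hXd : X ^ (1 - Real.log β / L) = X * Real.exp (-(β * Real.log β)) := by
      rw [sub_eq_add_neg, Real.rpow_add hX0, Real.rpow_one, Real.rpow_def_of_pos hX0, ← hlx, hlxe]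
      congr 2
      field_simp
    rw [hYd, hXd] at h1
    have h4 : (Psi K X Y : ℝ) * (β * L) ≤
        (C2 * C3 * Real.exp C4 * X * Real.exp (-(β * Real.log β) + β / 2)) * (β * L) := by
      rw [← hlxe]
      refine h1.trans ?_
      calc _ ≤ C2 * (X * Real.exp (-(β * Real.log β))) * β *
            (C3 * L * Real.exp (β / 2 + C4)) := by
            gcongr
            refine h2.trans ?_
            gcongr
        _ = _ := by rw [hlxe, Real.exp_add, Real.exp_add]; ring
    have h5 := le_of_mul_le_mul_right h4 (by positivity)
    refine h5.trans ?_
    have h6 : Real.exp (-(β * Real.log β) + β / 2) ≤ Real.exp (-β * Real.log (β / 2)) := by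
      rw [Real.exp_le_exp, hlog2]; nlinarith
    have h7 : 0 ≤ C0 * Real.exp (Real.exp G * G) := by positivity
    gcongr
    linarith
  · have habs : |Real.log L| ≤ Λ := by
      rw [abs_le]
      have h1 := Real.log_le_log hL0 hcase
      have h2 := Real.log_le_log (by linarith) hLlow
      have h3 := neg_abs_le (Real.log (Real.log 2))
      have h4 : 0 ≤ Real.log L1 := Real.log_nonneg (by linarith)
      have h5 := abs_nonneg (Real.log (Real.log 2))
      constructor <;> linarith
    have hβG : Real.log β ≤ G := by
      rw [hG, le_div_iff₀ hε, mul_comm]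
      refine hkey.trans ((le_abs_self _).trans ?_)
      rw [abs_mul]
      gcongr
    have hβe : β ≤ Real.exp G := (Real.log_le_iff_le_exp hβ0).1 hβG
    have h1 : β * Real.log β ≤ Real.exp G * G := by gcongr
    have h2 : 1 ≤ Real.exp (Real.exp G * G) * Real.exp (-β * Real.log (β / 2)) := by
      rw [← Real.exp_add]
      refine Real.one_le_exp ?_
      rw [hlog2]; nlinarith
    have h3 := htriv X Y hX
    have h4 : 0 ≤ C2 * C3 * Real.exp C4 * X * Real.exp (-β * Real.log (β / 2)) := by positivity
    calc (Psi K X Y : ℝ) ≤ C0 * X * 1 := by linarith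
      _ ≤ C0 * X * (Real.exp (Real.exp G * G) * Real.exp (-β * Real.log (β / 2))) := by gcongr
      _ ≤ _ := by linarith

end AlladiGen
end
end
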